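/- For every ε > 0 there exist η > 0 and n₀ ∈ ℕ such that for all n ≥ n₀ the following holds: if φ is an edge-colouring of the complete graph K_n that is (1−ε)n/2-bounded and locally ηn/(log n)⁴-bounded, then K_n contains a Hamilton cycle that is rainbow with respect to φ; and if moreover 3 divides n, then K_n also contains a rainbow triangle-factor, i.e. a spanning collection of n/3 vertex-disjoint triangles all of whose n edges receive pairwise distinct colours. -/

import Mathlib

namespace Paper

variable {V : Type*} {W : Type*} {C : Type*}

/-- The set of edges of `G` receiving colour `c` under `φ`. -/
def colourCls (G : SimpleGraph V) (φ : Sym2 V → C) (c : C) : Set (Sym2 V) :=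
  {e | e ∈ G.edgeSet ∧ φ e = c}

/-- `φ` is a (globally) `g`-bounded edge-colouring of `G`:
every colour is used on at most `g` edges. -/
def GBounded (G : SimpleGraph V) (φ : Sym2 V → C) (g : ℝ) : Prop :=
  ∀ c : C, ((colourCls G φ c).ncard : ℝ) ≤ g

/-- `φ` is a locally `l`-bounded edge-colouring of `G`:
every vertex is incident to at most `l` edges of each colour. -/
def LBounded (G : SimpleGraph V) (φ : Sym2 V → C) (l : ℝ) : Prop :=
  ∀ (v : V) (c : C), (({u | G.Adj v u ∧ φ s(v, u) = c}).ncard : ℝ) ≤ l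

/-- A set of edges is rainbow if the colouring is injective on it. -/
def Rainbow (φ : Sym2 V → C) (E : Set (Sym2 V)) : Prop :=
  Set.InjOn φ E

/-- The set of common neighbours `w` of `u` and `v` with `φ(uw) = φ(vw)`. -/
def monoSet (G : SimpleGraph V) (φ : Sym2 V → C) (u v : V) : Set V :=
  {w | G.Adj u w ∧ G.Adj v w ∧ φ s(u, w) = φ s(v, w)}

/-- The monochromatic codegree `c^φ_G(u,v)`. -/
noncomputable def monoCodeg (G : SimpleGraph V) (φ : Sym2 V → C) (u v : V) : ℕ :=
  (monoSet G φ u v).ncard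

/-- Degree of `u` into the set `S`. -/
noncomputable def degIn (G : SimpleGraph V) (u : V) (S : Set V) : ℕ :=
  (G.neighborSet u ∩ S).ncard

/-- Codegree of `u,v` into the set `S`. -/
noncomputable def codegIn (G : SimpleGraph V) (u v : V) (S : Set V) : ℕ :=
  (G.neighborSet u ∩ G.neighborSet v ∩ S).ncard

/-- `G` restricted to `S` is `(ε,d)`-quasirandom: all degrees (within `S`)
are `(d ± ε)|S|` and all but at most `ε|S|²` unordered pairs of distinct
vertices of `S` have codegree (within `S`) equal to `(d² ± ε)|S|`. -/
def QuasirandomOn (G : SimpleGraph V) (S : Set V) (ε d : ℝ) : Prop :=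
  (∀ v ∈ S, |(degIn G v S : ℝ) - d * S.ncard| ≤ ε * S.ncard) ∧
  ((({p : Sym2 V | ∃ u v, p = s(u, v) ∧ u ≠ v ∧ u ∈ S ∧ v ∈ S ∧
        ¬ (|(codegIn G u v S : ℝ) - d ^ 2 * S.ncard| ≤ ε * S.ncard)}).ncard : ℝ)
      ≤ ε * (S.ncard : ℝ) ^ 2)

/-- `G` is `(ε,d)`-quasirandom. -/
def Quasirandom (G : SimpleGraph V) (ε d : ℝ) : Prop :=
  QuasirandomOn G Set.univ ε d

/-- Edges of `G` with one endpoint in `X` and the other in `Y`. -/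
def edgesBetween (G : SimpleGraph V) (X Y : Set V) : Set (Sym2 V) :=
  {e | e ∈ G.edgeSet ∧ ∃ u v, e = s(u, v) ∧ u ∈ X ∧ v ∈ Y}

/-- The pair `(A,B)` is `(ε,d)`-regular in `G`. -/
def RegularPair (G : SimpleGraph V) (A B : Set V) (ε d : ℝ) : Prop :=
  ∀ X ⊆ A, ∀ Y ⊆ B, ε * A.ncard ≤ (X.ncard : ℝ) → ε * B.ncard ≤ (Y.ncard : ℝ) →
    |((edgesBetween G X Y).ncard : ℝ) / ((X.ncard : ℝ) * (Y.ncard : ℝ)) - d| ≤ ε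

/-- The pair `(A,B)` is `(ε,d)`-superregular in `G`. -/
def SuperregularPair (G : SimpleGraph V) (A B : Set V) (ε d : ℝ) : Prop :=
  RegularPair G A B ε d ∧
  (∀ u ∈ A, |(degIn G u B : ℝ) - d * B.ncard| ≤ ε * B.ncard) ∧
  (∀ v ∈ B, |(degIn G v A : ℝ) - d * A.ncard| ≤ ε * A.ncard)

/-- `H` is a copy of `F`: a subgraph of `G` isomorphic to `F`. -/
def IsCopy (F : SimpleGraph W) {G : SimpleGraph V} (H : G.Subgraph) : Prop :=
  Nonempty (F ≃g H.coe)

/-- `L` is the union of the family `𝒞` of pairwise vertex-disjoint copies of `F`. -/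
def IsFactorFrom (F : SimpleGraph W) {G : SimpleGraph V} (L : G.Subgraph)
    (𝒞 : Set G.Subgraph) : Prop :=
  (∀ H ∈ 𝒞, IsCopy F H) ∧
  𝒞.Pairwise (fun H₁ H₂ => Disjoint H₁.verts H₂.verts) ∧
  L = sSup 𝒞

/-- `L` consists of vertex-disjoint copies of `F`. -/
def IsFFactorSub (F : SimpleGraph W) {G : SimpleGraph V} (L : G.Subgraph) : Prop :=
  ∃ 𝒞 : Set G.Subgraph, IsFactorFrom F L 𝒞

/-- An `ε`-decomposition: pairwise edge-disjoint subgraphs of `G` which together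
contain all but at most an `ε`-proportion of the edges of `G`. -/
def ApxDecomp (G : SimpleGraph V) (ε : ℝ) {t : ℕ} (L : Fin t → G.Subgraph) : Prop :=
  (Pairwise fun i j => Disjoint (L i).edgeSet (L j).edgeSet) ∧
  ((G.edgeSet \ ⋃ i, (L i).edgeSet).ncard : ℝ) ≤ ε * (G.edgeSet.ncard : ℝ)

/-- `a(F) ≤ a`, where `a(F) = max {Δ(F), a'(F), a''(F)}`. -/
def AParamLe (F : SimpleGraph W) (a : ℕ) : Prop :=
  (∀ v, (F.neighborSet v).ncard ≤ a) ∧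
  (∀ u v, F.Adj u v →
    (F.neighborSet u).ncard + (F.neighborSet v).ncard - 2 ≤ a) ∧
  (∀ u v w, F.Adj u v → F.Adj v w → u ≠ w →
    (F.neighborSet u).ncard + (F.neighborSet v).ncard + (F.neighborSet w).ncard - 4 ≤ a)

end Paper

open Paper

namespace RainbowProof
open Finset

theorem exists_conflict_free {I Γ : Type*} [Fintype I] [Fintype Γ]
    (G : I → Finset Γ) (conf : I → Γ → I → Γ → Prop)
    (hsym : ∀ i g j g', conf i g j g' → conf j g' i g)
    (G0 : ℝ) (hG0 : 0 < G0) (hG : ∀ i, G0 ≤ (#(G i) : ℝ))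
    (cf : I → I → ℝ)
    (hcf : ∀ i j, i ≠ j → ∀ [DecidablePred fun q : Γ × Γ => conf i q.1 j q.2],
      (#{q ∈ G i ×ˢ G j | conf i q.1 j q.2} : ℝ) ≤ cf i j)
    (hcf0 : ∀ i j, 0 ≤ cf i j)
    (hsum : ∀ i, ∑ j, cf i j ≤ G0 ^ 2 / 4) :
    ∃ g : I → Γ, (∀ i, g i ∈ G i) ∧ ∀ i j, i ≠ j → ¬ conf i (g i) j (g j) := by
  classical
  have hne : ∀ i, (G i).Nonempty := fun i => by
    rw [← Finset.card_pos]
    have := hG i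
    exact_mod_cast hG0.trans_le this
  choose g0 hg0 using hne
  let Ω : Finset I → Finset (I → Γ) := fun S =>
    {g | (∀ i ∈ S, g i ∈ G i) ∧ (∀ i, i ∉ S → g i = g0 i) ∧
      ∀ i ∈ S, ∀ j ∈ S, i ≠ j → ¬ conf i (g i) j (g j)}
  have key : ∀ n : ℕ, ∀ S : Finset I, #S = n → ∀ v, v ∉ S →
      G0 / 2 * (#(Ω S) : ℝ) ≤ (#(Ω (insert v S)) : ℝ) := by
    intro n
    induction n using Nat.strong_induction_on with
    | _ n ih =>
    intro S hS v hv
    -- the pairs (old assignment, gadget for `v`) that conflict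
    let bad : Finset ((I → Γ) × Γ) :=
      {q ∈ Ω S ×ˢ G v | ∃ j ∈ S, conf v q.2 j (q.1 j)}
    have h1 : (#(Ω S ×ˢ G v \ bad)) ≤ #(Ω (insert v S)) := by
      apply Finset.card_le_card_of_injOn (fun q => Function.update q.1 v q.2)
      · rintro ⟨g, a⟩ hq
        simp only [bad, Ω, coe_sdiff, Set.mem_sdiff, mem_coe, mem_product, mem_filter, mem_univ,
          true_and, not_and, not_exists] at hq ⊢
        obtain ⟨⟨⟨hg1, hg2, hg3⟩, ha⟩, hb⟩ := hq
        have hb' := hb ⟨⟨hg1, hg2, hg3⟩, ha⟩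
        have hnev : ∀ i ∈ S, i ≠ v := fun i hi h => hv (h ▸ hi)
        refine ⟨?_, ?_, ?_⟩
        · intro i hi
          rcases mem_insert.1 hi with rfl | hi
          · simpa using ha
          · simpa [hnev i hi] using hg1 i hi
        · intro i hi
          have : i ≠ v := fun h => hi (by simp [h])
          simp only [Function.update_of_ne this]
          exact hg2 i (fun h => hi (mem_insert_of_mem h))
        · intro i hi j hj hij
          rcases mem_insert.1 hi with hi' | hi' <;> rcases mem_insert.1 hj with hj' | hj'
          · exact absurd (hi'.trans hj'.symm) hij
          · subst hi'
            simp only [Function.update_self, Function.update_of_ne (hnev j hj')]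
            exact hb' j hj'
          · subst hj'
            simp only [Function.update_self, Function.update_of_ne (hnev i hi')]
            exact fun h => hb' i hi' (hsym _ _ _ _ h)
          · simp only [Function.update_of_ne (hnev i hi'), Function.update_of_ne (hnev j hj')]
            exact hg3 i hi' j hj' hij
      · rintro ⟨g, a⟩ hq ⟨g', a'⟩ hq' h
        simp only [bad, Ω, coe_sdiff, Set.mem_sdiff, mem_coe, mem_product, mem_filter, mem_univ,
          true_and] at hq hq' h
        have ha : a = a' := by simpa using congrFun h v
        refine Prod.ext ?_ ha
        funext i
        by_cases hi : i = v
        · subst hi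
          simp only
          rw [hq.1.1.2.1 i hv, hq'.1.1.2.1 i hv]
        · simpa [hi] using congrFun h i
    have h2 : (#bad : ℝ) ≤ ∑ j ∈ S, cf v j * (2 / G0 * #(Ω S)) := by
      have hsub : bad ⊆ S.biUnion fun j =>
          ({q ∈ G v ×ˢ G j | conf v q.1 j q.2} : Finset (Γ × Γ)).biUnion fun q =>
            ({g ∈ Ω S | g j = q.2} : Finset (I → Γ)).image fun g => (g, q.1) := by
        rintro ⟨g, a⟩ hq
        simp only [bad, mem_filter, mem_product] at hq
        obtain ⟨⟨hg, ha⟩, j, hj, hc⟩ := hq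
        simp only [mem_biUnion, mem_filter, mem_product, mem_image, Prod.mk.injEq, Prod.exists]
        refine ⟨j, hj, a, g j, ⟨⟨ha, ?_⟩, hc⟩, g, ⟨hg, rfl⟩, rfl, rfl⟩
        simp only [Ω, mem_filter] at hg
        exact hg.2.1 j hj
      have h3 : (#bad : ℝ) ≤ ∑ j ∈ S,
          ∑ q ∈ ({q ∈ G v ×ˢ G j | conf v q.1 j q.2} : Finset (Γ × Γ)),
            (#({g ∈ Ω S | g j = q.2} : Finset (I → Γ)) : ℝ) := by
        have := (Finset.card_le_card hsub).trans Finset.card_biUnion_le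
        have h4 := this.trans (Finset.sum_le_sum fun j _ => Finset.card_biUnion_le.trans
          (Finset.sum_le_sum fun q _ => Finset.card_image_le))
        exact_mod_cast h4
      refine h3.trans (Finset.sum_le_sum fun j hj => ?_)
      have h5 : ∀ q ∈ ({q ∈ G v ×ˢ G j | conf v q.1 j q.2} : Finset (Γ × Γ)),
          (#({g ∈ Ω S | g j = q.2} : Finset (I → Γ)) : ℝ) ≤ 2 / G0 * #(Ω S) := by
        intro q _
        have h6 : #({g ∈ Ω S | g j = q.2} : Finset (I → Γ)) ≤ #(Ω (S.erase j)) := by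
          apply Finset.card_le_card_of_injOn (fun g => Function.update g j (g0 j))
          · intro g hg
            simp only [Ω, coe_filter, mem_filter, mem_univ, true_and, Set.mem_ofPred_eq] at hg ⊢
            obtain ⟨⟨hg1, hg2, hg3⟩, hg4⟩ := hg
            refine ⟨?_, ?_, ?_⟩
            · intro i hi
              rw [Function.update_of_ne (Finset.ne_of_mem_erase hi)]
              exact hg1 i (Finset.mem_of_mem_erase hi)
            · intro i hi
              by_cases hij : i = j
              · subst hij; simp
              · rw [Function.update_of_ne hij]
                exact hg2 i fun h => hi (Finset.mem_erase.2 ⟨hij, h⟩)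
            · intro i hi k hk hik
              rw [Function.update_of_ne (Finset.ne_of_mem_erase hi),
                Function.update_of_ne (Finset.ne_of_mem_erase hk)]
              exact hg3 i (Finset.mem_of_mem_erase hi) k (Finset.mem_of_mem_erase hk) hik
          · intro g hg g' hg' h
            simp only [coe_filter, Set.mem_ofPred_eq] at hg hg' h
            funext i
            by_cases hij : i = j
            · subst hij; rw [hg.2, hg'.2]
            · simpa [hij] using congrFun h i
        have h7 := ih #(S.erase j) (by rw [← hS]; exact Finset.card_erase_lt_of_mem hj)
          (S.erase j) rfl j (Finset.notMem_erase j S)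
        rw [Finset.insert_erase hj] at h7
        have h8 : (#({g ∈ Ω S | g j = q.2} : Finset (I → Γ)) : ℝ) ≤ #(Ω (S.erase j)) := by
          exact_mod_cast h6
        refine h8.trans ?_
        rw [div_mul_eq_mul_div, le_div_iff₀ hG0]
        linarith
      refine (Finset.sum_le_sum h5).trans ?_
      rw [Finset.sum_const, nsmul_eq_mul]
      refine mul_le_mul_of_nonneg_right (hcf v j fun h => hv (h ▸ hj)) (by positivity)
    have h3 : (#bad : ℝ) ≤ G0 / 2 * #(Ω S) := by
      refine h2.trans ?_
      rw [← Finset.sum_mul]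
      have h9 : ∑ j ∈ S, cf v j ≤ G0 ^ 2 / 4 :=
        (Finset.sum_le_sum_of_subset_of_nonneg (Finset.subset_univ S)
          fun j _ _ => hcf0 v j).trans (hsum v)
      refine (mul_le_mul_of_nonneg_right h9 (by positivity)).trans (le_of_eq ?_)
      field_simp
      ring
    have h4 : (#(Ω S ×ˢ G v) : ℝ) ≤ #(Ω S ×ˢ G v \ bad) + #bad := by
      have : #(Ω S ×ˢ G v) ≤ #(Ω S ×ˢ G v \ bad) + #bad := by
        have := Finset.le_card_sdiff bad (Ω S ×ˢ G v)
        omega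
      exact_mod_cast this
    have h5 : (#(Ω S ×ˢ G v \ bad) : ℝ) ≤ #(Ω (insert v S)) := by exact_mod_cast h1
    rw [Finset.card_product] at h4
    push_cast at h4
    have h6 : (#(Ω S) : ℝ) * G0 ≤ #(Ω S) * #(G v) :=
      mul_le_mul_of_nonneg_left (hG v) (by positivity)
    linarith
  have pos : ∀ S : Finset I, 0 < #(Ω S) := by
    intro S
    induction S using Finset.induction_on with
    | empty =>
      refine Finset.card_pos.2 ⟨g0, ?_⟩
      simp [Ω]
    | insert v S hv ih =>
      have := key _ S rfl v hv
      have h : (0 : ℝ) < #(Ω S) := by exact_mod_cast ih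
      have : (0 : ℝ) < #(Ω (insert v S)) := lt_of_lt_of_le (by positivity) this
      exact_mod_cast this
  obtain ⟨g, hg⟩ := Finset.card_pos.1 (pos univ)
  simp only [Ω, mem_filter, mem_univ, true_and, forall_const] at hg
  exact ⟨g, hg.1, fun i j => hg.2.2 i j⟩


theorem sum_exp_le_of_sum_eq_zero {A : Type*} [Fintype A] (u : A → ℝ) (t c : ℝ)
    (hu : ∑ a, u a = 0) (hc : ∀ a, |u a| ≤ c) (ht : 0 ≤ t) (htc : t * c ≤ 1) :
    ∑ a, Real.exp (t * u a) ≤ Fintype.card A * Real.exp (t ^ 2 * c ^ 2) := by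
  have h1 : ∀ a, Real.exp (t * u a) ≤ 1 + t * u a + t ^ 2 * c ^ 2 := by
    intro a
    have h2 : |t * u a| ≤ t * c := by
      rw [abs_mul, abs_of_nonneg ht]
      exact mul_le_mul_of_nonneg_left (hc a) ht
    have h3 := Real.abs_exp_sub_one_sub_id_le (h2.trans htc)
    have h4 : (t * u a) ^ 2 ≤ t ^ 2 * c ^ 2 := by
      rw [← mul_pow, ← sq_abs (t * u a)]
      exact pow_le_pow_left₀ (abs_nonneg _) h2 2
    have := le_abs_self (Real.exp (t * u a) - 1 - t * u a)
    linarith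
  calc ∑ a, Real.exp (t * u a) ≤ ∑ a, (1 + t * u a + t ^ 2 * c ^ 2) :=
        Finset.sum_le_sum fun a _ => h1 a
    _ = Fintype.card A * (1 + t ^ 2 * c ^ 2) := by
        rw [Finset.sum_add_distrib, Finset.sum_add_distrib, ← Finset.mul_sum, hu]
        simp
        ring
    _ ≤ _ := by
        refine mul_le_mul_of_nonneg_left ?_ (by positivity)
        linarith [Real.add_one_le_exp (t ^ 2 * c ^ 2)]

/-- A bounded-difference inequality for a uniformly random function `X → A`. -/
theorem sum_exp_boundedDiff {A : Type} [Fintype A] [Nonempty A] (X : Type) [Finite X] :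
    ∀ [Fintype X] [DecidableEq X] (g : (X → A) → ℝ) (c : X → ℝ) (t : ℝ)
    (_ : ∀ x κ a, |g (Function.update κ x a) - g κ| ≤ c x) (_ : 0 ≤ t)
    (_ : ∀ x, t * c x ≤ 1),
    ∑ κ, Real.exp (t * (g κ - (∑ κ', g κ') / Fintype.card (X → A))) ≤
      Fintype.card (X → A) * Real.exp (t ^ 2 * ∑ x, c x ^ 2) := by
  induction X using Finite.induction_empty_option with
  | @of_equiv X Y e ih =>
    intro _ _ g c t hg ht htc
    let _ := Fintype.ofEquiv Y e.symm
    let _ := Classical.decEq X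
    let E : (X → A) ≃ (Y → A) := Equiv.arrowCongr e (Equiv.refl A)
    have hE : ∀ κ y, E κ y = κ (e.symm y) := fun κ y => rfl
    have := ih (fun κ => g (E κ)) (fun x => c (e x)) t (by
      intro x κ a
      have : E (Function.update κ x a) = Function.update (E κ) (e x) a := by
        funext y
        rw [hE]
        by_cases h : y = e x
        · subst h; simp
        · have h' : e.symm y ≠ x := fun h' => h (by rw [← h']; simp)
          simp [h, h', hE]
      simp only [this]
      exact hg _ _ _) ht (fun x => htc _)
    rw [E.sum_comp (fun κ => g κ), Fintype.card_congr E, e.sum_comp (fun y => c y ^ 2)] at this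
    rwa [E.sum_comp (fun κ => Real.exp (t * (g κ - (∑ κ', g κ') / Fintype.card (Y → A))))] at this
  | h_empty =>
    intro _ _ g c t hg ht htc
    simp
  | @h_option X _ ih =>
    intro instF instD g c t hg ht htc
    obtain rfl : instF = instFintypeOption := Subsingleton.elim _ _
    let _ := Classical.decEq X
    let E : (Option X → A) ≃ A × (X → A) := Equiv.piOptionEquivProd
    let G : A → (X → A) → ℝ := fun a κ => g (E.symm (a, κ))
    let h : (X → A) → ℝ := fun κ => (∑ a, G a κ) / Fintype.card A
    have hA : (0 : ℝ) < Fintype.card A := by exact_mod_cast Fintype.card_pos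
    have hu1 : ∀ a a' κ, E.symm (a', κ) = Function.update (E.symm (a, κ)) none a' := by
      intro a a' κ
      funext x
      cases x <;> simp [E, Equiv.piOptionEquivProd]
    have hu2 : ∀ a κ x b, E.symm (a, Function.update κ x b) =
        Function.update (E.symm (a, κ)) (some x) b := by
      intro a κ x b
      funext y
      cases y with
      | none => simp [E, Equiv.piOptionEquivProd]
      | some y =>
        by_cases hy : y = x
        · subst hy; simp [E, Equiv.piOptionEquivProd]
        · simp [E, Equiv.piOptionEquivProd, hy]
    have hdh : ∀ x κ a, |h (Function.update κ x a) - h κ| ≤ c (some x) := by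
      intro x κ b
      simp only [h, G]
      rw [← sub_div, ← Finset.sum_sub_distrib, abs_div, abs_of_pos hA, div_le_iff₀ hA]
      refine (Finset.abs_sum_le_sum_abs _ _).trans ?_
      refine (Finset.sum_le_sum (g := fun _ => c (some x)) fun a _ => ?_).trans ?_
      · rw [hu2]; exact hg _ _ _
      · simp [mul_comm]
    have hdu : ∀ κ a, |G a κ - h κ| ≤ c none := by
      intro κ a
      have : G a κ - h κ = (∑ a', (G a κ - G a' κ)) / Fintype.card A := by
        rw [Finset.sum_sub_distrib]
        simp only [h, sum_const, card_univ, nsmul_eq_mul]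
        field_simp
      rw [this, abs_div, abs_of_pos hA, div_le_iff₀ hA]
      refine (Finset.abs_sum_le_sum_abs _ _).trans ?_
      refine (Finset.sum_le_sum (g := fun _ => c none) fun a' _ => ?_).trans ?_
      · simp only [G]
        rw [hu1 a' a κ]; exact hg _ _ _
      · simp [mul_comm]
    have hsum0 : ∀ κ, ∑ a, (G a κ - h κ) = 0 := by
      intro κ
      rw [Finset.sum_sub_distrib]
      simp only [h, sum_const, card_univ, nsmul_eq_mul]
      field_simp
      simp
    have hcard : Fintype.card (Option X → A) = Fintype.card A * Fintype.card (X → A) := by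
      rw [Fintype.card_congr E, Fintype.card_prod]
    have havg : (∑ κ', g κ') / Fintype.card (Option X → A) =
        (∑ κ, h κ) / Fintype.card (X → A) := by
      rw [hcard, ← E.symm.sum_comp g, Fintype.sum_prod_type_right]
      simp only [h, G]
      rw [← Finset.sum_div]
      push_cast
      rw [div_div]
    rw [havg, ← E.symm.sum_comp, Fintype.sum_prod_type_right]
    set μ := (∑ κ, h κ) / Fintype.card (X → A) with hμ
    have h1 : ∀ κ : X → A, ∑ a, Real.exp (t * (g (E.symm (a, κ)) - μ)) ≤
        Real.exp (t * (h κ - μ)) * (Fintype.card A * Real.exp (t ^ 2 * c none ^ 2)) := by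
      intro κ
      have := sum_exp_le_of_sum_eq_zero (fun a => G a κ - h κ) t (c none) (hsum0 κ) (hdu κ) ht
        (htc none)
      refine le_trans (le_of_eq ?_) (mul_le_mul_of_nonneg_left this (Real.exp_pos _).le)
      rw [Finset.mul_sum]
      refine Finset.sum_congr rfl fun a _ => ?_
      rw [← Real.exp_add]
      congr 1
      simp only [G]
      ring
    refine (Finset.sum_le_sum fun κ _ => h1 κ).trans ?_
    rw [← Finset.sum_mul]
    have := ih h (fun x => c (some x)) t hdh ht (fun x => htc _)
    refine (mul_le_mul_of_nonneg_right this (by positivity)).trans (le_of_eq ?_)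
    rw [hcard, Fintype.sum_option, mul_add, Real.exp_add]
    push_cast
    ring

theorem card_deviation_le {A X : Type} [Fintype A] [Nonempty A] [Fintype X] [DecidableEq X]
    (g : (X → A) → ℝ) (c : X → ℝ) (t d μ : ℝ)
    (hg : ∀ x κ a, |g (Function.update κ x a) - g κ| ≤ c x) (ht : 0 ≤ t)
    (htc : ∀ x, t * c x ≤ 1) (hμ : ∑ κ, g κ = μ * Fintype.card (X → A)) :
    (#{κ | d < |g κ - μ|} : ℝ) ≤
      2 * Fintype.card (X → A) * Real.exp (t ^ 2 * ∑ x, c x ^ 2 - t * d) := by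
  have hpos : (0 : ℝ) < Fintype.card (X → A) := by exact_mod_cast Fintype.card_pos
  have hμ' : (∑ κ, g κ) / Fintype.card (X → A) = μ := by rw [hμ]; field_simp
  have h1 := sum_exp_boundedDiff X g c t hg ht htc
  have h2 := sum_exp_boundedDiff X (fun κ => -g κ) c t (fun x κ a => by
    have := hg x κ a
    rw [← abs_neg] at this
    convert this using 2
    ring) ht htc
  rw [Finset.sum_neg_distrib, neg_div] at h2
  rw [hμ'] at h1 h2
  have h3 : (#{κ | d < |g κ - μ|} : ℝ) * Real.exp (t * d) ≤
      ∑ κ, Real.exp (t * (g κ - μ)) + ∑ κ, Real.exp (t * (-g κ - -μ)) := by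
    rw [← Finset.sum_add_distrib, ← nsmul_eq_mul, ← Finset.sum_const]
    refine (Finset.sum_le_sum (g := fun κ =>
      Real.exp (t * (g κ - μ)) + Real.exp (t * (-g κ - -μ))) ?_).trans
      (Finset.sum_le_sum_of_subset_of_nonneg (Finset.subset_univ _) ?_)
    · intro κ hκ
      simp only [mem_filter, mem_univ, true_and] at hκ
      rcases lt_abs.1 hκ with h | h
      · have : Real.exp (t * d) ≤ Real.exp (t * (g κ - μ)) :=
          Real.exp_le_exp.2 (mul_le_mul_of_nonneg_left h.le ht)
        linarith [Real.exp_pos (t * (-g κ - -μ))]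
      · have : Real.exp (t * d) ≤ Real.exp (t * (-g κ - -μ)) :=
          Real.exp_le_exp.2 (mul_le_mul_of_nonneg_left (by linarith) ht)
        linarith [Real.exp_pos (t * (g κ - μ))]
    · intro κ _ _; positivity
  rw [Real.exp_sub, ← mul_div_assoc, le_div_iff₀ (Real.exp_pos _)]
  linarith

theorem card_extend_mem {X : Type} [Fintype X] [DecidableEq X] {m r : ℕ}
    (c : Fin r → X) (hc : Function.Injective c) (s : Fin r → Finset (Fin m)) (hm : 0 < m) :
    (#{κ : X → Fin m | ∀ i, κ (c i) ∈ s i} : ℝ) =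
      (∏ i, (#(s i) : ℝ) / m) * Fintype.card (X → Fin m) := by
  let S : X → Finset (Fin m) := Function.extend c s (fun _ => univ)
  have h1 : ({κ : X → Fin m | ∀ i, κ (c i) ∈ s i} : Finset (X → Fin m)) =
      Fintype.piFinset S := by
    ext κ
    simp only [mem_filter, mem_univ, true_and, Fintype.mem_piFinset]
    constructor
    · intro h x
      by_cases hx : ∃ i, c i = x
      · obtain ⟨i, rfl⟩ := hx
        simpa [S, hc.extend_apply] using h i
      · simp [S, Function.extend_apply' _ _ _ hx]
    · intro h i
      have := h (c i)
      simpa [S, hc.extend_apply] using this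
  have hm' : (m : ℝ) ≠ 0 := by positivity
  have h2 : ∏ i, (#(s i) : ℝ) / m = ∏ x, (#(S x) : ℝ) / m := by
    have h3 : ∏ i, (#(s i) : ℝ) / m = ∏ x ∈ univ.map ⟨c, hc⟩, (#(S x) : ℝ) / m := by
      rw [Finset.prod_map]
      refine Finset.prod_congr rfl fun i _ => ?_
      simp [S, hc.extend_apply]
    rw [h3]
    refine Finset.prod_subset (Finset.subset_univ _) fun x _ hx => ?_
    have hx' : ¬ ∃ i, c i = x := by simpa using hx
    simp [S, Function.extend_apply' _ _ _ hx', hm']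
  have h4 : (Fintype.card (X → Fin m) : ℝ) = (m : ℝ) ^ Fintype.card X := by
    rw [Fintype.card_fun, Fintype.card_fin, Nat.cast_pow]
  have h5 : (m : ℝ) ^ Fintype.card X ≠ 0 := pow_ne_zero _ hm'
  rw [h1, Fintype.card_piFinset, h4, h2, Finset.prod_div_distrib, Finset.prod_const, card_univ,
    Nat.cast_prod, div_mul_cancel₀ _ h5]

/-- Concentration for the number of configurations whose colours fall into prescribed classes of a
random partition of the colours. -/
theorem card_lottery_bad_le {β X : Type} [Fintype X] [DecidableEq X] {m r : ℕ}
    (hm : 0 < m) (hr : 0 < r) (B : Finset β) (col : β → Fin r → X)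
    (hinj : ∀ b ∈ B, Function.Injective (col b)) (s : Fin r → Finset (Fin m))
    (G Λ δ : ℝ) (hG : 0 < G) (hΛ : 0 < Λ) (hδ : 0 < δ) (hδ1 : δ ≤ 1) (hB : (#B : ℝ) ≤ G)
    (hcol : ∀ i x, (#{b ∈ B | col b i = x} : ℝ) ≤ G / Λ) :
    (#{κ : X → Fin m | δ * G <
      |(#{b ∈ B | ∀ i, κ (col b i) ∈ s i} : ℝ) - #B * ∏ i, (#(s i) : ℝ) / m|} : ℝ) ≤
      2 * Fintype.card (X → Fin m) * Real.exp (-(δ ^ 2 * Λ / (4 * r ^ 2))) := by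
  classical
  have : Nonempty (Fin m) := ⟨⟨0, hm⟩⟩
  have hr' : (1 : ℝ) ≤ r := by exact_mod_cast hr
  let c : X → ℝ := fun x => (#{b ∈ B | ∃ i, col b i = x} : ℝ)
  have hc0 : ∀ x, 0 ≤ c x := fun x => by positivity
  have hc' : ∀ x, c x ≤ ∑ i, (#{b ∈ B | col b i = x} : ℝ) := by
    intro x
    have h1 : #{b ∈ B | ∃ i, col b i = x} ≤ ∑ i, #{b ∈ B | col b i = x} := by
      refine (Finset.card_le_card ?_).trans Finset.card_biUnion_le
      intro b
      simp
    simp only [c]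
    exact_mod_cast h1
  have hc1 : ∀ x, c x ≤ r * (G / Λ) := by
    intro x
    refine (hc' x).trans ((Finset.sum_le_sum fun i _ => hcol i x).trans ?_)
    simp
  have hc2 : ∑ x, c x ≤ r * G := by
    refine (Finset.sum_le_sum fun x _ => hc' x).trans ?_
    rw [Finset.sum_comm]
    have h2 : ∀ i, ∑ x, (#{b ∈ B | col b i = x} : ℝ) = #B := by
      intro i
      have := Finset.card_eq_sum_card_fiberwise (f := fun b => col b i) (s := B) (t := univ)
        (fun _ _ => by simp)
      exact_mod_cast this.symm
    simp only [h2, sum_const, card_univ, Fintype.card_fin, nsmul_eq_mul]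
    exact mul_le_mul_of_nonneg_left hB (by positivity)
  have hc3 : ∑ x, c x ^ 2 ≤ r ^ 2 * G ^ 2 / Λ := by
    calc ∑ x, c x ^ 2 ≤ ∑ x, (r * (G / Λ)) * c x := Finset.sum_le_sum fun x _ => by
          rw [sq]; exact mul_le_mul_of_nonneg_right (hc1 x) (hc0 x)
      _ ≤ (r * (G / Λ)) * (r * G) := by
          rw [← Finset.mul_sum]
          exact mul_le_mul_of_nonneg_left hc2 (by positivity)
      _ = _ := by field_simp
  set t : ℝ := δ / (2 * r ^ 2) * (Λ / G) with ht
  have ht0 : 0 ≤ t := by positivity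
  refine (card_deviation_le (fun κ => (#{b ∈ B | ∀ i, κ (col b i) ∈ s i} : ℝ)) c t (δ * G)
    (#B * ∏ i, (#(s i) : ℝ) / m) ?_ ht0 ?_ ?_).trans ?_
  · intro x κ a
    have h1 : ∀ κ κ' : X → Fin m, (∀ y, y ≠ x → κ y = κ' y) →
        (#{b ∈ B | ∀ i, κ (col b i) ∈ s i} : ℝ) - #{b ∈ B | ∀ i, κ' (col b i) ∈ s i} ≤ c x := by
      intro κ κ' h
      have h2 : #{b ∈ B | ∀ i, κ (col b i) ∈ s i} ≤
          #{b ∈ B | ∃ i, col b i = x} + #{b ∈ B | ∀ i, κ' (col b i) ∈ s i} := by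
        refine (Finset.card_le_card ?_).trans (Finset.card_union_le _ _)
        intro b hb
        simp only [mem_filter, mem_union] at hb ⊢
        by_cases hx : ∃ i, col b i = x
        · exact Or.inl ⟨hb.1, hx⟩
        · push Not at hx
          exact Or.inr ⟨hb.1, fun i => h _ (hx i) ▸ hb.2 i⟩
      have h3 : (#{b ∈ B | ∀ i, κ (col b i) ∈ s i} : ℝ) ≤
          c x + #{b ∈ B | ∀ i, κ' (col b i) ∈ s i} := by
        simp only [c]
        exact_mod_cast h2
      linarith
    rw [abs_le]
    constructor
    · have := h1 κ (Function.update κ x a) (fun y hy => by simp [hy])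
      linarith
    · exact h1 (Function.update κ x a) κ (fun y hy => by simp [hy])
  · intro x
    calc t * c x ≤ t * (r * (G / Λ)) := mul_le_mul_of_nonneg_left (hc1 x) ht0
      _ = δ / (2 * r) := by rw [ht]; field_simp
      _ ≤ 1 := by rw [div_le_one (by positivity)]; linarith
  · have h1 : ∑ κ : X → Fin m, (#{b ∈ B | ∀ i, κ (col b i) ∈ s i} : ℝ) =
        ∑ b ∈ B, (#{κ : X → Fin m | ∀ i, κ (col b i) ∈ s i} : ℝ) := by
      simp only [card_filter]
      push_cast
      rw [Finset.sum_comm]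
    rw [h1, Finset.sum_congr rfl fun b hb => card_extend_mem (col b) (hinj b hb) s hm]
    simp [mul_assoc]
  · refine mul_le_mul_of_nonneg_left (Real.exp_le_exp.2 ?_) (by positivity)
    have h1 : t ^ 2 * ∑ x, c x ^ 2 ≤ t ^ 2 * (r ^ 2 * G ^ 2 / Λ) :=
      mul_le_mul_of_nonneg_left hc3 (by positivity)
    have h2 : t ^ 2 * (r ^ 2 * G ^ 2 / Λ) - t * (δ * G) = -(δ ^ 2 * Λ / (4 * r ^ 2)) := by
      rw [ht]
      field_simp
      ring
    linarith

/-- If at most `R` values of the coordinate `j` make `P` true, then `P` is rare. -/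
theorem card_filter_mul_le {V : Type} [Fintype V] [DecidableEq V] {d : ℕ}
    (S : Finset (Fin d → V)) (j : Fin d)
    (hS : ∀ b ∈ S, ∀ v, Function.update b j v ∈ S) (P : (Fin d → V) → Prop) [DecidablePred P]
    (R : ℝ) (hR : ∀ b ∈ S, (#{v | P (Function.update b j v)} : ℝ) ≤ R) :
    (#{b ∈ S | P b} : ℝ) * Fintype.card V ≤ #S * R := by
  have h1 : #({b ∈ S | P b} ×ˢ (univ : Finset V)) ≤
      #(S.sigma fun b => ({v | P (Function.update b j v)} : Finset V)) := by
    refine Finset.card_le_card_of_injOn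
      (fun q => ⟨Function.update q.1 j q.2, q.1 j⟩) ?_ ?_
    · rintro ⟨b, v⟩ hq
      simp only [coe_product, coe_filter, coe_univ, Set.mem_prod, Set.mem_ofPred_eq,
        Set.mem_univ, and_true] at hq
      simp [hS b hq.1, hq.2]
    · rintro ⟨b, v⟩ _ ⟨b', v'⟩ _ h
      simp only [Sigma.mk.injEq, heq_eq_eq] at h
      have hv : v = v' := by simpa using congrFun h.1 j
      have hb : b = b' := by
        funext i
        by_cases hi : i = j
        · rw [hi]; exact h.2
        · simpa [hi] using congrFun h.1 i
      rw [hv, hb]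
  rw [Finset.card_product, Finset.card_sigma, card_univ] at h1
  have h2 : (#{b ∈ S | P b} : ℝ) * Fintype.card V ≤
      ∑ b ∈ S, (#{v | P (Function.update b j v)} : ℝ) := by exact_mod_cast h1
  refine h2.trans ((Finset.sum_le_sum hR).trans ?_)
  simp

theorem weighted_exp_le {Act : Type*} [Fintype Act] (p Δ : Act → ℝ) (hp : ∀ a, 0 ≤ p a)
    (hp1 : ∑ a, p a = 1) (l B E μ : ℝ) (hl : 0 ≤ l) (hlB : l * B ≤ 1)
    (hB : ∀ a, |Δ a| ≤ B) (hE : ∑ a, p a * |Δ a| ≤ E) (hμ : ∑ a, p a * Δ a ≤ μ)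
    (hB0 : 0 ≤ B) :
    ∑ a, p a * Real.exp (l * Δ a) ≤ Real.exp (l * μ + l ^ 2 * B * E) := by
  have h1 : ∀ a, Real.exp (l * Δ a) ≤ 1 + l * Δ a + l ^ 2 * B * |Δ a| := by
    intro a
    have h2 : |l * Δ a| ≤ l * B := by
      rw [abs_mul, abs_of_nonneg hl]
      exact mul_le_mul_of_nonneg_left (hB a) hl
    have h3 := Real.abs_exp_sub_one_sub_id_le (h2.trans hlB)
    have h4 : (l * Δ a) ^ 2 ≤ l ^ 2 * B * |Δ a| := by
      rw [mul_pow, mul_assoc, ← sq_abs (Δ a), sq |Δ a|]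
      exact mul_le_mul_of_nonneg_left
        (mul_le_mul_of_nonneg_right (hB a) (abs_nonneg _)) (by positivity)
    have := le_abs_self (Real.exp (l * Δ a) - 1 - l * Δ a)
    linarith
  calc ∑ a, p a * Real.exp (l * Δ a)
      ≤ ∑ a, p a * (1 + l * Δ a + l ^ 2 * B * |Δ a|) :=
        Finset.sum_le_sum fun a _ => mul_le_mul_of_nonneg_left (h1 a) (hp a)
    _ = 1 + l * ∑ a, p a * Δ a + l ^ 2 * B * ∑ a, p a * |Δ a| := by
        nth_rewrite 2 [← hp1]
        rw [Finset.mul_sum, Finset.mul_sum, ← Finset.sum_add_distrib,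
          ← Finset.sum_add_distrib]
        exact Finset.sum_congr rfl fun a _ => by ring
    _ ≤ 1 + l * μ + l ^ 2 * B * E := by gcongr
    _ ≤ _ := by linarith [Real.add_one_le_exp (l * μ + l ^ 2 * B * E)]

section Hit

variable {Act W : Type*} [Fintype Act] [DecidableEq W] (p : Act → ℝ) (K : Act → Finset W)

/-- The indicator of the action `a` meeting the set `g`. -/
noncomputable def hitI (a : Act) (g : Finset W) : ℝ := if Disjoint (K a) g then 0 else 1

omit [Fintype Act] in
theorem hitI_nonneg (a : Act) (g : Finset W) : 0 ≤ hitI K a g := by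
  unfold hitI; split_ifs <;> norm_num

theorem sum_mul_card_inter (N : ℝ) (A g : Finset W) (hg : g ⊆ A)
    (hd : ∀ u ∈ A, ∑ a, (if u ∈ K a then p a else 0) = 1 / N) :
    ∑ a, p a * (#(g.filter (· ∈ K a)) : ℝ) = #g / N := by
  have h1 : ∀ a, p a * (#(g.filter (· ∈ K a)) : ℝ) = ∑ u ∈ g, if u ∈ K a then p a else 0 := by
    intro a
    rw [← Finset.sum_filter, Finset.sum_const, nsmul_eq_mul, mul_comm]
  simp only [h1]
  rw [Finset.sum_comm, Finset.sum_congr rfl fun u hu => hd u (hg hu)]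
  simp [div_eq_mul_inv]

theorem sum_hitI_le (hp : ∀ a, 0 ≤ p a) (N : ℝ) (A g : Finset W) (hg : g ⊆ A)
    (hd : ∀ u ∈ A, ∑ a, (if u ∈ K a then p a else 0) = 1 / N) :
    ∑ a, p a * hitI K a g ≤ #g / N := by
  rw [← sum_mul_card_inter p K N A g hg hd]
  refine Finset.sum_le_sum fun a _ => mul_le_mul_of_nonneg_left ?_ (hp a)
  unfold hitI
  split_ifs with h
  · positivity
  · obtain ⟨u, hu, hu'⟩ := Finset.not_disjoint_iff.1 h
    have : 0 < #(g.filter (· ∈ K a)) := Finset.card_pos.2 ⟨u, by simp [hu, hu']⟩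
    exact_mod_cast this

theorem le_sum_hitI (hp : ∀ a, 0 ≤ p a) (N x : ℝ) (hx : 0 ≤ x) (A g : Finset W) (hg : g ⊆ A)
    (hd : ∀ u ∈ A, ∑ a, (if u ∈ K a then p a else 0) = 1 / N)
    (h2 : ∀ u u', u ≠ u' → ∑ a, (if u ∈ K a ∧ u' ∈ K a then p a else 0) ≤ x) :
    #g / N - (#g : ℝ) ^ 2 * x ≤ ∑ a, p a * hitI K a g := by
  rw [← sum_mul_card_inter p K N A g hg hd]
  have h3 : ∑ a, p a * (#((g ×ˢ g).filter fun q => q.1 ≠ q.2 ∧ q.1 ∈ K a ∧ q.2 ∈ K a) : ℝ) ≤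
      (#g : ℝ) ^ 2 * x := by
    have h4 : ∀ a, p a * (#((g ×ˢ g).filter fun q => q.1 ≠ q.2 ∧ q.1 ∈ K a ∧ q.2 ∈ K a) : ℝ) =
        ∑ q ∈ g ×ˢ g, if q.1 ≠ q.2 ∧ q.1 ∈ K a ∧ q.2 ∈ K a then p a else 0 := by
      intro a
      rw [← Finset.sum_filter, Finset.sum_const, nsmul_eq_mul, mul_comm]
    simp only [h4]
    rw [Finset.sum_comm]
    refine (Finset.sum_le_sum (g := fun _ => x) fun q _ => ?_).trans (le_of_eq ?_)
    · by_cases hq : q.1 = q.2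
      · simpa [hq] using hx
      · simpa [hq] using h2 q.1 q.2 hq
    · rw [Finset.sum_const, Finset.card_product, nsmul_eq_mul]; push_cast; ring
  have h5 : ∑ a, p a * (#(g.filter (· ∈ K a)) : ℝ) ≤ ∑ a, p a * hitI K a g +
      ∑ a, p a * (#((g ×ˢ g).filter fun q => q.1 ≠ q.2 ∧ q.1 ∈ K a ∧ q.2 ∈ K a) : ℝ) := by
    rw [← Finset.sum_add_distrib]
    refine Finset.sum_le_sum fun a _ => ?_
    rw [← mul_add]
    refine mul_le_mul_of_nonneg_left ?_ (hp a)
    have h6 : ((g ×ˢ g).filter fun q => q.1 ≠ q.2 ∧ q.1 ∈ K a ∧ q.2 ∈ K a) =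
        (g.filter (· ∈ K a)).offDiag := by
      ext q; simp only [mem_filter, mem_product, mem_offDiag]; tauto
    rw [h6, Finset.offDiag_card]
    unfold hitI
    split_ifs with h
    · have : g.filter (· ∈ K a) = ∅ := by
        rw [Finset.filter_eq_empty_iff]
        exact fun u hu hu' => Finset.disjoint_left.1 h hu' hu
      simp [this]
    · generalize #(g.filter (· ∈ K a)) = n
      rcases n with _ | _ | n
      · simp
      · simp
      · have : (n + 1 + 1 : ℕ) ≤ 1 + ((n + 1 + 1) * (n + 1 + 1) - (n + 1 + 1)) := by
          have : (n + 1 + 1) * (n + 1 + 1) = (n + 1 + 1) + (n + 1 + 1) * (n + 1) := by ring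
          rw [this, Nat.add_sub_cancel_left]
          nlinarith
        exact_mod_cast this
  linarith

end Hit

section Nibble

variable {ι W : Type*} [Fintype ι] [DecidableEq ι] [Fintype W] [DecidableEq W]
  (H : Finset ι) (vs : ι → Finset W)

/-- The edges at `v` whose other vertices lie in `A`. -/
def starIn (A : Finset W) (v : W) : Finset ι := {e ∈ H | v ∈ vs e ∧ (vs e).erase v ⊆ A}

/-- The edges inside `A`. -/
def inside (A : Finset W) : Finset ι := {e ∈ H | vs e ⊆ A}

/-- The vertices removed by an action. -/
def killed : Option (W ⊕ ι) → Finset W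
  | none => ∅
  | some (Sum.inl u) => {u}
  | some (Sum.inr e) => vs e

/-- The random action of one step of the greedy process. -/
noncomputable def stepPre (A : Finset W) (N π : ℝ) : W ⊕ ι → ℝ
  | Sum.inl u => if u ∈ A then 1 / N - π * #{e ∈ inside H vs A | u ∈ vs e} else 0
  | Sum.inr e => if e ∈ inside H vs A then π else 0

/-- The distribution of the action in one step of the greedy process. -/
noncomputable def stepProb (A : Finset W) (N π : ℝ) : Option (W ⊕ ι) → ℝ
  | none => 1 - ∑ a, stepPre H vs A N π a
  | some a => stepPre H vs A N π a

omit [Fintype ι] [DecidableEq ι] [Fintype W] in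
theorem card_inside_le_starIn (A : Finset W) (u : W) :
    #{e ∈ inside H vs A | u ∈ vs e} ≤ #(starIn H vs A u) := by
  refine Finset.card_le_card fun e he => ?_
  simp only [inside, starIn, mem_filter] at he ⊢
  exact ⟨he.1.1, he.2, (Finset.erase_subset _ _).trans he.1.2⟩

omit [Fintype ι] [Fintype W] in
theorem stepPre_nonneg (A : Finset W) (N π : ℝ) (hπ : 0 ≤ π)
    (hdeg : ∀ u ∈ A, π * #(starIn H vs A u) ≤ 1 / N) (a : W ⊕ ι) :
    0 ≤ stepPre H vs A N π a := by
  rcases a with u | e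
  · simp only [stepPre]
    split_ifs with hu
    · have h1 := hdeg u hu
      have h2 : (#{e ∈ inside H vs A | u ∈ vs e} : ℝ) ≤ #(starIn H vs A u) := by
        exact_mod_cast card_inside_le_starIn H vs A u
      have := mul_le_mul_of_nonneg_left h2 hπ
      linarith
    · exact le_rfl
  · simp only [stepPre]
    split_ifs <;> simp [hπ]

theorem sum_stepPre_le (A : Finset W) (N π : ℝ) (hπ : 0 ≤ π) (hN : (Fintype.card W : ℝ) ≤ N)
    (hne : ∀ e ∈ H, (vs e).Nonempty) (hN0 : 0 < N) :
    ∑ a, stepPre H vs A N π a ≤ 1 := by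
  rw [Fintype.sum_sum_type]
  simp only [stepPre]
  rw [← Finset.sum_filter, ← Finset.sum_filter]
  simp only [Finset.sum_const, nsmul_eq_mul, Finset.sum_sub_distrib, Finset.filter_mem_eq_inter,
    Finset.univ_inter]
  rw [← Finset.mul_sum]
  have h1 : (#(inside H vs A) : ℝ) ≤ ∑ u ∈ A, (#{e ∈ inside H vs A | u ∈ vs e} : ℝ) := by
    have : #(inside H vs A) ≤ ∑ u ∈ A, #{e ∈ inside H vs A | u ∈ vs e} := by
      refine le_trans (Finset.card_le_card ?_) Finset.card_biUnion_le
      intro e he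
      have he' := he
      simp only [inside, mem_filter] at he'
      obtain ⟨u, hu⟩ := hne e he'.1
      simp only [mem_biUnion, mem_filter]
      exact ⟨u, he'.2 hu, he, hu⟩
    exact_mod_cast this
  have h2 : (#A : ℝ) * (1 / N) ≤ 1 := by
    rw [mul_one_div, div_le_one hN0]
    refine le_trans ?_ hN
    exact_mod_cast Finset.card_le_univ A
  have := mul_le_mul_of_nonneg_left h1 hπ
  linarith

theorem stepProb_nonneg (A : Finset W) (N π : ℝ) (hπ : 0 ≤ π)
    (hN : (Fintype.card W : ℝ) ≤ N) (hN0 : 0 < N) (hne : ∀ e ∈ H, (vs e).Nonempty)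
    (hdeg : ∀ u ∈ A, π * #(starIn H vs A u) ≤ 1 / N) (a : Option (W ⊕ ι)) :
    0 ≤ stepProb H vs A N π a := by
  cases a with
  | none => simpa [stepProb] using sum_stepPre_le H vs A N π hπ hN hne hN0
  | some a => exact stepPre_nonneg H vs A N π hπ hdeg a

theorem sum_stepProb (A : Finset W) (N π : ℝ) : ∑ a, stepProb H vs A N π a = 1 := by
  simp [Fintype.sum_option, stepProb]

theorem sum_stepProb_mem (A : Finset W) (N π : ℝ) (u : W) (hu : u ∈ A) :
    ∑ a, (if u ∈ killed vs a then stepProb H vs A N π a else 0) = 1 / N := by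
  rw [Fintype.sum_option, Fintype.sum_sum_type]
  have h1 : ∀ w : W, (if u ∈ killed vs (some (Sum.inl w) : Option (W ⊕ ι)) then
      stepProb H vs A N π (some (Sum.inl w)) else 0) =
      if u = w then stepPre H vs A N π (Sum.inl w) else 0 := fun w =>
    if_congr (by simp [killed]) rfl rfl
  have h2 : ∀ e : ι, (if u ∈ killed vs (some (Sum.inr e) : Option (W ⊕ ι)) then
      stepProb H vs A N π (some (Sum.inr e)) else 0) =
      if e ∈ ({e ∈ inside H vs A | u ∈ vs e} : Finset ι) then π else 0 := fun e => by
    rw [if_congr (Q := u ∈ vs e) (by simp [killed]) rfl rfl]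
    simp only [stepProb, stepPre, mem_filter, ← ite_and, and_comm]
  rw [if_neg (by simp [killed]), Finset.sum_congr rfl fun w _ => h1 w,
    Finset.sum_congr rfl fun e _ => h2 e, Finset.sum_ite_eq univ u, if_pos (mem_univ _),
    Finset.sum_ite_mem, Finset.univ_inter, Finset.sum_const, nsmul_eq_mul]
  simp only [stepPre, if_pos hu]
  ring

theorem sum_stepProb_mem_mem (A : Finset W) (N π x : ℝ) (hπ : 0 ≤ π) (u u' : W) (hu : u ≠ u')
    (hx : (#{e ∈ H | u ∈ vs e ∧ u' ∈ vs e} : ℝ) ≤ x) :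
    ∑ a, (if u ∈ killed vs a ∧ u' ∈ killed vs a then stepProb H vs A N π a else 0) ≤ π * x := by
  rw [Fintype.sum_option, Fintype.sum_sum_type]
  have h1 : ∀ w : W, (if u ∈ killed vs (some (Sum.inl w) : Option (W ⊕ ι)) ∧
      u' ∈ killed vs (some (Sum.inl w) : Option (W ⊕ ι)) then
      stepProb H vs A N π (some (Sum.inl w)) else 0) = 0 := fun w => if_neg (by
    simp only [killed, mem_singleton]
    exact fun h => hu (h.1.trans h.2.symm))
  have h2 : ∀ e : ι, (if u ∈ killed vs (some (Sum.inr e) : Option (W ⊕ ι)) ∧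
      u' ∈ killed vs (some (Sum.inr e) : Option (W ⊕ ι)) then
      stepProb H vs A N π (some (Sum.inr e)) else 0) =
      if e ∈ ({e ∈ inside H vs A | u ∈ vs e ∧ u' ∈ vs e} : Finset ι) then π else 0 := fun e => by
    rw [if_congr (Q := u ∈ vs e ∧ u' ∈ vs e) (by simp [killed]) rfl rfl]
    simp only [stepProb, stepPre, mem_filter, ← ite_and, and_comm]
  rw [if_neg (by simp [killed]), Finset.sum_congr rfl fun w _ => h1 w,
    Finset.sum_congr rfl fun e _ => h2 e,
    Finset.sum_ite_mem, Finset.univ_inter, Finset.sum_const, nsmul_eq_mul]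
  rw [mul_zero, zero_add, zero_add, Finset.sum_const, nsmul_eq_mul, mul_comm]
  refine mul_le_mul_of_nonneg_left (le_trans ?_ hx) hπ
  norm_cast
  refine Finset.card_le_card fun e he => ?_
  simp only [inside, mem_filter] at he ⊢
  tauto

end Nibble

section Loss

variable {Act ι W : Type*} [Fintype Act] [DecidableEq ι] [Fintype W] [DecidableEq W]
  (H : Finset ι) (vs : ι → Finset W) (K : Act → Finset W)

omit [Fintype Act] [DecidableEq ι] [Fintype W] in
theorem card_starIn_sub (A : Finset W) (v : W) (a : Act) :
    (#(starIn H vs A v) : ℝ) - #(starIn H vs (A \ K a) v) =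
      ∑ e ∈ starIn H vs A v, hitI K a ((vs e).erase v) := by
  have h1 : starIn H vs (A \ K a) v =
      (starIn H vs A v).filter fun e => Disjoint (K a) ((vs e).erase v) := by
    ext e
    simp only [starIn, mem_filter, Finset.subset_sdiff, disjoint_comm]
    tauto
  have h2 := Finset.card_filter_add_card_filter_not (s := starIn H vs A v)
    (fun e => Disjoint (K a) ((vs e).erase v))
  rw [h1, ← h2]
  push_cast
  rw [add_sub_cancel_left, Finset.card_filter]
  push_cast
  refine Finset.sum_congr rfl fun e _ => ?_
  unfold hitI
  split_ifs <;> simp_all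

omit [Fintype Act] [DecidableEq ι] [Fintype W] in
theorem sum_inside_sub (A : Finset W) (q : ι → ℝ) (a : Act) :
    ∑ e ∈ inside H vs A, q e - ∑ e ∈ inside H vs (A \ K a), q e =
      ∑ e ∈ inside H vs A, q e * hitI K a (vs e) := by
  have h1 : inside H vs (A \ K a) =
      (inside H vs A).filter fun e => Disjoint (K a) (vs e) := by
    ext e
    simp only [inside, mem_filter, Finset.subset_sdiff, disjoint_comm]
    tauto
  rw [h1, Finset.sum_filter, ← Finset.sum_sub_distrib]
  refine Finset.sum_congr rfl fun e _ => ?_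
  unfold hitI
  split_ifs <;> simp

omit [Fintype Act] [DecidableEq ι] [Fintype W] in
theorem sum_hitI_starIn_le (A : Finset W) (v : W) (a : Act) (x : ℝ)
    (hx : ∀ w, w ≠ v → (#{e ∈ H | v ∈ vs e ∧ w ∈ vs e} : ℝ) ≤ x) (k : ℕ)
    (hk : #(K a) ≤ k) (hx0 : 0 ≤ x) :
    ∑ e ∈ starIn H vs A v, hitI K a ((vs e).erase v) ≤ k * x := by
  have h1 : ∀ e ∈ starIn H vs A v, hitI K a ((vs e).erase v) ≤
      ∑ w ∈ K a, if w ≠ v ∧ w ∈ vs e then (1 : ℝ) else 0 := by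
    intro e _
    unfold hitI
    split_ifs with h
    · exact Finset.sum_nonneg fun w _ => by split_ifs <;> norm_num
    · obtain ⟨w, hw, hw'⟩ := Finset.not_disjoint_iff.1 h
      rw [Finset.mem_erase] at hw'
      refine le_trans ?_ (Finset.single_le_sum
        (f := fun w => if w ≠ v ∧ w ∈ vs e then (1 : ℝ) else 0)
        (fun w _ => by split_ifs <;> norm_num) hw)
      simp [hw']
  refine (Finset.sum_le_sum h1).trans ?_
  rw [Finset.sum_comm]
  refine (Finset.sum_le_sum (g := fun _ => x) fun w _ => ?_).trans ?_
  · rw [← Finset.sum_filter, Finset.sum_const, nsmul_eq_mul, mul_one]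
    by_cases hw : w = v
    · simpa [hw] using hx0
    · refine le_trans ?_ (hx w hw)
      norm_cast
      refine Finset.card_le_card fun e he => ?_
      simp only [starIn, mem_filter] at he ⊢
      tauto
  · rw [Finset.sum_const, nsmul_eq_mul]
    exact mul_le_mul_of_nonneg_right (by exact_mod_cast hk) hx0

omit [Fintype Act] [DecidableEq ι] [Fintype W] in
theorem sum_hitI_inside_le (A : Finset W) (q : ι → ℝ) (hq : ∀ e, 0 ≤ q e) (a : Act) (x : ℝ)
    (hx : ∀ w, ∑ e ∈ H.filter (w ∈ vs ·), q e ≤ x) (k : ℕ)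
    (hk : #(K a) ≤ k) (hx0 : 0 ≤ x) :
    ∑ e ∈ inside H vs A, q e * hitI K a (vs e) ≤ k * x := by
  have h1 : ∀ e ∈ inside H vs A, q e * hitI K a (vs e) ≤
      ∑ w ∈ K a, if w ∈ vs e then q e else 0 := by
    intro e _
    unfold hitI
    split_ifs with h
    · rw [mul_zero]
      exact Finset.sum_nonneg fun w _ => by split_ifs <;> simp [hq]
    · obtain ⟨w, hw, hw'⟩ := Finset.not_disjoint_iff.1 h
      refine le_trans ?_ (Finset.single_le_sum
        (f := fun w => if w ∈ vs e then q e else 0)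
        (fun w _ => by split_ifs <;> simp [hq]) hw)
      simp [hw']
  refine (Finset.sum_le_sum h1).trans ?_
  rw [Finset.sum_comm]
  refine (Finset.sum_le_sum (g := fun _ => x) fun w _ => ?_).trans ?_
  · rw [← Finset.sum_filter]
    refine le_trans (Finset.sum_le_sum_of_subset_of_nonneg ?_ fun e _ _ => hq e) (hx w)
    intro e he
    simp only [inside, mem_filter] at he ⊢
    tauto
  · rw [Finset.sum_const, nsmul_eq_mul]
    exact mul_le_mul_of_nonneg_right (by exact_mod_cast hk) hx0

end Loss

/-- Constants controlling one step of the greedy process: `b` is the size of the drift, `X` the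
random loss of a statistic and `η` its normalisation. -/
theorem weighted_exp_affine_le {Act : Type*} [Fintype Act] (p X : Act → ℝ) (hp : ∀ a, 0 ≤ p a)
    (hp1 : ∑ a, p a = 1) (l L N κ b s μ : ℝ) (hl : 0 ≤ l) (hL : 0 < L) (hLN : L ≤ N)
    (hκ : 0 ≤ κ) (hlκ : l * (3 * κ / L) ≤ 1) (hb : |b| ≤ 2 * κ / N)
    (hs : |s| = 1) (hX0 : ∀ a, 0 ≤ X a) (hX : ∀ a, X a ≤ κ / L)
    (hEX : ∑ a, p a * X a ≤ 2 * κ / N) (hμ : s * (b - ∑ a, p a * X a) ≤ μ / N) :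
    ∑ a, p a * Real.exp (l * (s * (b - X a))) ≤
      Real.exp ((l * μ + l ^ 2 * (12 * κ ^ 2 / L)) / N) := by
  have hN : 0 < N := hL.trans_le hLN
  have h0 : ∀ a, |s * (b - X a)| ≤ |b| + X a := by
    intro a
    rw [abs_mul, hs, one_mul]
    refine (abs_sub _ _).trans ?_
    rw [abs_of_nonneg (hX0 a)]
  have h1 : 2 * κ / N ≤ 2 * κ / L := div_le_div_of_nonneg_left (by positivity) hL hLN
  refine (weighted_exp_le p (fun a => s * (b - X a)) hp hp1 l (3 * κ / L) (4 * κ / N) (μ / N) hl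
    hlκ ?_ ?_ ?_ (by positivity)).trans (le_of_eq ?_)
  · intro a
    have h2 := h0 a
    have h3 := hX a
    have : 3 * κ / L = 2 * κ / L + κ / L := by ring
    linarith
  · have h2 : ∑ a, p a * |s * (b - X a)| ≤ ∑ a, (p a * |b| + p a * X a) :=
      Finset.sum_le_sum fun a _ => by
        rw [← mul_add]; exact mul_le_mul_of_nonneg_left (h0 a) (hp a)
    rw [Finset.sum_add_distrib, ← Finset.sum_mul, hp1] at h2
    have : 4 * κ / N = 2 * κ / N + 2 * κ / N := by ring
    linarith
  · have h2 : ∑ a, p a * (s * (b - X a)) = s * (b - ∑ a, p a * X a) := by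
      calc ∑ a, p a * (s * (b - X a)) = s * (b * ∑ a, p a - ∑ a, p a * X a) := by
            rw [Finset.mul_sum, ← Finset.sum_sub_distrib, Finset.mul_sum]
            exact Finset.sum_congr rfl fun a _ => by ring
        _ = _ := by rw [hp1, mul_one]
    rw [h2]; exact hμ
  · congr 1
    field_simp
    ring


section Step

variable {Act ι W : Type*} [Fintype Act] [DecidableEq ι] [Fintype W] [DecidableEq W]

omit [DecidableEq ι] [Fintype W] in
theorem step_starIn_le (H : Finset ι) (vs : ι → Finset W) (K : Act → Finset W) (p : Act → ℝ)
    (hp : ∀ a, 0 ≤ p a) (hp1 : ∑ a, p a = 1) (k : ℕ) (hk : 1 ≤ k) (D L N θ l x : ℝ)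
    (hvs : ∀ e ∈ H, #(vs e) = k) (hK : ∀ a, #(K a) ≤ k) (A : Finset W) (v : W)
    (hd : ∀ u ∈ A, ∑ a, (if u ∈ K a then p a else 0) = 1 / N)
    (h2 : ∀ u u', u ≠ u' → ∑ a, (if u ∈ K a ∧ u' ∈ K a then p a else 0) ≤ x)
    (hx0 : 0 ≤ x) (hx : x ≤ θ / (N * L))
    (hD : 0 < D) (hL : 0 < L) (hLN : L ≤ N) (hθ : 0 ≤ θ) (hl : 0 ≤ l)
    (hlκ : l * (3 * (θ * k) / L) ≤ 1) (hdeg : (#(starIn H vs A v) : ℝ) ≤ D)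
    (hco : ∀ w, w ≠ v → (#{e ∈ H | v ∈ vs e ∧ w ∈ vs e} : ℝ) ≤ D / L)
    (r ρ : ℝ) (hr : 0 < r) (hρ : ρ = 1 - ((k : ℝ) - 1) / N) (hρ0 : 0 < ρ)
    (hrθ : 1 ≤ θ * (r * ρ)) :
    ∑ a, p a * Real.exp (l * (#(starIn H vs (A \ K a) v) / (D * (r * ρ)) -
      #(starIn H vs A v) / (D * r))) ≤
      Real.exp ((l * ((θ * k) ^ 2 / L) + l ^ 2 * (12 * (θ * k) ^ 2 / L)) / N) := by
  have hN : 0 < N := hL.trans_le hLN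
  have hk' : (1 : ℝ) ≤ k := by exact_mod_cast hk
  have hke : ∀ e ∈ starIn H vs A v, (#((vs e).erase v) : ℝ) = k - 1 := by
    intro e he
    simp only [starIn, mem_filter] at he
    rw [Finset.card_erase_of_mem he.2.1, hvs e he.1, Nat.cast_sub hk, Nat.cast_one]
  have hsub : ∀ e ∈ starIn H vs A v, (vs e).erase v ⊆ A := by
    intro e he
    simp only [starIn, mem_filter] at he
    exact he.2.2
  set η : ℝ := 1 / (D * (r * ρ)) with hη
  have hη0 : 0 < η := by positivity
  have hηD : η * D ≤ θ := by
    rw [hη, one_div, mul_inv, mul_comm D⁻¹, mul_assoc, inv_mul_cancel₀ hD.ne', mul_one,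
      inv_le_iff_one_le_mul₀ (by positivity)]
    exact hrθ
  set Z : ℝ := (#(starIn H vs A v) : ℝ) with hZ
  have hZ0 : 0 ≤ Z := by positivity
  have hηZ : η * Z ≤ θ := (mul_le_mul_of_nonneg_left hdeg hη0.le).trans hηD
  let X : Act → ℝ := fun a => η * ∑ e ∈ starIn H vs A v, hitI K a ((vs e).erase v)
  have hΔ : ∀ a, (#(starIn H vs (A \ K a) v) : ℝ) / (D * (r * ρ)) - Z / (D * r) =
      1 * (η * ((k - 1) / N * Z) - X a) := by
    intro a
    have h1 := card_starIn_sub H vs K A v a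
    rw [← hZ] at h1
    simp only [X]
    rw [← h1, hη]
    have h3 : ((k : ℝ) - 1) / N = 1 - ρ := by rw [hρ]; ring
    rw [h3]
    field_simp
    ring
  have hEX : ∑ a, p a * X a = η * ∑ e ∈ starIn H vs A v, ∑ a, p a * hitI K a ((vs e).erase v) := by
    simp only [X, Finset.mul_sum]
    rw [Finset.sum_comm]
    refine Finset.sum_congr rfl fun e _ => Finset.sum_congr rfl fun a _ => by ring
  have hEX1 : ∑ a, p a * X a ≤ η * (Z * ((k - 1) / N)) := by
    rw [hEX]
    refine mul_le_mul_of_nonneg_left ?_ hη0.le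
    refine (Finset.sum_le_sum fun e he => sum_hitI_le p K hp N A _ (hsub e he) hd).trans ?_
    rw [Finset.sum_congr rfl fun e he => by rw [hke e he], Finset.sum_const, nsmul_eq_mul]
  have hEX2 : η * (Z * ((k - 1) / N - k ^ 2 * x)) ≤ ∑ a, p a * X a := by
    rw [hEX]
    refine mul_le_mul_of_nonneg_left ?_ hη0.le
    refine le_trans ?_ (Finset.sum_le_sum fun e he => le_sum_hitI p K hp N x hx0 A _ (hsub e he)
      hd h2)
    rw [Finset.sum_congr rfl fun e he => by rw [hke e he], Finset.sum_const, nsmul_eq_mul]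
    refine mul_le_mul_of_nonneg_left ?_ hZ0
    have : ((k : ℝ) - 1) ^ 2 ≤ k ^ 2 := by nlinarith
    linarith [mul_le_mul_of_nonneg_right this hx0]
  have hb : η * Z * ((k - 1) / N) ≤ 2 * (θ * k) / N := by
    calc η * Z * ((k - 1) / N) ≤ θ * (k / N) := by
          refine mul_le_mul hηZ ?_ (div_nonneg (by linarith) hN.le) hθ
          exact div_le_div_of_nonneg_right (by linarith) hN.le
      _ = θ * k / N := by ring
      _ ≤ _ := div_le_div_of_nonneg_right (by nlinarith [mul_nonneg hθ (by linarith : (0:ℝ) ≤ k)])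
          hN.le
  rw [Finset.sum_congr rfl fun a _ => by rw [hΔ a]]
  refine weighted_exp_affine_le p X hp hp1 l L N (θ * k) (η * ((k - 1) / N * Z)) 1
    ((θ * k) ^ 2 / L) hl hL hLN (by positivity) hlκ ?_ (by simp) ?_ ?_ ?_ ?_
  · rw [abs_of_nonneg]
    · linarith
    · have : 0 ≤ ((k : ℝ) - 1) / N := div_nonneg (by linarith) hN.le
      positivity
  · intro a
    exact mul_nonneg hη0.le (Finset.sum_nonneg fun e _ => hitI_nonneg K a _)
  · intro a
    have := sum_hitI_starIn_le H vs K A v a (D / L) hco k (hK a) (by positivity)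
    calc X a ≤ η * (k * (D / L)) := mul_le_mul_of_nonneg_left this hη0.le
      _ = (η * D) * (k / L) := by ring
      _ ≤ θ * (k / L) := mul_le_mul_of_nonneg_right hηD (by positivity)
      _ = _ := by ring
  · linarith
  · calc 1 * (η * ((k - 1) / N * Z) - ∑ a, p a * X a)
        ≤ η * Z * (k ^ 2 * x) := by linarith
      _ ≤ θ * (k ^ 2 * (θ / (N * L))) := by gcongr
      _ = _ := by field_simp

omit [DecidableEq ι] [Fintype W] in
theorem step_inside_le (H : Finset ι) (vs : ι → Finset W) (K : Act → Finset W) (p : Act → ℝ)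
    (hp : ∀ a, 0 ≤ p a) (hp1 : ∑ a, p a = 1) (k : ℕ) (Q L N θ l : ℝ)
    (hvs : ∀ e ∈ H, #(vs e) = k) (hK : ∀ a, #(K a) ≤ k) (A : Finset W)
    (hd : ∀ u ∈ A, ∑ a, (if u ∈ K a then p a else 0) = 1 / N)
    (hQ : 0 < Q) (hL : 0 < L) (hLN : L ≤ N) (hθ : 0 ≤ θ) (hl : 0 ≤ l)
    (hlκ : l * (3 * (θ * k) / L) ≤ 1) (q : ι → ℝ) (hq : ∀ e, 0 ≤ q e)
    (hsum : ∑ e ∈ inside H vs A, q e ≤ Q)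
    (hqv : ∀ w, ∑ e ∈ H.filter (w ∈ vs ·), q e ≤ Q / L)
    (r ρ : ℝ) (hr : 0 < r) (hρ : ρ = 1 - (k : ℝ) / N) (hρ0 : 0 < ρ)
    (hrθ : 1 ≤ θ * (r * ρ)) :
    ∑ a, p a * Real.exp (l * (-((∑ e ∈ inside H vs (A \ K a), q e) / (Q * (r * ρ))) -
      -((∑ e ∈ inside H vs A, q e) / (Q * r)))) ≤
      Real.exp ((l * ((θ * k) ^ 2 / L) + l ^ 2 * (12 * (θ * k) ^ 2 / L)) / N) := by
  have hN : 0 < N := hL.trans_le hLN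
  set η : ℝ := 1 / (Q * (r * ρ)) with hη
  have hη0 : 0 < η := by positivity
  have hηD : η * Q ≤ θ := by
    rw [hη, one_div, mul_inv, mul_comm Q⁻¹, mul_assoc, inv_mul_cancel₀ hQ.ne', mul_one,
      inv_le_iff_one_le_mul₀ (by positivity)]
    exact hrθ
  set Z : ℝ := ∑ e ∈ inside H vs A, q e with hZ
  have hZ0 : 0 ≤ Z := Finset.sum_nonneg fun e _ => hq e
  have hηZ : η * Z ≤ θ := (mul_le_mul_of_nonneg_left hsum hη0.le).trans hηD
  let X : Act → ℝ := fun a => η * ∑ e ∈ inside H vs A, q e * hitI K a (vs e)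
  have hΔ : ∀ a, -((∑ e ∈ inside H vs (A \ K a), q e) / (Q * (r * ρ))) - -(Z / (Q * r)) =
      -1 * (η * (k / N * Z) - X a) := by
    intro a
    have h1 := sum_inside_sub H vs K A q a
    rw [← hZ] at h1
    simp only [X]
    rw [← h1, hη]
    have h3 : (k : ℝ) / N = 1 - ρ := by rw [hρ]; ring
    rw [h3]
    field_simp
    ring
  have hEX1 : ∑ a, p a * X a ≤ η * (Z * (k / N)) := by
    have hEX : ∑ a, p a * X a = η * ∑ e ∈ inside H vs A, q e * ∑ a, p a * hitI K a (vs e) := by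
      simp only [X, Finset.mul_sum]
      rw [Finset.sum_comm]
      refine Finset.sum_congr rfl fun e _ => Finset.sum_congr rfl fun a _ => by ring
    rw [hEX]
    refine mul_le_mul_of_nonneg_left ?_ hη0.le
    rw [hZ, Finset.sum_mul]
    refine Finset.sum_le_sum fun e he => mul_le_mul_of_nonneg_left ?_ (hq e)
    simp only [inside, mem_filter] at he
    rw [← hvs e he.1]
    exact sum_hitI_le p K hp N A _ he.2 hd
  have hb : η * Z * (k / N) ≤ 2 * (θ * k) / N := by
    calc η * Z * (k / N) ≤ θ * (k / N) := mul_le_mul_of_nonneg_right hηZ (by positivity)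
      _ = θ * k / N := by ring
      _ ≤ _ := div_le_div_of_nonneg_right (by nlinarith [mul_nonneg hθ (Nat.cast_nonneg (α := ℝ) k)])
          hN.le
  rw [Finset.sum_congr rfl fun a _ => by rw [hΔ a]]
  refine weighted_exp_affine_le p X hp hp1 l L N (θ * k) (η * (k / N * Z)) (-1)
    ((θ * k) ^ 2 / L) hl hL hLN (by positivity) hlκ ?_ (by simp) ?_ ?_ ?_ ?_
  · rw [abs_of_nonneg (by positivity)]
    linarith
  · intro a
    exact mul_nonneg hη0.le
      (Finset.sum_nonneg fun e _ => mul_nonneg (hq e) (hitI_nonneg K a _))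
  · intro a
    have := sum_hitI_inside_le H vs K A q hq a (Q / L) hqv k (hK a) (by positivity)
    calc X a ≤ η * (k * (Q / L)) := mul_le_mul_of_nonneg_left this hη0.le
      _ = (η * Q) * (k / L) := by ring
      _ ≤ θ * (k / L) := mul_le_mul_of_nonneg_right hηD (by positivity)
      _ = _ := by ring
  · linarith
  · have : (0 : ℝ) ≤ (θ * k) ^ 2 / L / N := by positivity
    linarith

end Step

section Match

variable {ι W : Type*} [Fintype ι] [DecidableEq ι] [Fintype W] [DecidableEq W]

open Classical in
/-- The edges of `H` inside `A` that may be added to `M`. -/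
noncomputable def addable (H : Finset ι) (vs : ι → Finset W) (P : Finset ι → Prop)
    (A : Finset W) (M : Finset ι) : Finset ι :=
  (inside H vs A).filter fun e => P (insert e M)

omit [Fintype ι] [Fintype W] in
theorem addable_subset (H : Finset ι) (vs : ι → Finset W) (P : Finset ι → Prop)
    (A : Finset W) (M : Finset ι) : addable H vs P A M ⊆ inside H vs A := by
  intro e he
  simp only [addable, mem_filter] at he
  exact he.1

/-- The set of selected edges after an action. -/
noncomputable def nextSel (H : Finset ι) (vs : ι → Finset W) (P : Finset ι → Prop)
    (A : Finset W) (M : Finset ι) : Option (W ⊕ ι) → Finset ι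
  | some (Sum.inr e) => if e ∈ addable H vs P A M then insert e M else M
  | _ => M

/-- The weight gained by an action. -/
noncomputable def gain (H : Finset ι) (vs : ι → Finset W) (P : Finset ι → Prop)
    (A : Finset W) (M : Finset ι) (q : ι → ℝ) : Option (W ⊕ ι) → ℝ
  | some (Sum.inr e) => if e ∈ addable H vs P A M then q e else 0
  | _ => 0

omit [Fintype ι] [Fintype W] in
theorem sum_nextSel (H : Finset ι) (vs : ι → Finset W) (P : Finset ι → Prop)
    (A : Finset W) (M : Finset ι) (q : ι → ℝ) (hM : ∀ e ∈ inside H vs A, e ∉ M)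
    (a : Option (W ⊕ ι)) :
    ∑ e ∈ nextSel H vs P A M a, q e = ∑ e ∈ M, q e + gain H vs P A M q a := by
  rcases a with _ | u | e
  · simp [nextSel, gain]
  · simp [nextSel, gain]
  · simp only [nextSel, gain]
    split_ifs with h
    · have : e ∈ inside H vs A := addable_subset H vs P A M h
      rw [Finset.sum_insert (hM e this), add_comm]
    · simp

theorem sum_stepProb_gain (H : Finset ι) (vs : ι → Finset W) (P : Finset ι → Prop)
    (A : Finset W) (M : Finset ι) (q : ι → ℝ) (N π : ℝ) :
    ∑ a, stepProb H vs A N π a * gain H vs P A M q a = π * ∑ e ∈ addable H vs P A M, q e := by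
  rw [Fintype.sum_option, Fintype.sum_sum_type]
  simp only [gain, mul_zero, Finset.sum_const_zero, zero_add]
  have : ∀ e : ι, stepProb H vs A N π (some (Sum.inr e)) *
      (if e ∈ addable H vs P A M then q e else 0) =
      if e ∈ addable H vs P A M then π * q e else 0 := by
    intro e
    split_ifs with h
    · have h' : e ∈ inside H vs A := addable_subset H vs P A M h
      simp [stepProb, stepPre, h']
    · simp
  rw [Finset.sum_congr rfl fun e _ => this e, Finset.sum_ite_mem, Finset.univ_inter,
    Finset.mul_sum]

theorem step_gain_le (H : Finset ι) (vs : ι → Finset W) (P : Finset ι → Prop)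
    (A : Finset W) (M : Finset ι) (q : ι → ℝ) (N π : ℝ) (k : ℕ) (hk : 1 ≤ k) (D Q L θ l g : ℝ)
    (hp : ∀ a, 0 ≤ stepProb H vs A N π a) (hD : 0 < D)
    (hQ : 0 < Q) (hL : 1 ≤ L) (hLN : L ≤ N) (hθ : 1 ≤ θ) (hl : 0 ≤ l) (hπ : 0 ≤ π)
    (hlκ : l * (3 * (θ * k) / L) ≤ 1) (hq : ∀ e, 0 ≤ q e)
    (hqD : ∀ e, q e ≤ Q / (D * L)) (hsum : ∑ e ∈ inside H vs A, q e ≤ Q)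
    (hg : |g| ≤ 2 * θ / N) (hπD : π * D ≤ 2 * θ / N)
    (hgain : g ≤ π * (D / Q * ∑ e ∈ addable H vs P A M, q e)) :
    ∑ a, stepProb H vs A N π a * Real.exp (l * (g - D / Q * gain H vs P A M q a)) ≤
      Real.exp ((l * ((θ * k) ^ 2 / L) + l ^ 2 * (12 * (θ * k) ^ 2 / L)) / N) := by
  have hL0 : 0 < L := by linarith
  have hN : 0 < N := hL0.trans_le hLN
  have hk' : (1 : ℝ) ≤ k := by exact_mod_cast hk
  have hθk : 1 * θ ≤ θ * k := by nlinarith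
  have hg0 : ∀ a, 0 ≤ gain H vs P A M q a := by
    intro a
    rcases a with _ | u | e
    · exact le_rfl
    · exact le_rfl
    · simp only [gain]; split_ifs <;> simp [hq]
  have hg1 : ∀ a, gain H vs P A M q a ≤ Q / (D * L) := by
    intro a
    rcases a with _ | u | e
    · simp only [gain]; positivity
    · simp only [gain]; positivity
    · simp only [gain]; split_ifs
      · exact hqD e
      · positivity
  have hE : ∑ a, stepProb H vs A N π a * (D / Q * gain H vs P A M q a) =
      π * (D / Q * ∑ e ∈ addable H vs P A M, q e) := by
    rw [Finset.sum_congr rfl fun a _ => mul_left_comm _ _ _, ← Finset.mul_sum,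
      sum_stepProb_gain]
    ring
  have key := weighted_exp_affine_le (stepProb H vs A N π)
    (fun a => D / Q * gain H vs P A M q a) hp (sum_stepProb H vs A N π) l L N (θ * k) g 1
    ((θ * k) ^ 2 / L) hl hL0 hLN (by positivity) hlκ ?_ (by simp) ?_ ?_ ?_ ?_
  · simpa only [one_mul] using key
  · refine hg.trans (div_le_div_of_nonneg_right (by linarith) hN.le)
  · intro a; have := hg0 a; positivity
  · intro a
    calc D / Q * gain H vs P A M q a ≤ D / Q * (Q / (D * L)) :=
          mul_le_mul_of_nonneg_left (hg1 a) (by positivity)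
      _ = 1 / L := by field_simp
      _ ≤ _ := div_le_div_of_nonneg_right (by linarith) hL0.le
  · rw [hE]
    have h1 : ∑ e ∈ addable H vs P A M, q e ≤ Q :=
      (Finset.sum_le_sum_of_subset_of_nonneg (addable_subset H vs P A M)
        fun e _ _ => hq e).trans hsum
    calc π * (D / Q * ∑ e ∈ addable H vs P A M, q e) ≤ π * (D / Q * Q) := by gcongr
      _ = π * D := by field_simp
      _ ≤ 2 * θ / N := hπD
      _ ≤ _ := div_le_div_of_nonneg_right (by linarith) hN.le
  · rw [hE]
    have : (0 : ℝ) ≤ (θ * k) ^ 2 / L / N := by positivity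
    linarith

end Match

theorem exists_le_of_weighted_sum_le {Act : Type*} [Fintype Act] (p F : Act → ℝ)
    (hp : ∀ a, 0 ≤ p a) (hp1 : ∑ a, p a = 1) (c : ℝ) (h : ∑ a, p a * F a ≤ c) :
    ∃ a, F a ≤ c := by
  by_contra! hF
  have h1 : ∀ a, 0 ≤ p a * (F a - c) := fun a => mul_nonneg (hp a) (by linarith [hF a])
  have h2 : ∑ a, p a * (F a - c) ≤ 0 := by
    simp only [mul_sub, Finset.sum_sub_distrib, ← Finset.sum_mul, hp1]
    linarith
  have h3 := (Finset.sum_eq_zero_iff_of_nonneg fun a _ => h1 a).1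
    (le_antisymm h2 (Finset.sum_nonneg fun a _ => h1 a))
  have h4 : ∀ a, p a = 0 := fun a => by
    have := h3 a (mem_univ a)
    rcases mul_eq_zero.1 this with h | h
    · exact h
    · linarith [hF a]
  simp [h4] at hp1

section GreedyRun

variable {ι W J : Type*} [Fintype ι] [DecidableEq ι] [Fintype W] [DecidableEq W] [Fintype J]

/-- The potential of a state of the greedy process at time `t`. -/
noncomputable def potential (H : Finset ι) (vs : ι → Finset W) (q : J → ι → ℝ) (Q : J → ℝ)
    (D l δ ρ₁ ρ₂ : ℝ) (Γ : ℝ) (t : ℕ) (A : Finset W) (M : Finset ι) : ℝ :=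
  ∑ v, Real.exp (l * (#(starIn H vs A v) / (D * ρ₁ ^ t) - (1 + δ))) +
  (∑ j, Real.exp (l * (-((∑ e ∈ inside H vs A, q j e) / (Q j * ρ₂ ^ t)) - (-1 + δ))) +
  ∑ j, Real.exp (l * (Γ - D / Q j * ∑ e ∈ M, q j e - δ)))

omit [Fintype ι] [DecidableEq ι] in
theorem of_potential_lt_one {H : Finset ι} {vs : ι → Finset W} {q : J → ι → ℝ} {Q : J → ℝ}
    {D l δ ρ₁ ρ₂ Γ : ℝ} {t : ℕ} {A : Finset W} {M : Finset ι} (hl : 0 < l)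
    (h : potential H vs q Q D l δ ρ₁ ρ₂ Γ t A M < 1) :
    (∀ v, (#(starIn H vs A v) : ℝ) / (D * ρ₁ ^ t) < 1 + δ) ∧
    (∀ j, 1 - δ < (∑ e ∈ inside H vs A, q j e) / (Q j * ρ₂ ^ t)) ∧
    (∀ j, Γ - δ < D / Q j * ∑ e ∈ M, q j e) := by
  have key : ∀ x : ℝ, Real.exp (l * x) < 1 → x < 0 := by
    intro x hx
    rw [Real.exp_lt_one_iff] at hx
    by_contra hx'
    exact absurd hx (not_lt.2 (mul_nonneg hl.le (not_lt.1 hx')))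
  have p1 : 0 ≤ ∑ v, Real.exp (l * (#(starIn H vs A v) / (D * ρ₁ ^ t) - (1 + δ))) :=
    Finset.sum_nonneg fun _ _ => (Real.exp_pos _).le
  have p2 : 0 ≤ ∑ j, Real.exp (l * (-((∑ e ∈ inside H vs A, q j e) / (Q j * ρ₂ ^ t)) -
      (-1 + δ))) := Finset.sum_nonneg fun _ _ => (Real.exp_pos _).le
  have p3 : 0 ≤ ∑ j, Real.exp (l * (Γ - D / Q j * ∑ e ∈ M, q j e - δ)) :=
    Finset.sum_nonneg fun _ _ => (Real.exp_pos _).le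
  unfold potential at h
  refine ⟨fun v => ?_, fun j => ?_, fun j => ?_⟩
  · have := Finset.single_le_sum (f := fun v =>
      Real.exp (l * (#(starIn H vs A v) / (D * ρ₁ ^ t) - (1 + δ))))
      (fun _ _ => (Real.exp_pos _).le) (mem_univ v)
    linarith [key _ (lt_of_le_of_lt this (by linarith))]
  · have := Finset.single_le_sum (f := fun j =>
      Real.exp (l * (-((∑ e ∈ inside H vs A, q j e) / (Q j * ρ₂ ^ t)) - (-1 + δ))))
      (fun _ _ => (Real.exp_pos _).le) (mem_univ j)
    linarith [key _ (lt_of_le_of_lt this (by linarith))]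
  · have := Finset.single_le_sum (f := fun j =>
      Real.exp (l * (Γ - D / Q j * ∑ e ∈ M, q j e - δ)))
      (fun _ _ => (Real.exp_pos _).le) (mem_univ j)
    linarith [key _ (lt_of_le_of_lt this (by linarith))]

/-- The target gain in step `t` of the greedy process. -/
noncomputable def targetGain (δ θ L N ρ₁ ρ₂ : ℝ) (t : ℕ) : ℝ :=
  1 / N * ((1 - δ) / (1 + δ) * (ρ₂ / ρ₁) ^ t - θ / L)

theorem exists_next (H : Finset ι) (vs : ι → Finset W) (P : Finset ι → Prop)
    (k : ℕ) (hk : 1 ≤ k) (hvs : ∀ e ∈ H, #(vs e) = k) (hvs' : ∀ e, #(vs e) ≤ k)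
    (D L N δ θ l : ℝ) (hD : 0 < D) (hL : 1 ≤ L) (hLN : L ≤ N) (hδ : 0 < δ) (hδ1 : δ < 1)
    (hWN : (Fintype.card W : ℝ) ≤ N) (hkN : (k : ℝ) < N)
    (hθ : 1 ≤ θ) (hl : 0 < l) (hlκ : l * (3 * (θ * k) / L) ≤ 1)
    (hdeg : ∀ v, (#(H.filter (v ∈ vs ·)) : ℝ) ≤ D)
    (hco : ∀ v w, w ≠ v → (#{e ∈ H | v ∈ vs e ∧ w ∈ vs e} : ℝ) ≤ D / L)
    (q : J → ι → ℝ) (hq : ∀ j e, 0 ≤ q j e) (Q : J → ℝ) (hQ : ∀ j, 0 < Q j)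
    (hQs : ∀ j, ∑ e ∈ H, q j e = Q j) (hqD : ∀ j e, q j e ≤ Q j / (D * L))
    (hqv : ∀ j w, ∑ e ∈ H.filter (w ∈ vs ·), q j e ≤ Q j / L)
    (t : ℕ) (hrθ : 1 ≤ θ * (1 - (k : ℝ) / N) ^ (t + 1)) (Γ : ℝ) (A : Finset W) (M : Finset ι)
    (hM : ∀ e ∈ inside H vs A, e ∉ M)
    (hP : ∀ j, ∑ e ∈ inside H vs A, q j e - Q j / L ≤ ∑ e ∈ addable H vs P A M, q j e)
    (hΦ : potential H vs q Q D l δ (1 - ((k : ℝ) - 1) / N) (1 - (k : ℝ) / N) Γ t A M < 1) :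
    ∃ a : Option (W ⊕ ι),
      potential H vs q Q D l δ (1 - ((k : ℝ) - 1) / N) (1 - (k : ℝ) / N)
        (Γ + targetGain δ θ L N (1 - ((k : ℝ) - 1) / N) (1 - (k : ℝ) / N) t) (t + 1)
        (A \ killed vs a) (nextSel H vs P A M a) ≤
      potential H vs q Q D l δ (1 - ((k : ℝ) - 1) / N) (1 - (k : ℝ) / N) Γ t A M *
        Real.exp ((l * ((θ * k) ^ 2 / L) + l ^ 2 * (12 * (θ * k) ^ 2 / L)) / N) := by
  have hL0 : 0 < L := by linarith
  have hN : 0 < N := by linarith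
  have hk' : (1 : ℝ) ≤ k := by exact_mod_cast hk
  have hθ0 : 0 < θ := by linarith
  set ρ₁ : ℝ := 1 - ((k : ℝ) - 1) / N with hρ₁
  set ρ₂ : ℝ := 1 - (k : ℝ) / N with hρ₂
  have hρ₂0 : 0 < ρ₂ := by
    rw [hρ₂, sub_pos, div_lt_one hN]; exact hkN
  have hρ12 : ρ₂ ≤ ρ₁ := by
    rw [hρ₁, hρ₂]
    have : ((k : ℝ) - 1) / N ≤ k / N := div_le_div_of_nonneg_right (by linarith) hN.le
    linarith
  have hρ₁0 : 0 < ρ₁ := hρ₂0.trans_le hρ12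
  have hρ₁1 : ρ₁ ≤ 1 := by
    rw [hρ₁]
    have : 0 ≤ ((k : ℝ) - 1) / N := div_nonneg (by linarith) hN.le
    linarith
  have hρ₂1 : ρ₂ ≤ 1 := hρ12.trans hρ₁1
  have hr₁ : 0 < ρ₁ ^ t := by positivity
  have hr₂ : 0 < ρ₂ ^ t := by positivity
  have hr₁θ : 1 ≤ θ * (ρ₁ ^ t * ρ₁) := by
    rw [← pow_succ]
    refine hrθ.trans (mul_le_mul_of_nonneg_left (pow_le_pow_left₀ hρ₂0.le hρ12 _) hθ0.le)
  have hr₂θ : 1 ≤ θ * (ρ₂ ^ t * ρ₂) := by rw [← pow_succ]; exact hrθ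
  have hr₁θ' : 1 ≤ θ * ρ₁ ^ t := by
    refine hr₁θ.trans (mul_le_mul_of_nonneg_left ?_ hθ0.le)
    nlinarith
  obtain ⟨hs1, hs2, -⟩ := of_potential_lt_one hl hΦ
  set π : ℝ := 1 / (N * (D * ((1 + δ) * ρ₁ ^ t))) with hπdef
  have hπ : 0 ≤ π := by positivity
  have hπD : π * D = 1 / (N * ((1 + δ) * ρ₁ ^ t)) := by rw [hπdef]; field_simp
  have hinv : 1 / ((1 + δ) * ρ₁ ^ t) ≤ θ := by
    rw [div_le_iff₀ (by positivity)]
    nlinarith [mul_pos hδ (mul_pos hθ0 hr₁)]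
  have hπD' : π * D ≤ θ / N := by
    rw [hπD]
    calc 1 / (N * ((1 + δ) * ρ₁ ^ t)) = 1 / ((1 + δ) * ρ₁ ^ t) / N := by field_simp
      _ ≤ θ / N := div_le_div_of_nonneg_right hinv hN.le
  have hdegπ : ∀ u ∈ A, π * #(starIn H vs A u) ≤ 1 / N := by
    intro u _
    have h1 := (hs1 u).le
    rw [div_le_iff₀ (by positivity)] at h1
    rw [hπdef, div_mul_eq_mul_div, one_mul, div_le_div_iff₀ (by positivity) hN]
    nlinarith
  have hne : ∀ e ∈ H, (vs e).Nonempty := fun e he => by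
    rw [← Finset.card_pos, hvs e he]; omega
  have hp := stepProb_nonneg H vs A N π hπ hWN hN hne hdegπ
  have hp1 := sum_stepProb H vs A N π
  have hK : ∀ a : Option (W ⊕ ι), #(killed vs a) ≤ k := by
    intro a
    rcases a with _ | u | e
    · simp [killed]
    · simpa [killed] using hk
    · exact hvs' e
  have hd := sum_stepProb_mem H vs A N π
  set c : ℝ := (l * ((θ * k) ^ 2 / L) + l ^ 2 * (12 * (θ * k) ^ 2 / L)) / N with hc
  have hsumQ : ∀ j, ∑ e ∈ inside H vs A, q j e ≤ Q j := fun j => by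
    rw [← hQs j]
    exact Finset.sum_le_sum_of_subset_of_nonneg (Finset.filter_subset _ _) fun e _ _ => hq j e
  -- the three families of statistics
  have e1 : ∀ v, ∑ a, stepProb H vs A N π a *
      Real.exp (l * (#(starIn H vs (A \ killed vs a) v) / (D * ρ₁ ^ (t + 1)) - (1 + δ))) ≤
      Real.exp (l * (#(starIn H vs A v) / (D * ρ₁ ^ t) - (1 + δ))) * Real.exp c := by
    intro v
    have hstar : (#(starIn H vs A v) : ℝ) ≤ D := by
      refine le_trans ?_ (hdeg v)
      norm_cast
      refine Finset.card_le_card fun e he => ?_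
      simp only [starIn, mem_filter] at he ⊢
      exact ⟨he.1, he.2.1⟩
    have := step_starIn_le H vs (killed vs) (stepProb H vs A N π) hp hp1 k hk D L N θ l
      (π * (D / L)) hvs hK A v hd
      (fun u u' hu => sum_stepProb_mem_mem H vs A N π _ hπ u u' hu (hco u u' hu.symm))
      (by positivity) (by
        calc π * (D / L) = π * D / L := by ring
          _ ≤ θ / N / L := div_le_div_of_nonneg_right hπD' hL0.le
          _ = _ := by rw [div_div]) hD hL0 hLN hθ0.le hl.le hlκ hstar (fun w hw => hco v w hw)
      (ρ₁ ^ t) ρ₁ hr₁ hρ₁ hρ₁0 hr₁θ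
    refine le_trans (le_of_eq ?_) (mul_le_mul_of_nonneg_left this (Real.exp_pos _).le)
    rw [Finset.mul_sum]
    refine Finset.sum_congr rfl fun a _ => ?_
    rw [mul_left_comm, ← Real.exp_add, pow_succ]
    congr 2
    ring
  have e2 : ∀ j, ∑ a, stepProb H vs A N π a *
      Real.exp (l * (-((∑ e ∈ inside H vs (A \ killed vs a), q j e) / (Q j * ρ₂ ^ (t + 1))) -
        (-1 + δ))) ≤
      Real.exp (l * (-((∑ e ∈ inside H vs A, q j e) / (Q j * ρ₂ ^ t)) - (-1 + δ))) *
        Real.exp c := by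
    intro j
    have := step_inside_le H vs (killed vs) (stepProb H vs A N π) hp hp1 k (Q j) L N θ l
      hvs hK A hd (hQ j) hL0 hLN hθ0.le hl.le hlκ (q j) (hq j) (hsumQ j) (hqv j)
      (ρ₂ ^ t) ρ₂ hr₂ hρ₂ hρ₂0 hr₂θ
    refine le_trans (le_of_eq ?_) (mul_le_mul_of_nonneg_left this (Real.exp_pos _).le)
    rw [Finset.mul_sum]
    refine Finset.sum_congr rfl fun a _ => ?_
    rw [mul_left_comm, ← Real.exp_add, pow_succ]
    congr 2
    ring
  have e3 : ∀ j, ∑ a, stepProb H vs A N π a *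
      Real.exp (l * (Γ + targetGain δ θ L N ρ₁ ρ₂ t -
        D / Q j * ∑ e ∈ nextSel H vs P A M a, q j e - δ)) ≤
      Real.exp (l * (Γ - D / Q j * ∑ e ∈ M, q j e - δ)) * Real.exp c := by
    intro j
    have hratio0 : 0 ≤ (ρ₂ / ρ₁) ^ t := by positivity
    have hratio1 : (ρ₂ / ρ₁) ^ t ≤ 1 := pow_le_one₀ (by positivity) ((div_le_one hρ₁0).2 hρ12)
    have hδδ0 : 0 ≤ (1 - δ) / (1 + δ) := div_nonneg (by linarith) (by linarith)
    have hδδ1 : (1 - δ) / (1 + δ) ≤ 1 := by rw [div_le_one (by linarith)]; linarith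
    have hy0 : 0 ≤ (1 - δ) / (1 + δ) * (ρ₂ / ρ₁) ^ t := by positivity
    have hy1 : (1 - δ) / (1 + δ) * (ρ₂ / ρ₁) ^ t ≤ 1 := by nlinarith
    have hθL : θ / L ≤ θ := div_le_self hθ0.le hL
    have hθL0 : 0 ≤ θ / L := by positivity
    have := step_gain_le H vs P A M (q j) N π k hk D (Q j) L θ l
      (targetGain δ θ L N ρ₁ ρ₂ t) hp hD (hQ j) hL hLN hθ hl.le hπ hlκ (hq j) (hqD j) (hsumQ j)
      (by
        rw [targetGain, abs_mul, abs_of_pos (by positivity : 0 < 1 / N), div_mul_eq_mul_div,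
          one_mul]
        refine div_le_div_of_nonneg_right (abs_le.2 ⟨by linarith, by linarith⟩) hN.le)
      (hπD'.trans (div_le_div_of_nonneg_right (by linarith) hN.le))
      (by
        have h1 : Q j * ((1 - δ) * ρ₂ ^ t) - Q j / L ≤ ∑ e ∈ addable H vs P A M, q j e := by
          have h2 := (hs2 j).le
          rw [le_div_iff₀ (mul_pos (hQ j) hr₂)] at h2
          have := hP j
          linarith
        have hQj := hQ j
        calc targetGain δ θ L N ρ₁ ρ₂ t ≤
            1 / N * ((1 - δ) / (1 + δ) * (ρ₂ / ρ₁) ^ t - 1 / ((1 + δ) * ρ₁ ^ t) / L) := by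
              rw [targetGain]
              gcongr
          _ = π * (D / Q j * (Q j * ((1 - δ) * ρ₂ ^ t) - Q j / L)) := by
              rw [hπdef, div_pow]
              field_simp
          _ ≤ _ := by gcongr)
    refine le_trans (le_of_eq ?_) (mul_le_mul_of_nonneg_left this (Real.exp_pos _).le)
    rw [Finset.mul_sum]
    refine Finset.sum_congr rfl fun a _ => ?_
    rw [mul_left_comm, ← Real.exp_add, sum_nextSel H vs P A M (q j) hM a]
    congr 2
    ring
  refine exists_le_of_weighted_sum_le (stepProb H vs A N π) _ hp hp1 _ ?_
  unfold potential
  simp only [mul_add, Finset.sum_add_distrib, Finset.mul_sum, add_mul, Finset.sum_mul]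
  rw [Finset.sum_comm (s := univ) (t := (univ : Finset W))]
  rw [Finset.sum_comm (s := univ) (t := (univ : Finset J)),
    Finset.sum_comm (s := univ) (t := (univ : Finset J))]
  simp only [Finset.mul_sum] at e1 e2 e3
  exact add_le_add (Finset.sum_le_sum fun v _ => e1 v)
    (add_le_add (Finset.sum_le_sum fun j _ => e2 j) (Finset.sum_le_sum fun j _ => e3 j))

end GreedyRun

theorem exp_neg_two_mul_le_one_sub {x : ℝ} (hx0 : 0 ≤ x) (hx : x ≤ 1 / 2) :
    Real.exp (-(2 * x)) ≤ 1 - x := by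
  have h1 := Real.add_one_le_exp (2 * x)
  rw [Real.exp_neg, inv_le_iff_one_le_mul₀ (Real.exp_pos _)]
  nlinarith

section Run

variable {ι W J : Type*} [Fintype ι] [DecidableEq ι] [Fintype W] [DecidableEq W] [Fintype J]

theorem exists_state (H : Finset ι) (vs : ι → Finset W) (P : Finset ι → Prop)
    (k : ℕ) (hk : 1 ≤ k) (hvs : ∀ e ∈ H, #(vs e) = k) (hvs' : ∀ e, #(vs e) ≤ k)
    (D L N δ θ l : ℝ) (hD : 0 < D) (hL : 1 ≤ L) (hLN : L ≤ N) (hδ : 0 < δ) (hδ1 : δ < 1)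
    (hWN : (Fintype.card W : ℝ) ≤ N) (hkN : (k : ℝ) < N)
    (hθ : 1 ≤ θ) (hl : 0 < l) (hlκ : l * (3 * (θ * k) / L) ≤ 1)
    (hdeg : ∀ v, (#(H.filter (v ∈ vs ·)) : ℝ) ≤ D)
    (hco : ∀ v w, w ≠ v → (#{e ∈ H | v ∈ vs e ∧ w ∈ vs e} : ℝ) ≤ D / L)
    (q : J → ι → ℝ) (hq : ∀ j e, 0 ≤ q j e) (Q : J → ℝ) (hQ : ∀ j, 0 < Q j)
    (hQs : ∀ j, ∑ e ∈ H, q j e = Q j) (hqD : ∀ j e, q j e ≤ Q j / (D * L))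
    (hqv : ∀ j w, ∑ e ∈ H.filter (w ∈ vs ·), q j e ≤ Q j / L)
    (hP0 : P ∅)
    (hP : ∀ M ⊆ H, (∀ e ∈ M, ∀ f ∈ M, e ≠ f → Disjoint (vs e) (vs f)) → P M →
      ∀ j, ∀ S ⊆ H, (∀ e ∈ S, (∀ f ∈ M, Disjoint (vs e) (vs f)) ∧ ¬ P (insert e M)) →
        ∑ e ∈ S, q j e ≤ Q j / L)
    (n : ℕ) (hrθ : 1 ≤ θ * (1 - (k : ℝ) / N) ^ n)
    (hΦ : (Fintype.card W + 2 * Fintype.card J : ℝ) * Real.exp (-(l * δ)) *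
      Real.exp (n * ((l * ((θ * k) ^ 2 / L) + l ^ 2 * (12 * (θ * k) ^ 2 / L)) / N)) < 1)
    (t : ℕ) (ht : t ≤ n) :
    ∃ (A : Finset W) (M : Finset ι), M ⊆ H ∧
      (∀ e ∈ M, ∀ f ∈ M, e ≠ f → Disjoint (vs e) (vs f)) ∧ (∀ e ∈ M, Disjoint (vs e) A) ∧
      P M ∧
      potential H vs q Q D l δ (1 - ((k : ℝ) - 1) / N) (1 - (k : ℝ) / N)
        (∑ s ∈ range t, targetGain δ θ L N (1 - ((k : ℝ) - 1) / N) (1 - (k : ℝ) / N) s) t A M ≤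
      (Fintype.card W + 2 * Fintype.card J : ℝ) * Real.exp (-(l * δ)) *
        Real.exp (t * ((l * ((θ * k) ^ 2 / L) + l ^ 2 * (12 * (θ * k) ^ 2 / L)) / N)) := by
  have hN : 0 < N := by linarith
  have hL0 : 0 < L := by linarith
  set c : ℝ := (l * ((θ * k) ^ 2 / L) + l ^ 2 * (12 * (θ * k) ^ 2 / L)) / N with hc
  have hc0 : 0 ≤ c := by positivity
  have hr0 : 0 ≤ 1 - (k : ℝ) / N := by rw [sub_nonneg, div_le_one hN]; exact hkN.le
  have hr1 : 1 - (k : ℝ) / N ≤ 1 := by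
    have : 0 ≤ (k : ℝ) / N := by positivity
    linarith
  induction t with
  | zero =>
    refine ⟨univ, ∅, empty_subset _, by simp, by simp, hP0, ?_⟩
    simp only [range_zero, sum_empty, Nat.cast_zero, zero_mul, Real.exp_zero, mul_one, potential,
      pow_zero, mul_zero]
    have h1 : ∀ v, Real.exp (l * (#(starIn H vs univ v) / D - (1 + δ))) ≤
        Real.exp (-(l * δ)) := by
      intro v
      have : (#(starIn H vs univ v) : ℝ) / D ≤ 1 := by
        rw [div_le_one hD]
        refine le_trans ?_ (hdeg v)
        norm_cast
        refine Finset.card_le_card fun e he => ?_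
        simp only [starIn, mem_filter] at he ⊢
        exact ⟨he.1, he.2.1⟩
      rw [Real.exp_le_exp]
      nlinarith
    have h2 : ∀ j, Real.exp (l * (-((∑ e ∈ inside H vs univ, q j e) / Q j) - (-1 + δ))) ≤
        Real.exp (-(l * δ)) := by
      intro j
      have : inside H vs univ = H := by simp [inside]
      rw [this, hQs j, div_self (hQ j).ne', Real.exp_le_exp]
      nlinarith
    have h3 : ∀ j : J, Real.exp (l * (0 - 0 - δ)) ≤ Real.exp (-(l * δ)) := by
      intro j
      rw [Real.exp_le_exp]
      linarith
    calc _ ≤ ∑ v : W, Real.exp (-(l * δ)) +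
          (∑ j : J, Real.exp (-(l * δ)) + ∑ j : J, Real.exp (-(l * δ))) :=
          add_le_add (Finset.sum_le_sum fun v _ => h1 v)
            (add_le_add (Finset.sum_le_sum fun j _ => h2 j)
              (Finset.sum_le_sum fun j _ => h3 j))
      _ = _ := by
          simp only [sum_const, card_univ, nsmul_eq_mul]
          ring
  | succ t ih =>
    obtain ⟨A, M, hMH, hMd, hMA, hPM, hpot⟩ := ih (by omega)
    have hne : ∀ e ∈ H, (vs e).Nonempty := fun e he => by
      rw [← Finset.card_pos, hvs e he]; omega
    have hlt : potential H vs q Q D l δ (1 - ((k : ℝ) - 1) / N) (1 - (k : ℝ) / N)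
        (∑ s ∈ range t, targetGain δ θ L N (1 - ((k : ℝ) - 1) / N) (1 - (k : ℝ) / N) s)
        t A M < 1 := by
      refine (hpot.trans ?_).trans_lt hΦ
      gcongr
      omega
    have hinM : ∀ e ∈ inside H vs A, e ∉ M := by
      intro e he heM
      simp only [inside, mem_filter] at he
      obtain ⟨x, hx⟩ := hne e he.1
      exact Finset.disjoint_left.1 (hMA e heM) hx (he.2 hx)
    obtain ⟨a, ha⟩ := exists_next H vs P k hk hvs hvs' D L N δ θ l hD hL hLN hδ hδ1 hWN hkN hθ hl
      hlκ hdeg hco q hq Q hQ hQs hqD hqv t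
      (hrθ.trans (mul_le_mul_of_nonneg_left (pow_le_pow_of_le_one hr0 hr1 ht) (by linarith)))
      _ A M hinM (by
        intro j
        have h1 := hP M hMH hMd hPM j (inside H vs A \ addable H vs P A M)
          (fun e he => by
            simp only [inside, mem_sdiff, mem_filter] at he
            exact he.1.1)
          (fun e he => by
            rw [mem_sdiff] at he
            refine ⟨fun f hf => ?_, fun hPe => he.2 ?_⟩
            · simp only [inside, mem_filter] at he
              exact (Finset.disjoint_of_subset_right he.1.2 (hMA f hf)).symm
            · simp only [addable, mem_filter]
              exact ⟨he.1, hPe⟩)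
        have h2 := Finset.sum_sdiff (f := q j) (addable_subset H vs P A M)
        linarith) hlt
    refine ⟨A \ killed vs a, nextSel H vs P A M a, ?_, ?_, ?_, ?_, ?_⟩
    · rcases a with _ | u | e
      · exact hMH
      · exact hMH
      · simp only [nextSel]
        split_ifs with h
        · refine Finset.insert_subset ?_ hMH
          have := addable_subset H vs P A M h
          simp only [inside, mem_filter] at this
          exact this.1
        · exact hMH
    · rcases a with _ | u | e
      · exact hMd
      · exact hMd
      · simp only [nextSel]
        split_ifs with h
        · have := addable_subset H vs P A M h
          simp only [inside, mem_filter] at this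
          intro x hx y hy hxy
          rw [mem_insert] at hx hy
          rcases hx with rfl | hx <;> rcases hy with rfl | hy
          · exact absurd rfl hxy
          · exact (Finset.disjoint_of_subset_right this.2 (hMA y hy)).symm
          · exact Finset.disjoint_of_subset_right this.2 (hMA x hx)
          · exact hMd x hx y hy hxy
        · exact hMd
    · have hold : ∀ x ∈ M, Disjoint (vs x) (A \ killed vs a) := fun x hx =>
        Finset.disjoint_of_subset_right sdiff_subset (hMA x hx)
      rcases a with _ | u | e
      · exact hold
      · exact hold
      · simp only [nextSel]
        split_ifs with h
        · intro x hx
          rw [mem_insert] at hx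
          rcases hx with rfl | hx
          · simp only [killed]
            exact Finset.disjoint_sdiff
          · exact hold x hx
        · exact hold
    · rcases a with _ | u | e
      · exact hPM
      · exact hPM
      · simp only [nextSel]
        split_ifs with h
        · simp only [addable, mem_filter] at h
          exact h.2
        · exact hPM
    · rw [Finset.sum_range_succ]
      refine ha.trans ((mul_le_mul_of_nonneg_right hpot (Real.exp_pos _).le).trans (le_of_eq ?_))
      rw [mul_assoc, ← Real.exp_add]
      push_cast
      congr 2
      ring

end Run

theorem le_sum_targetGain {δ θ L N : ℝ} {k T n : ℕ} (hδ : 0 < δ) (hδ1 : δ ≤ 1)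
    (hN : 0 < N) (hk : 1 ≤ k) (hkN : (k : ℝ) / N ≤ δ) (hkN' : (k : ℝ) < N) (hn : (n : ℝ) = T * N)
    (hT : Real.exp (-T) ≤ δ) (hTL : T * θ / L ≤ δ) :
    1 - 5 * δ ≤ ∑ s ∈ range n, targetGain δ θ L N (1 - ((k : ℝ) - 1) / N) (1 - (k : ℝ) / N) s := by
  set ρ₁ : ℝ := 1 - ((k : ℝ) - 1) / N with hρ₁
  set ρ₂ : ℝ := 1 - (k : ℝ) / N with hρ₂
  have hk' : (1 : ℝ) ≤ k := by exact_mod_cast hk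
  have hρ₂0 : 0 < ρ₂ := by rw [hρ₂, sub_pos, div_lt_one hN]; exact hkN'
  have hρ12 : ρ₁ = ρ₂ + 1 / N := by rw [hρ₁, hρ₂]; ring
  have hN1 : 0 < 1 / N := by positivity
  have hρ₁0 : 0 < ρ₁ := by linarith
  have hρ₁1 : ρ₁ ≤ 1 := by
    have : 0 ≤ ((k : ℝ) - 1) / N := div_nonneg (by linarith) hN.le
    linarith
  set r : ℝ := ρ₂ / ρ₁ with hr
  have hr0 : 0 < r := by positivity
  have hr1 : 1 - r = 1 / N / ρ₁ := by rw [hr, hρ12]; field_simp; ring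
  have hr1' : 1 / N ≤ 1 - r := by
    rw [hr1, le_div_iff₀ hρ₁0]
    nlinarith
  have hgeom : (∑ s ∈ range n, r ^ s) * (1 / N) = ρ₁ * (1 - r ^ n) := by
    have := geom_sum_mul_neg r n
    rw [← this, hr1]
    field_simp
  have hrn : r ^ n ≤ δ := by
    calc r ^ n ≤ (Real.exp (-(1 / N))) ^ n := by
          refine pow_le_pow_left₀ hr0.le ?_ n
          have := Real.add_one_le_exp (-(1 / N))
          linarith
      _ = Real.exp (-T) := by
          rw [← Real.exp_nat_mul, hn]
          congr 1
          field_simp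
      _ ≤ δ := hT
  have hsum : ∑ s ∈ range n, targetGain δ θ L N ρ₁ ρ₂ s =
      (1 - δ) / (1 + δ) * ((∑ s ∈ range n, r ^ s) * (1 / N)) - T * θ / L := by
    simp only [targetGain, ← hr]
    rw [← Finset.mul_sum, Finset.sum_sub_distrib, ← Finset.mul_sum, sum_const, card_range,
      nsmul_eq_mul, hn]
    field_simp
  rw [hsum, hgeom]
  have h1 : (1 - δ) * (1 - δ) ≤ ρ₁ * (1 - r ^ n) := by
    refine mul_le_mul (by linarith) (by linarith) (by linarith) hρ₁0.le
  have h2 : 1 - 4 * δ ≤ (1 - δ) / (1 + δ) * ((1 - δ) * (1 - δ)) := by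
    rw [div_mul_eq_mul_div, le_div_iff₀ (by linarith)]
    nlinarith [mul_pos hδ hδ, mul_nonneg (mul_pos hδ hδ).le (sub_nonneg.2 hδ1)]
  have h3 : (1 - δ) / (1 + δ) * ((1 - δ) * (1 - δ)) ≤ (1 - δ) / (1 + δ) * (ρ₁ * (1 - r ^ n)) :=
    mul_le_mul_of_nonneg_left h1 (div_nonneg (by linarith) (by linarith))
  linarith

set_option maxHeartbeats 1000000 in
/-- A nearly regular uniform hypergraph with small codegrees has a matching that is almost perfect
with respect to each of a given family of weight functions, and that can moreover be required to
keep a property which at every stage forbids only few further edges. -/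
theorem exists_pseudorandom_matching (k : ℕ) (hk : 1 ≤ k) (γ : ℝ) (hγ : 0 < γ) :
    ∃ K : ℝ, 1 ≤ K ∧ ∀ {ι W J : Type} [Fintype ι] [DecidableEq ι] [Fintype W] [DecidableEq W]
      [Fintype J] (H : Finset ι) (vs : ι → Finset W) (P : Finset ι → Prop)
      (_ : ∀ e ∈ H, #(vs e) = k) (_ : ∀ e, #(vs e) ≤ k) (D L : ℝ) (_ : 0 < D)
      (_ : K * (Real.log (Fintype.card W + Fintype.card J + 2) + 1) ≤ L)
      (_ : ∀ v, (#(H.filter (v ∈ vs ·)) : ℝ) ≤ D)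
      (_ : ∀ v w, w ≠ v → (#{e ∈ H | v ∈ vs e ∧ w ∈ vs e} : ℝ) ≤ D / L)
      (q : J → ι → ℝ) (_ : ∀ j e, 0 ≤ q j e) (Q : J → ℝ) (_ : ∀ j, 0 < Q j)
      (_ : ∀ j, ∑ e ∈ H, q j e = Q j) (_ : ∀ j e, q j e ≤ Q j / (D * L))
      (_ : ∀ j w, ∑ e ∈ H.filter (w ∈ vs ·), q j e ≤ Q j / L)
      (_ : P ∅)
      (_ : ∀ M ⊆ H, (∀ e ∈ M, ∀ f ∈ M, e ≠ f → Disjoint (vs e) (vs f)) → P M →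
        ∀ j, ∀ S ⊆ H, (∀ e ∈ S, (∀ f ∈ M, Disjoint (vs e) (vs f)) ∧ ¬ P (insert e M)) →
          ∑ e ∈ S, q j e ≤ Q j / L),
      ∃ M ⊆ H, (∀ e ∈ M, ∀ f ∈ M, e ≠ f → Disjoint (vs e) (vs f)) ∧ P M ∧
        ∀ j, (1 - γ) * (Q j / D) ≤ ∑ e ∈ M, q j e := by
  set δ : ℝ := min γ 1 / 6 with hδdef
  have hδ : 0 < δ := by positivity
  have hδ1 : δ ≤ 1 / 6 := by rw [hδdef]; linarith [min_le_right γ 1]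
  have hδγ : 6 * δ ≤ γ := by rw [hδdef]; linarith [min_le_left γ 1]
  obtain ⟨T, hT⟩ := exists_nat_gt (Real.log (1 / δ))
  have hT0 : (0 : ℝ) < T := by
    refine lt_trans (Real.log_pos ?_) hT
    rw [lt_div_iff₀ hδ]; linarith
  have hTδ : Real.exp (-T) ≤ δ := by
    rw [← Real.exp_log hδ, Real.exp_le_exp]
    rw [one_div, Real.log_inv] at hT
    linarith
  have hT1 : (1 : ℝ) ≤ T := by
    have : 0 < T := by exact_mod_cast hT0
    exact_mod_cast this
  set θ : ℝ := Real.exp (2 * k * T) with hθdef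
  have hk' : (1 : ℝ) ≤ k := by exact_mod_cast hk
  have hθ : 1 ≤ θ := Real.one_le_exp (by positivity)
  have hθ0 : 0 < θ := by linarith
  set s : ℝ := δ / (24 * (θ * k) ^ 2 * T) with hs
  have hs0 : 0 < s := by positivity
  refine ⟨max 1 (max (4 / (s * δ)) (T * θ / δ)), le_max_left _ _, ?_⟩
  intro ι W J _ _ _ _ _ H vs P hvs hvs' D L hD hL hdeg hco q hq Q hQ hQs hqD hqv hP0 hP
  set X : ℝ := Fintype.card W + Fintype.card J + 2 with hX
  have hX2 : 2 ≤ X := by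
    have h1 : (0 : ℝ) ≤ Fintype.card W := Nat.cast_nonneg _
    have h2 : (0 : ℝ) ≤ Fintype.card J := Nat.cast_nonneg _
    linarith
  have hlogX : 0 < Real.log X := Real.log_pos (by linarith)
  have hKL : max 1 (max (4 / (s * δ)) (T * θ / δ)) ≤ L := by
    refine le_trans ?_ hL
    have h1 : (0 : ℝ) ≤ max 1 (max (4 / (s * δ)) (T * θ / δ)) :=
      zero_le_one.trans (le_max_left _ _)
    nlinarith
  have hL1 : 1 ≤ L := (le_max_left _ _).trans hKL
  have hL0 : 0 < L := by linarith
  have hTL : T * θ / L ≤ δ := by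
    have := ((le_max_right _ _).trans (le_max_right _ _)).trans hKL
    rw [div_le_iff₀ hδ] at this
    rw [div_le_iff₀ hL0]
    linarith
  have hL4 : 2 * (Real.log X + 1) ≤ s * L * δ / 2 := by
    have h1 : 4 / (s * δ) * (Real.log X + 1) ≤ L := by
      refine le_trans (mul_le_mul_of_nonneg_right ?_ (by linarith)) hL
      exact (le_max_left _ _).trans (le_max_right _ _)
    rw [div_mul_eq_mul_div, div_le_iff₀ (by positivity)] at h1
    linarith
  obtain ⟨N, hN⟩ := exists_nat_ge (max (max L (Fintype.card W)) (k / δ))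
  have hLN : L ≤ N := ((le_max_left _ _).trans (le_max_left _ _)).trans hN
  have hWN : (Fintype.card W : ℝ) ≤ N := ((le_max_right _ _).trans (le_max_left _ _)).trans hN
  have hkN : (k : ℝ) / δ ≤ N := (le_max_right _ _).trans hN
  have hN0 : (0 : ℝ) < N := by linarith
  have hkN' : (k : ℝ) / N ≤ δ := by
    rw [div_le_iff₀ hδ] at hkN
    rw [div_le_iff₀ hN0]
    linarith
  have hkN2 : (k : ℝ) < N := by
    rw [div_le_iff₀ hN0] at hkN'
    nlinarith
  have hθk : 1 ≤ θ * k := by nlinarith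
  have hlκ : s * L * (3 * (θ * k) / L) ≤ 1 := by
    have : s * L * (3 * (θ * k) / L) = δ / (8 * (θ * k) * T) := by
      rw [hs]; field_simp; norm_num
    rw [this, div_le_one (by positivity)]
    nlinarith
  have hc : ((T * N : ℕ) : ℝ) * ((s * L * ((θ * k) ^ 2 / L) +
      (s * L) ^ 2 * (12 * (θ * k) ^ 2 / L)) / N) = δ / 24 + s * L * δ / 2 := by
    have : s * ((θ * k) ^ 2 * T) = δ / 24 := by rw [hs]; field_simp
    calc _ = s * ((θ * k) ^ 2 * T) + 12 * s * L * (s * ((θ * k) ^ 2 * T)) := by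
          push_cast; field_simp
      _ = _ := by rw [this]; ring
  have hΦ : (Fintype.card W + 2 * Fintype.card J : ℝ) * Real.exp (-(s * L * δ)) *
      Real.exp ((T * N : ℕ) * ((s * L * ((θ * k) ^ 2 / L) +
        (s * L) ^ 2 * (12 * (θ * k) ^ 2 / L)) / N)) < 1 := by
    rw [hc]
    have h1 : (Fintype.card W + 2 * Fintype.card J : ℝ) ≤ Real.exp (2 * Real.log X) := by
      rw [two_mul (Real.log X), Real.exp_add, Real.exp_log (by linarith)]
      have h1 : (0 : ℝ) ≤ Fintype.card W := Nat.cast_nonneg _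
      have h2 : (0 : ℝ) ≤ Fintype.card J := Nat.cast_nonneg _
      nlinarith
    calc _ ≤ Real.exp (2 * Real.log X) * Real.exp (-(s * L * δ)) *
          Real.exp (δ / 24 + s * L * δ / 2) := by gcongr
      _ = Real.exp (2 * Real.log X + -(s * L * δ) + (δ / 24 + s * L * δ / 2)) := by
          rw [← Real.exp_add, ← Real.exp_add]
      _ < 1 := by
          rw [Real.exp_lt_one_iff]
          linarith
  have hrθ : 1 ≤ θ * (1 - (k : ℝ) / N) ^ (T * N) := by
    have h1 := exp_neg_two_mul_le_one_sub (x := (k : ℝ) / N) (by positivity) (by linarith)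
    have h2 := pow_le_pow_left₀ (Real.exp_pos _).le h1 (T * N)
    rw [← Real.exp_nat_mul] at h2
    have h3 : ((T * N : ℕ) : ℝ) * -(2 * (k / N)) = -(2 * k * T) := by
      push_cast; field_simp
    rw [h3, Real.exp_neg, ← hθdef] at h2
    calc 1 = θ * θ⁻¹ := by field_simp
      _ ≤ _ := by gcongr
  obtain ⟨A, M, hMH, hMd, -, hPM, hpot⟩ := exists_state H vs P k hk hvs hvs' D L N δ θ (s * L)
    hD hL1 hLN hδ (by linarith) hWN hkN2 hθ (by positivity) hlκ hdeg hco q hq Q hQ hQs hqD hqv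
    hP0 hP (T * N) hrθ hΦ (T * N) le_rfl
  refine ⟨M, hMH, hMd, hPM, fun j => ?_⟩
  obtain ⟨-, -, h3⟩ := of_potential_lt_one (by positivity) (hpot.trans_lt hΦ)
  have h4 := h3 j
  have h5 := le_sum_targetGain (L := L) (θ := θ) (n := T * N) hδ (by linarith) hN0 hk hkN' hkN2
    (by push_cast; ring) hTδ hTL
  have h6 : 1 - γ ≤ D / Q j * ∑ e ∈ M, q j e := by linarith
  have hQj := hQ j
  calc (1 - γ) * (Q j / D) ≤ (D / Q j * ∑ e ∈ M, q j e) * (Q j / D) := by gcongr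
    _ = _ := by field_simp


/-- Choosing one candidate per index so that all keys of candidates chosen for different indices
differ. -/
theorem exists_key_free {I Γ X : Type*} [Fintype I] [Fintype Γ] [DecidableEq X] (r : ℕ)
    (key : Fin r → I → Γ → X) (G : I → Finset Γ) (G0 G1 τ : ℝ) (hG0 : 0 < G0)
    (hG : ∀ i, G0 ≤ #(G i)) (hG1 : ∀ i, (#(G i) : ℝ) ≤ G1)
    (hτ : ∀ b x, ∑ j, (#{g ∈ G j | key b j g = x} : ℝ) ≤ τ) (hτ0 : 0 ≤ τ)
    (hb : G1 * (r ^ 2 * τ) ≤ G0 ^ 2 / 4) :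
    ∃ g : I → Γ, (∀ i, g i ∈ G i) ∧
      ∀ i j, i ≠ j → ∀ a b, key a i (g i) ≠ key b j (g j) := by
  classical
  obtain ⟨g, hg, hg'⟩ := exists_conflict_free G
    (fun i g j g' => ∃ a b, key a i g = key b j g')
    (fun i g j g' ⟨a, b, h⟩ => ⟨b, a, h.symm⟩) G0 hG0 hG
    (fun i j => ∑ g ∈ G i, ∑ a, ∑ b, (#{g' ∈ G j | key b j g' = key a i g} : ℝ))
    (by
      intro i j _ hdec
      have h1 : ({q ∈ G i ×ˢ G j | ∃ a b, key a i q.1 = key b j q.2} : Finset (Γ × Γ)) ⊆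
          (G i).biUnion fun g => univ.biUnion fun a => univ.biUnion fun b =>
            ({g' ∈ G j | key b j g' = key a i g} : Finset Γ).image (fun g' => (g, g')) := by
        intro q hq
        simp only [mem_filter, mem_product, mem_biUnion, mem_univ, true_and, mem_image] at hq ⊢
        obtain ⟨⟨h1, h2⟩, a, b, h⟩ := hq
        exact ⟨q.1, h1, a, b, q.2, ⟨h2, h.symm⟩, rfl⟩
      have h2 : #({q ∈ G i ×ˢ G j | ∃ a b, key a i q.1 = key b j q.2} : Finset (Γ × Γ)) ≤
          ∑ g ∈ G i, ∑ a, ∑ b, #{g' ∈ G j | key b j g' = key a i g} := by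
        refine (Finset.card_le_card h1).trans (Finset.card_biUnion_le.trans ?_)
        refine Finset.sum_le_sum fun g _ => Finset.card_biUnion_le.trans ?_
        refine Finset.sum_le_sum fun a _ => Finset.card_biUnion_le.trans ?_
        exact Finset.sum_le_sum fun b _ => Finset.card_image_le
      refine le_trans (le_of_eq ?_) (by exact_mod_cast h2 :
        (#({q ∈ G i ×ˢ G j | ∃ a b, key a i q.1 = key b j q.2} : Finset (Γ × Γ)) : ℝ) ≤ _)
      congr!)
    (fun i j => by positivity)
    (by
      intro i
      rw [Finset.sum_comm]
      have h1 : ∀ g ∈ G i,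
          ∑ j, ∑ a, ∑ b, (#{g' ∈ G j | key b j g' = key a i g} : ℝ) ≤ r ^ 2 * τ := by
        intro g _
        rw [Finset.sum_comm]
        calc _ ≤ ∑ a : Fin r, ∑ b : Fin r, τ := by
              refine Finset.sum_le_sum fun a _ => ?_
              rw [Finset.sum_comm]
              exact Finset.sum_le_sum fun b _ => hτ b _
          _ = _ := by simp; ring
      refine (Finset.sum_le_sum h1).trans ?_
      rw [Finset.sum_const, nsmul_eq_mul]
      refine le_trans ?_ hb
      exact mul_le_mul_of_nonneg_right (hG1 i) (by positivity))
  exact ⟨g, hg, fun i j hij a b h => hg' i j hij ⟨a, b, h⟩⟩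

theorem card_biUnion_univ_le {Ω S : Type*} [DecidableEq Ω] [Fintype S] (A : S → Finset Ω) (x : ℝ)
    (hA : ∀ s, (#(A s) : ℝ) ≤ x) : (#(univ.biUnion A) : ℝ) ≤ Fintype.card S * x := by
  calc (#(univ.biUnion A) : ℝ) ≤ ∑ s, (#(A s) : ℝ) := by exact_mod_cast card_biUnion_le
    _ ≤ ∑ s : S, x := Finset.sum_le_sum fun s _ => hA s
    _ = _ := by simp

theorem exists_avoiding {Ω S T U : Type*} [Fintype Ω] [Fintype S] [Fintype T] [Fintype U]
    (A : S → Finset Ω) (B : T → Finset Ω) (D : U → Finset Ω) (x : ℝ)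
    (hA : ∀ s, (#(A s) : ℝ) ≤ x) (hB : ∀ s, (#(B s) : ℝ) ≤ x) (hD : ∀ s, (#(D s) : ℝ) ≤ x)
    (h : (Fintype.card S + Fintype.card T + Fintype.card U : ℝ) * x < Fintype.card Ω) :
    ∃ w, (∀ s, w ∉ A s) ∧ (∀ s, w ∉ B s) ∧ ∀ s, w ∉ D s := by
  classical
  by_contra! hcon
  have h1 : (univ : Finset Ω) ⊆ univ.biUnion A ∪ (univ.biUnion B ∪ univ.biUnion D) := by
    intro w _
    simp only [mem_union, mem_biUnion, mem_univ, true_and]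
    by_cases h2 : ∀ s, w ∉ A s
    · by_cases h3 : ∀ s, w ∉ B s
      · exact Or.inr (Or.inr (hcon w h2 h3))
      · push Not at h3; exact Or.inr (Or.inl h3)
    · push Not at h2; exact Or.inl h2
  have h2 : (Fintype.card Ω : ℝ) ≤ #(univ.biUnion A) + (#(univ.biUnion B) + #(univ.biUnion D)) := by
    have h3 := (Finset.card_le_card h1).trans ((card_union_le _ _).trans
      (Nat.add_le_add_left (card_union_le _ _) _))
    rw [card_univ] at h3
    exact_mod_cast h3
  linarith [card_biUnion_univ_le A x hA, card_biUnion_univ_le B x hB, card_biUnion_univ_le D x hD]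

section Template

variable {V C : Type} [Fintype V] [DecidableEq V]
  {d r : ℕ} {κ : Type}

/-- The colours of the edges of a template under a placement of its free points. -/
def ecol (f : V → V → C) (u : κ → V) (E : Fin r → Fin d × (Fin d ⊕ κ)) (p : Fin d → V)
    (l : Fin r) : C :=
  f (p (E l).1) (Sum.elim p u (E l).2)

/-- The free point `j` lies on the template edge `e`. -/
def OnEdge (e : Fin d × (Fin d ⊕ κ)) (j : Fin d) : Prop :=
  (e.1 = j ∧ e.2 ≠ Sum.inl j) ∨ (e.2 = Sum.inl j ∧ e.1 ≠ j)

/-- The free point `j` does not lie on the template edge `e`. -/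
def OffEdge (e : Fin d × (Fin d ⊕ κ)) (j : Fin d) : Prop :=
  e.1 ≠ j ∧ e.2 ≠ Sum.inl j

instance [DecidableEq κ] (e : Fin d × (Fin d ⊕ κ)) (j : Fin d) : Decidable (OnEdge e j) := by
  unfold OnEdge; infer_instance

instance [DecidableEq κ] (e : Fin d × (Fin d ⊕ κ)) (j : Fin d) : Decidable (OffEdge e j) := by
  unfold OffEdge; infer_instance

omit [Fintype V] [DecidableEq V] in
theorem elim_update (u : κ → V) (p : Fin d → V) (j : Fin d) (v : V) (a : Fin d ⊕ κ)
    (ha : a ≠ Sum.inl j) : Sum.elim (Function.update p j v) u a = Sum.elim p u a := by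
  rcases a with i | a
  · have : i ≠ j := fun h => ha (by rw [h])
    simp [this]
  · rfl

variable [DecidableEq C] (f : V → V → C) (hf : ∀ x y, f x y = f y x) (Λ : ℝ)
  (hloc : ∀ v c, (#{x | f v x = c} : ℝ) ≤ Fintype.card V / Λ)

include hf hloc in
theorem card_ecol_eq_le [Nonempty V] (u : κ → V) (E : Fin r → Fin d × (Fin d ⊕ κ))
    (S : Finset (Fin d → V)) (j : Fin d)
    (hS : ∀ b ∈ S, ∀ v, Function.update b j v ∈ S) (l : Fin r) (hl : OnEdge (E l) j)
    (F : (Fin d → V) → C) (hF : ∀ p v, F (Function.update p j v) = F p) :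
    (#{p ∈ S | ecol f u E p l = F p} : ℝ) ≤ #S / Λ := by
  have hn : (0 : ℝ) < Fintype.card V := by exact_mod_cast Fintype.card_pos
  have key := card_filter_mul_le S j hS (fun p => ecol f u E p l = F p) (Fintype.card V / Λ) (by
    intro b _
    rcases hl with ⟨h1, h2⟩ | ⟨h1, h2⟩
    · refine le_trans ?_ (hloc (Sum.elim b u (E l).2) (F b))
      norm_cast
      refine Finset.card_le_card fun v hv => ?_
      simp only [mem_filter, mem_univ, true_and, ecol, hF] at hv ⊢
      rw [elim_update u b j v _ h2, h1, Function.update_self, hf] at hv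
      exact hv
    · refine le_trans ?_ (hloc (b (E l).1) (F b))
      norm_cast
      refine Finset.card_le_card fun v hv => ?_
      simp only [mem_filter, mem_univ, true_and, ecol, hF] at hv ⊢
      rw [h1, Function.update_of_ne h2, Sum.elim_inl, Function.update_self] at hv
      exact hv)
  have h2 : (#S : ℝ) * (Fintype.card V / Λ) = #S / Λ * Fintype.card V := by ring
  rw [h2] at key
  exact le_of_mul_le_mul_right key hn

omit [Fintype V] [DecidableEq V] [DecidableEq C] in
theorem ecol_update_of_offEdge (u : κ → V) (E : Fin r → Fin d × (Fin d ⊕ κ))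
    (l : Fin r) (j : Fin d) (h : OffEdge (E l) j) (p : Fin d → V) (v : V) :
    ecol f u E (Function.update p j v) l = ecol f u E p l := by
  unfold ecol
  rw [elim_update u p j v _ h.2, Function.update_of_ne h.1]

include hf hloc in
theorem le_card_injective [Nonempty V] (hΛ : 0 < Λ) (u : κ → V)
    (E : Fin r → Fin d × (Fin d ⊕ κ))
    (S S' : Finset (Fin d → V)) (hSS : S' ⊆ S) (T : Finset (Fin d))
    (hS : ∀ j ∈ T, ∀ b ∈ S, ∀ v, Function.update b j v ∈ S)
    (hsep : ∀ l l', l < l' → (∃ j ∈ T, (OnEdge (E l) j ∧ OffEdge (E l') j) ∨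
      (OnEdge (E l') j ∧ OffEdge (E l) j)) ∨ ∀ p ∈ S', ecol f u E p l ≠ ecol f u E p l')
    [DecidablePred fun p => Function.Injective (ecol f u E p)] :
    (#S' : ℝ) - r ^ 2 * (#S / Λ) ≤ #{p ∈ S' | Function.Injective (ecol f u E p)} := by
  classical
  have hpair : ∀ l l', l < l' →
      (#{p ∈ S' | ecol f u E p l = ecol f u E p l'} : ℝ) ≤ #S / Λ := by
    intro l l' hll
    rcases hsep l l' hll with ⟨j, hj, h | h⟩ | h
    · refine le_trans ?_ (card_ecol_eq_le f hf Λ hloc u E S j (hS j hj) l h.1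
        (fun p => ecol f u E p l') (ecol_update_of_offEdge f u E l' j h.2))
      exact_mod_cast Finset.card_le_card (Finset.filter_subset_filter _ hSS)
    · refine le_trans ?_ (card_ecol_eq_le f hf Λ hloc u E S j (hS j hj) l' h.1
        (fun p => ecol f u E p l) (ecol_update_of_offEdge f u E l j h.2))
      have : #{p ∈ S' | ecol f u E p l = ecol f u E p l'} ≤
          #{p ∈ S | ecol f u E p l' = ecol f u E p l} := by
        refine Finset.card_le_card fun p hp => ?_
        simp only [mem_filter] at hp ⊢
        exact ⟨hSS hp.1, hp.2.symm⟩
      exact_mod_cast this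
    · rw [Finset.filter_false_of_mem h]
      simp only [card_empty, Nat.cast_zero]
      positivity
  have hsub : S' ⊆ ({p ∈ S' | Function.Injective (ecol f u E p)} : Finset _) ∪
      ({q : Fin r × Fin r | q.1 < q.2} : Finset _).biUnion
        fun q => {p ∈ S' | ecol f u E p q.1 = ecol f u E p q.2} := by
    intro p hp
    by_cases hinj : Function.Injective (ecol f u E p)
    · exact mem_union_left _ (mem_filter.2 ⟨hp, hinj⟩)
    · refine mem_union_right _ ?_
      simp only [Function.Injective] at hinj
      push Not at hinj
      obtain ⟨l, l', h1, h2⟩ := hinj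
      simp only [mem_biUnion, mem_filter, mem_univ, true_and]
      rcases lt_or_gt_of_ne h2 with h | h
      · exact ⟨(l, l'), h, hp, h1⟩
      · exact ⟨(l', l), h, hp, h1.symm⟩
  have h1 : (#S' : ℝ) ≤ #{p ∈ S' | Function.Injective (ecol f u E p)} +
      ∑ q : Fin r × Fin r with q.1 < q.2,
        (#{p ∈ S' | ecol f u E p q.1 = ecol f u E p q.2} : ℝ) := by
    have := (Finset.card_le_card hsub).trans ((card_union_le _ _).trans
      (Nat.add_le_add_left card_biUnion_le _))
    exact_mod_cast this
  have h2 : ∑ q : Fin r × Fin r with q.1 < q.2,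
      (#{p ∈ S' | ecol f u E p q.1 = ecol f u E p q.2} : ℝ) ≤ r ^ 2 * (#S / Λ) := by
    have h0 : (0 : ℝ) ≤ #S / Λ := by positivity
    calc _ ≤ ∑ q : Fin r × Fin r with q.1 < q.2, (#S / Λ : ℝ) :=
          Finset.sum_le_sum fun q hq => hpair q.1 q.2 (mem_filter.1 hq).2
      _ ≤ ∑ q : Fin r × Fin r, (#S / Λ : ℝ) :=
          Finset.sum_le_sum_of_subset_of_nonneg (Finset.filter_subset _ _) fun _ _ _ => h0
      _ = _ := by
          rw [sum_const, card_univ, Fintype.card_prod, Fintype.card_fin, nsmul_eq_mul]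
          push_cast
          ring
  linarith

end Template

section Test

variable {V C : Type} [Fintype V] [DecidableEq V] [Fintype C] [DecidableEq C]
  {d r : ℕ} {κ : Type}

theorem exists_bad_lottery [Nonempty V] (f : V → V → C) (hf : ∀ x y, f x y = f y x) (Λ : ℝ)
    (hloc : ∀ v c, (#{x | f v x = c} : ℝ) ≤ Fintype.card V / Λ) {m : ℕ} (hm : 0 < m)
    (hr : 0 < r) (hΛ : 0 < Λ) (u : κ → V) (E : Fin r → Fin d × (Fin d ⊕ κ))
    (S S' : Finset (Fin d → V)) (hS0 : S.Nonempty) (hSS : S' ⊆ S) (T : Finset (Fin d))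
    (hS : ∀ j ∈ T, ∀ b ∈ S, ∀ v, Function.update b j v ∈ S)
    (hon : ∀ l, ∃ j ∈ T, OnEdge (E l) j)
    (hsep : ∀ l l', l < l' → (∃ j ∈ T, (OnEdge (E l) j ∧ OffEdge (E l') j) ∨
      (OnEdge (E l') j ∧ OffEdge (E l) j)) ∨ ∀ p ∈ S', ecol f u E p l ≠ ecol f u E p l')
    (s : Fin r → Finset (Fin m)) (δ : ℝ) (hδ : 0 < δ) (hδ1 : δ ≤ 1) (r₀ : ℕ) (hr₀ : r ≤ r₀) :
    ∃ A : Finset (C → Fin m),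
      (#A : ℝ) ≤ 2 * Fintype.card (C → Fin m) * Real.exp (-(δ ^ 2 * Λ / (4 * r₀ ^ 2))) ∧
      ∀ k ∉ A, ∀ [DecidablePred fun p => Function.Injective (ecol f u E p) ∧
          ∀ l, k (ecol f u E p l) ∈ s l],
        |(#{p ∈ S' | Function.Injective (ecol f u E p) ∧ ∀ l, k (ecol f u E p l) ∈ s l} : ℝ) -
          #S' * ∏ l, (#(s l) : ℝ) / m| ≤ (δ + r ^ 2 / Λ) * #S := by
  classical
  have hS0' : (0 : ℝ) < #S := by exact_mod_cast hS0.card_pos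
  set B : Finset (Fin d → V) := {p ∈ S' | Function.Injective (ecol f u E p)} with hB
  have hBS : B ⊆ S := (Finset.filter_subset _ _).trans hSS
  refine ⟨({k | δ * #S < |(#{p ∈ B | ∀ l, k (ecol f u E p l) ∈ s l} : ℝ) -
      #B * ∏ l, (#(s l) : ℝ) / m|} : Finset (C → Fin m)), ?_, ?_⟩
  · have := card_lottery_bad_le hm hr B (ecol f u E) (fun p hp => (mem_filter.1 hp).2) s #S Λ δ
      hS0' hΛ hδ hδ1 (by exact_mod_cast Finset.card_le_card hBS) (by
        intro l c
        obtain ⟨j, hj, hl⟩ := hon l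
        refine le_trans ?_ (card_ecol_eq_le f hf Λ hloc u E S j (hS j hj) l hl
          (fun _ => c) (fun _ _ => rfl))
        exact_mod_cast Finset.card_le_card (Finset.filter_subset_filter _ hBS))
    refine this.trans (mul_le_mul_of_nonneg_left ?_ (by positivity))
    rw [Real.exp_le_exp, neg_le_neg_iff]
    have : (r : ℝ) ≤ r₀ := by exact_mod_cast hr₀
    have h0 : (0 : ℝ) < r := by exact_mod_cast hr
    gcongr
  · intro k hk hdec
    simp only [mem_filter, mem_univ, true_and, not_lt] at hk
    have h1 : (#S' : ℝ) - r ^ 2 * (#S / Λ) ≤ #B :=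
      le_card_injective f hf Λ hloc hΛ u E S S' hSS T hS hsep
    have h2 : (#B : ℝ) ≤ #S' := by exact_mod_cast Finset.card_le_card (Finset.filter_subset _ _)
    have h3 : ({p ∈ S' | Function.Injective (ecol f u E p) ∧ ∀ l, k (ecol f u E p l) ∈ s l} :
        Finset (Fin d → V)) = {p ∈ B | ∀ l, k (ecol f u E p l) ∈ s l} := by
      ext p
      simp only [hB, mem_filter, and_assoc]
    rw [h3]
    set π : ℝ := ∏ l, (#(s l) : ℝ) / m
    have hm' : (0 : ℝ) < m := by exact_mod_cast hm
    have hπ0 : 0 ≤ π := Finset.prod_nonneg fun l _ => by positivity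
    have hπ1 : π ≤ 1 := Finset.prod_le_one (fun l _ => by positivity) fun l _ => by
      rw [div_le_one hm']
      have := Finset.card_le_univ (s l)
      rw [Fintype.card_fin] at this
      exact_mod_cast this
    rw [abs_le] at hk ⊢
    have h4 : ((#S' : ℝ) - #B) * π ≤ r ^ 2 * (#S / Λ) * 1 :=
      mul_le_mul (by linarith) hπ1 hπ0 (by positivity)
    have h5 : 0 ≤ ((#S' : ℝ) - #B) * π := mul_nonneg (by linarith) hπ0
    have h6 : (δ + r ^ 2 / Λ) * #S = δ * #S + r ^ 2 * (#S / Λ) := by ring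
    have h7 : (0 : ℝ) ≤ r ^ 2 * (#S / Λ) := by positivity
    constructor <;> nlinarith

end Test

theorem mul_exp_neg_le {n : ℕ} {δ Λ : ℝ} {r₀ : ℕ} (hr₀ : 0 < r₀) (hδ : 0 < δ) (hn : 0 < n)
    (h : 16 * r₀ ^ 2 / δ ^ 2 * Real.log n ≤ Λ) :
    Real.exp (-(δ ^ 2 * Λ / (4 * r₀ ^ 2))) ≤ 1 / (n : ℝ) ^ 4 := by
  have hn' : (0 : ℝ) < n := by exact_mod_cast hn
  have hr : (0 : ℝ) < r₀ := by exact_mod_cast hr₀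
  have h1 : 4 * Real.log n ≤ δ ^ 2 * Λ / (4 * r₀ ^ 2) := by
    rw [div_mul_eq_mul_div, div_le_iff₀ (by positivity)] at h
    rw [le_div_iff₀ (by positivity)]
    linarith
  calc Real.exp (-(δ ^ 2 * Λ / (4 * r₀ ^ 2))) ≤ Real.exp (-(4 * Real.log n)) := by
        rw [Real.exp_le_exp]; linarith
    _ = 1 / (n : ℝ) ^ 4 := by
        rw [Real.exp_neg, one_div, show (4 : ℝ) * Real.log n = (4 : ℕ) * Real.log n by norm_num,
          Real.exp_nat_mul, Real.exp_log hn']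

section Triangle

variable {V C : Type} [Fintype V] [DecidableEq V] [Fintype C] [DecidableEq C]

/-- The colours of the sides of a triangle. -/
def tcol (f : V → V → C) (p : Fin 3 → V) (l : Fin 3) : C := f (p l) (p (l + 1))

/-- The triangles with sides of distinct colours in the main classes. -/
def triH (f : V → V → C) {m : ℕ} (k : C → Fin m) : Finset (Fin 3 → V) :=
  {p | Function.Injective (tcol f p) ∧ ∀ l, 7 ≤ (k (tcol f p l)).1}

/-- The candidates for the first triangle of a switch. -/
def triQ (f : V → V → C) {m : ℕ} (k : C → Fin m) (u₁ u₃ : V) : Finset (Fin 3 → V) :=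
  {p ∈ triH f k | (k (f (p 0) u₁)).1 = 0 ∧ (k (f (p 1) u₁)).1 = 1 ∧ (k (f (p 2) u₃)).1 = 2}

/-- The candidates for the second triangle of a switch. -/
def triQ' (f : V → V → C) {m : ℕ} (k : C → Fin m) (z u₂ u₃ : V) : Finset (Fin 3 → V) :=
  {p ∈ triH f k | (k (f (p 0) u₂)).1 = 3 ∧ (k (f (p 1) u₂)).1 = 4 ∧ (k (f (p 2) u₃)).1 = 5 ∧
    (k (f (p 2) z)).1 = 6}

theorem card_coord_eq (i : Fin 3) (v : V) :
    #({p | p i = v} : Finset (Fin 3 → V)) = Fintype.card V ^ 2 := by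
  have : ({p | p i = v} : Finset (Fin 3 → V)) =
      Fintype.piFinset fun j => if j = i then {v} else univ := by
    ext p
    simp only [mem_filter, mem_univ, true_and, Fintype.mem_piFinset]
    constructor
    · intro h j
      split_ifs with hj
      · simp [hj, h]
      · simp
    · intro h
      simpa using h i
  rw [this, Fintype.card_piFinset, Fin.prod_univ_three]
  fin_cases i <;> simp [sq, Finset.card_univ]

theorem card_main {m : ℕ} (hm : 7 ≤ m) : #({x | 7 ≤ x.1} : Finset (Fin m)) = m - 7 := by
  have h := Finset.card_filter_add_card_filter_not (s := (univ : Finset (Fin m)))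
    (fun x => x.1 < 7)
  have h2 : #({x | x.1 < 7} : Finset (Fin m)) = 7 := by
    rw [Fin.card_filter_val_lt]; omega
  simp only [not_lt, card_univ, Fintype.card_fin] at h
  omega

theorem card_single {m a : ℕ} (ha : a < m) : #({x | x.1 = a} : Finset (Fin m)) = 1 := by
  rw [Finset.card_eq_one]
  refine ⟨⟨a, ha⟩, ?_⟩
  ext x
  simp [Fin.ext_iff]

theorem exists_triangle_lottery (m : ℕ) (hm : 7 < m) (δ : ℝ) (hδ : 0 < δ) (hδ1 : δ ≤ 1) :
    ∃ K : ℝ, 1 ≤ K ∧ ∀ {V C : Type} [Fintype V] [DecidableEq V] [Fintype C] [DecidableEq C]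
      (f : V → V → C) (_ : ∀ x y, f x y = f y x) (Λ : ℝ) (_ : 11 ≤ Fintype.card V)
      (_ : K * Real.log (Fintype.card V) ≤ Λ)
      (_ : ∀ v c, (#{x | f v x = c} : ℝ) ≤ Fintype.card V / Λ),
      ∃ k : C → Fin m,
        (∀ i v, |(#{p ∈ triH f k | p i = v} : ℝ) -
          ((m - 7 : ℕ) / (m : ℝ)) ^ 3 * (Fintype.card V : ℝ) ^ 2| ≤
            δ * (Fintype.card V : ℝ) ^ 2) ∧
        (∀ u₁ u₃, (((m - 7 : ℕ) / (m : ℝ)) ^ 3 * (1 / m) ^ 3 - δ) * (Fintype.card V : ℝ) ^ 3 ≤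
          #(triQ f k u₁ u₃)) ∧
        (∀ z u₂ u₃, 2 * #{x | f x u₃ = f x z} ≤ Fintype.card V →
          (((m - 7 : ℕ) / (m : ℝ)) ^ 3 * (1 / m) ^ 4 / 2 - δ) * (Fintype.card V : ℝ) ^ 3 ≤
          #(triQ' f k z u₂ u₃)) := by
  refine ⟨16 * 7 ^ 2 / (δ / 2) ^ 2, ?_, ?_⟩
  · rw [le_div_iff₀ (by positivity)]; nlinarith
  intro V C _ _ _ _ f hf Λ hn hKΛ hloc
  classical
  set n := Fintype.card V with hndef
  have hn' : (11 : ℝ) ≤ n := by exact_mod_cast hn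
  have : Nonempty V := Fintype.card_pos_iff.1 (by omega)
  have hlog : 1 ≤ Real.log n := by
    rw [Real.le_log_iff_exp_le (by linarith)]
    linarith [Real.exp_one_lt_d9]
  have hΛ1 : 16 * 7 ^ 2 / (δ / 2) ^ 2 ≤ Λ := by
    refine le_trans ?_ hKΛ
    exact le_mul_of_one_le_right (by positivity) hlog
  have hΛδ : 98 / δ ≤ Λ := by
    refine le_trans ?_ hΛ1
    rw [div_le_div_iff₀ hδ (by positivity)]
    nlinarith
  have hΛ : 0 < Λ := lt_of_lt_of_le (by positivity) hΛδ
  have h49 : 49 / Λ ≤ δ / 2 := by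
    rw [div_le_iff₀ hδ] at hΛδ
    rw [div_le_iff₀ hΛ]
    linarith
  have hx := mul_exp_neg_le (n := n) (δ := δ / 2) (Λ := Λ) (r₀ := 7) (by norm_num) (by positivity)
    (by omega) (by exact_mod_cast hKΛ)
  set x := 2 * (Fintype.card (C → Fin m) : ℝ) *
    Real.exp (-((δ / 2) ^ 2 * Λ / (4 * (7 : ℕ) ^ 2))) with hxdef
  have hmpos : 0 < m := by omega
  have hm' : (0 : ℝ) < m := by exact_mod_cast hmpos
  let main : Finset (Fin m) := {x | 7 ≤ x.1}
  let single : ℕ → Finset (Fin m) := fun a => {x | x.1 = a}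
  have hmain : #main = m - 7 := card_main hm.le
  have hsingle : ∀ a, a < 7 → #(single a) = 1 := fun a ha => card_single (by omega)
  let E3 : Fin 3 → Fin 3 × (Fin 3 ⊕ Fin 3) := fun l => (l, Sum.inl (l + 1))
  let E6 : Fin 6 → Fin 3 × (Fin 3 ⊕ Fin 3) := ![(0, Sum.inl 1), (1, Sum.inl 2), (2, Sum.inl 0),
    (0, Sum.inr 0), (1, Sum.inr 0), (2, Sum.inr 1)]
  let E7 : Fin 7 → Fin 3 × (Fin 3 ⊕ Fin 3) := ![(0, Sum.inl 1), (1, Sum.inl 2), (2, Sum.inl 0),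
    (0, Sum.inr 1), (1, Sum.inr 1), (2, Sum.inr 2), (2, Sum.inr 0)]
  -- the three families of tests
  have t3 := fun q : Fin 3 × V => exists_bad_lottery f hf Λ hloc hmpos (r := 3) (by norm_num) hΛ
    (fun _ => q.2) E3 {p | p q.1 = q.2} {p | p q.1 = q.2} ⟨fun _ => q.2, by simp⟩ subset_rfl
    (univ.erase q.1)
    (by
      intro j hj b hb v
      simp only [mem_erase, mem_filter, mem_univ, and_true, true_and] at hj hb ⊢
      rw [Function.update_of_ne (Ne.symm hj), hb])
    ((by decide : ∀ i : Fin 3, ∀ l : Fin 3, ∃ j ∈ univ.erase i,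
      OnEdge ((l, Sum.inl (l + 1)) : Fin 3 × (Fin 3 ⊕ Fin 3)) j) q.1)
    (by
      intro l l' hll
      left
      exact (by decide : ∀ i l l' : Fin 3, l < l' → ∃ j ∈ univ.erase i,
        (OnEdge ((l, Sum.inl (l + 1)) : Fin 3 × (Fin 3 ⊕ Fin 3)) j ∧
          OffEdge ((l', Sum.inl (l' + 1)) : Fin 3 × (Fin 3 ⊕ Fin 3)) j) ∨
        (OnEdge ((l', Sum.inl (l' + 1)) : Fin 3 × (Fin 3 ⊕ Fin 3)) j ∧
          OffEdge ((l, Sum.inl (l + 1)) : Fin 3 × (Fin 3 ⊕ Fin 3)) j)) q.1 l l' hll)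
    (fun _ => main) (δ / 2) (by positivity) (by linarith) 7 (by norm_num)
  have t6 := fun q : V × V => exists_bad_lottery f hf Λ hloc hmpos (r := 6) (by norm_num) hΛ
    ![q.1, q.2, q.2] E6 univ univ ⟨fun _ => q.2, by simp⟩ subset_rfl univ
    (fun _ _ _ _ _ => mem_univ _) (by decide)
    (by intro l l' hll; left; revert l l'; decide)
    ![main, main, main, single 0, single 1, single 2] (δ / 2) (by positivity) (by linarith) 7
    (by norm_num)
  have t7 := fun q : V × V × V => exists_bad_lottery f hf Λ hloc hmpos (r := 7) (by norm_num) hΛ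
    ![q.1, q.2.1, q.2.2] E7 univ {p | f (p 2) q.2.2 ≠ f (p 2) q.1} ⟨fun _ => q.1, by simp⟩
    (subset_univ _) univ
    (fun _ _ _ _ _ => mem_univ _) (by decide)
    (by
      intro l l' hll
      by_cases h : l = 5 ∧ l' = 6
      · right
        rw [h.1, h.2]
        intro p hp
        simpa [ecol, E7] using hp
      · left
        revert l l'; decide)
    ![main, main, main, single 3, single 4, single 5, single 6] (δ / 2) (by positivity)
    (by linarith) 7 (by norm_num)
  choose A3 hA3 hA3' using t3
  choose A6 hA6 hA6' using t6
  choose A7 hA7 hA7' using t7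
  have hΩ : (0 : ℝ) < Fintype.card (C → Fin m) := by
    have : Nonempty (Fin m) := ⟨⟨0, hmpos⟩⟩
    exact_mod_cast Fintype.card_pos
  obtain ⟨k, hk3, hk6, hk7⟩ := exists_avoiding A3 A6 A7 x hA3 hA6 hA7 (by
    simp only [Fintype.card_prod, Fintype.card_fin, ← hndef]
    push_cast
    have h1 : x ≤ 2 * (Fintype.card (C → Fin m) : ℝ) * (1 / (n : ℝ) ^ 4) :=
      mul_le_mul_of_nonneg_left hx (by positivity)
    have h2 : (3 * n + n * n + n * (n * n) : ℝ) * (2 * (1 / (n : ℝ) ^ 4)) < 1 := by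
      have : (3 * n + n * n + n * (n * n) : ℝ) * (2 * (1 / (n : ℝ) ^ 4)) =
          (2 * (3 * n + n * n + n * (n * n))) / (n : ℝ) ^ 4 := by ring
      rw [this, div_lt_one (by positivity)]
      have h3 : (11 : ℝ) * n ≤ n * n := by nlinarith
      have h4 : (11 : ℝ) * (n * n) ≤ n * (n * n) := by nlinarith
      have h5 : (11 : ℝ) * (n * (n * n)) ≤ n ^ 4 := by
        have : (n : ℝ) ^ 4 = n * (n * (n * n)) := by ring
        rw [this]
        exact mul_le_mul_of_nonneg_right hn' (by positivity)
      nlinarith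
    calc _ ≤ (3 * n + n * n + n * (n * n) : ℝ) *
          (2 * (Fintype.card (C → Fin m) : ℝ) * (1 / (n : ℝ) ^ 4)) :=
          mul_le_mul_of_nonneg_left h1 (by positivity)
      _ = ((3 * n + n * n + n * (n * n) : ℝ) * (2 * (1 / (n : ℝ) ^ 4))) *
          Fintype.card (C → Fin m) := by ring
      _ < 1 * Fintype.card (C → Fin m) := mul_lt_mul_of_pos_right h2 hΩ
      _ = _ := one_mul _)
  have hfac : ∀ r : ℕ, r ≤ 7 → δ / 2 + (r : ℝ) ^ 2 / Λ ≤ δ := by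
    intro r hr
    have h1 : (r : ℝ) ^ 2 ≤ 49 := by
      have : (r : ℝ) ≤ 7 := by exact_mod_cast hr
      have h0 : (0 : ℝ) ≤ r := Nat.cast_nonneg _
      nlinarith
    have : (r : ℝ) ^ 2 / Λ ≤ 49 / Λ := div_le_div_of_nonneg_right h1 hΛ.le
    linarith
  have hcard3 : (#(univ : Finset (Fin 3 → V)) : ℝ) = (n : ℝ) ^ 3 := by
    rw [card_univ, Fintype.card_fun, Fintype.card_fin]; push_cast; rfl
  refine ⟨k, ?_, ?_, ?_⟩
  · intro i v
    have h := hA3' (i, v) k (hk3 (i, v))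
    have h1 : ({p ∈ triH f k | p i = v} : Finset (Fin 3 → V)) =
        {p ∈ ({p | p i = v} : Finset (Fin 3 → V)) |
          Function.Injective (ecol f (fun _ : Fin 3 => v) E3 p) ∧
            ∀ l, k (ecol f (fun _ : Fin 3 => v) E3 p l) ∈ main} := by
      ext p
      have : ecol f (fun _ : Fin 3 => v) E3 p = tcol f p := rfl
      simp only [triH, mem_filter, mem_univ, true_and, main, this]
      tauto
    simp only at h
    rw [← h1, card_coord_eq, prod_const, card_univ, Fintype.card_fin, hmain, ← hndef] at h
    push_cast at h
    rw [mul_comm ((n : ℝ) ^ 2)] at h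
    refine h.trans (mul_le_mul_of_nonneg_right ?_ (by positivity))
    exact_mod_cast hfac 3 (by norm_num)
  · intro u₁ u₃
    have h := hA6' (u₁, u₃) k (hk6 (u₁, u₃))
    simp only [hcard3] at h
    have h1 : ({p ∈ univ | Function.Injective (ecol f ![u₁, u₃, u₃] E6 p) ∧
        ∀ l, k (ecol f ![u₁, u₃, u₃] E6 p l) ∈
          (![main, main, main, single 0, single 1, single 2] : Fin 6 → Finset (Fin m)) l} :
          Finset (Fin 3 → V)) ⊆ triQ f k u₁ u₃ := by
      intro p hp
      simp only [mem_filter, mem_univ, true_and] at hp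
      obtain ⟨hp1, hp2⟩ := hp
      have e0 := hp2 0
      have e1 := hp2 1
      have e2 := hp2 2
      have e3 := hp2 3
      have e4 := hp2 4
      have e5 := hp2 5
      simp only [main, single, E6, ecol, Matrix.cons_val, Sum.elim_inl, Sum.elim_inr, mem_filter,
        mem_univ, true_and] at e0 e1 e2 e3 e4 e5
      simp only [triQ, triH, mem_filter, mem_univ, true_and]
      refine ⟨⟨?_, ?_⟩, e3, e4, e5⟩
      · have : tcol f p = fun l => ecol f ![u₁, u₃, u₃] E6 p (Fin.castLE (by norm_num) l) := by
          ext l; fin_cases l <;> rfl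
        rw [this]
        exact fun a b hab => Fin.castLE_injective (by norm_num) (hp1 hab)
      · intro l; fin_cases l
        · exact e0
        · exact e1
        · exact e2
    have h2 : (∏ l, (#((![main, main, main, single 0, single 1, single 2] :
        Fin 6 → Finset (Fin m)) l) : ℝ) / m) = ((m - 7 : ℕ) / (m : ℝ)) ^ 3 * (1 / m) ^ 3 := by
      simp only [Fin.prod_univ_succ, Matrix.cons_val_zero, Matrix.cons_val_succ, hmain,
        hsingle _ (show 0 < 7 by norm_num), hsingle _ (show 1 < 7 by norm_num),
        hsingle _ (show 2 < 7 by norm_num)]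
      simp
      ring
    rw [h2, abs_le] at h
    have h3 : (#({p ∈ univ | Function.Injective (ecol f ![u₁, u₃, u₃] E6 p) ∧
        ∀ l, k (ecol f ![u₁, u₃, u₃] E6 p l) ∈
          (![main, main, main, single 0, single 1, single 2] : Fin 6 → Finset (Fin m)) l} :
          Finset (Fin 3 → V)) : ℝ) ≤ #(triQ f k u₁ u₃) := by
      exact_mod_cast Finset.card_le_card h1
    have h4 := hfac 6 (by norm_num)
    have h5 : (0 : ℝ) ≤ (n : ℝ) ^ 3 := by positivity
    have h6 := mul_le_mul_of_nonneg_right h4 h5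
    nlinarith [h.1]
  · intro z u₂ u₃ hz
    have h := hA7' (z, u₂, u₃) k (hk7 (z, u₂, u₃))
    simp only [hcard3] at h
    have h1 : ({p ∈ ({p | f (p 2) u₃ ≠ f (p 2) z} : Finset (Fin 3 → V)) |
        Function.Injective (ecol f ![z, u₂, u₃] E7 p) ∧
        ∀ l, k (ecol f ![z, u₂, u₃] E7 p l) ∈
          (![main, main, main, single 3, single 4, single 5, single 6] :
            Fin 7 → Finset (Fin m)) l} :
          Finset (Fin 3 → V)) ⊆ triQ' f k z u₂ u₃ := by
      intro p hp
      simp only [mem_filter, mem_univ, true_and] at hp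
      obtain ⟨-, hp1, hp2⟩ := hp
      have e0 := hp2 0
      have e1 := hp2 1
      have e2 := hp2 2
      have e3 := hp2 3
      have e4 := hp2 4
      have e5 := hp2 5
      have e6 := hp2 6
      simp only [main, single, E7, ecol, Matrix.cons_val, Sum.elim_inl, Sum.elim_inr, mem_filter,
        mem_univ, true_and] at e0 e1 e2 e3 e4 e5 e6
      simp only [triQ', triH, mem_filter, mem_univ, true_and]
      refine ⟨⟨?_, ?_⟩, e3, e4, e5, e6⟩
      · have : tcol f p = fun l => ecol f ![z, u₂, u₃] E7 p (Fin.castLE (by norm_num) l) := by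
          ext l; fin_cases l <;> rfl
        rw [this]
        exact fun a b hab => Fin.castLE_injective (by norm_num) (hp1 hab)
      · intro l; fin_cases l
        · exact e0
        · exact e1
        · exact e2
    have h2 : (∏ l, (#((![main, main, main, single 3, single 4, single 5, single 6] :
        Fin 7 → Finset (Fin m)) l) : ℝ) / m) = ((m - 7 : ℕ) / (m : ℝ)) ^ 3 * (1 / m) ^ 4 := by
      simp only [Fin.prod_univ_succ, Matrix.cons_val_zero, Matrix.cons_val_succ, hmain,
        hsingle _ (show 3 < 7 by norm_num), hsingle _ (show 4 < 7 by norm_num),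
        hsingle _ (show 5 < 7 by norm_num), hsingle _ (show 6 < 7 by norm_num)]
      simp
      ring
    rw [h2, abs_le] at h
    have h3 : (#({p ∈ ({p | f (p 2) u₃ ≠ f (p 2) z} : Finset (Fin 3 → V)) |
        Function.Injective (ecol f ![z, u₂, u₃] E7 p) ∧
        ∀ l, k (ecol f ![z, u₂, u₃] E7 p l) ∈
          (![main, main, main, single 3, single 4, single 5, single 6] :
            Fin 7 → Finset (Fin m)) l} : Finset (Fin 3 → V)) : ℝ) ≤ #(triQ' f k z u₂ u₃) := by
      exact_mod_cast Finset.card_le_card h1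
    have h4 := hfac 7 (by norm_num)
    have h5 : (0 : ℝ) ≤ (n : ℝ) ^ 3 := by positivity
    have h6 := mul_le_mul_of_nonneg_right h4 h5
    have h7 : (n : ℝ) ^ 3 / 2 ≤ #({p | f (p 2) u₃ ≠ f (p 2) z} : Finset (Fin 3 → V)) := by
      have h8 := card_filter_mul_le (univ : Finset (Fin 3 → V)) 2 (fun _ _ _ => mem_univ _)
        (fun p => f (p 2) u₃ = f (p 2) z) (n / 2) (by
          intro b _
          simp only [Function.update_self]
          have : (2 * #{x | f x u₃ = f x z} : ℝ) ≤ n := by exact_mod_cast hz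
          linarith)
      rw [hcard3, ← hndef] at h8
      have h9 := Finset.card_filter_add_card_filter_not (s := (univ : Finset (Fin 3 → V)))
        (fun p => f (p 2) u₃ = f (p 2) z)
      have h10 : (#({p | f (p 2) u₃ = f (p 2) z} : Finset (Fin 3 → V)) : ℝ) +
          #({p | f (p 2) u₃ ≠ f (p 2) z} : Finset (Fin 3 → V)) = (n : ℝ) ^ 3 := by
        rw [← hcard3]; exact_mod_cast h9
      have h11 : (#({p | f (p 2) u₃ = f (p 2) z} : Finset (Fin 3 → V)) : ℝ) ≤ (n : ℝ) ^ 3 / 2 := by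
        have : (n : ℝ) ^ 3 * (n / 2) = (n : ℝ) ^ 3 / 2 * n := by ring
        rw [this] at h8
        exact le_of_mul_le_mul_right h8 (by linarith)
      linarith
    have h8 : (0 : ℝ) ≤ ((m - 7 : ℕ) / (m : ℝ)) ^ 3 * (1 / m) ^ 4 := by positivity
    nlinarith [h.1, mul_le_mul_of_nonneg_right h7 h8]

end Triangle

section Matching

variable {V C : Type} [Fintype V] [DecidableEq V] [Fintype C] [DecidableEq C]

/-- The vertices and side colours of a triangle. -/
def tval (f : V → V → C) (p : Fin 3 → V) : Fin 3 ⊕ Fin 3 → V ⊕ C :=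
  Sum.elim (fun i => Sum.inl (p i)) (fun l => Sum.inr (tcol f p l))

omit [Fintype V] [DecidableEq V] [Fintype C] [DecidableEq C] in
theorem tval_injective (f : V → V → C) (hf : ∀ x y, f x y = f y x) (p : Fin 3 → V)
    (hp : Function.Injective (tcol f p)) : Function.Injective (tval f p) := by
  have h1 : ∀ i, p i ≠ p (i + 1) := by
    intro i hi
    have h2 : tcol f p (i + 1) = tcol f p (i + 2) := by
      have e1 : i + 1 + 1 = i + 2 := by fin_cases i <;> rfl
      have e2 : i + 2 + 1 = i := by fin_cases i <;> rfl
      simp only [tcol, e1, e2, hi]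
      exact hf _ _
    have h3 := hp h2
    revert h3
    fin_cases i <;> decide
  have h2 : Function.Injective p := by
    have a0 := h1 0
    have a1 := h1 1
    have a2 := h1 2
    simp only [Fin.isValue, zero_add, Fin.reduceAdd] at a0 a1 a2
    intro i j hij
    fin_cases i <;> fin_cases j <;> first | rfl | (exfalso; simp_all)
  rintro (a | a) (b | b) h
  · simp only [tval, Sum.elim_inl, Sum.inl.injEq] at h; rw [h2 h]
  · simp [tval] at h
  · simp [tval] at h
  · simp only [tval, Sum.elim_inr, Sum.inr.injEq] at h; rw [hp h]

omit [DecidableEq V] [Fintype C] in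
theorem card_tcol_eq_le (f : V → V → C) (l : Fin 3) (c : C) :
    #({p | tcol f p l = c} : Finset (Fin 3 → V)) ≤
      Fintype.card V * #({q | f q.1 q.2 = c} : Finset (V × V)) := by
  classical
  rw [← Finset.card_univ, ← Finset.card_product]
  refine Finset.card_le_card_of_injOn (fun p => (p (l + 2), (p l, p (l + 1)))) ?_ ?_
  · intro p hp
    have hp' : tcol f p l = c := by simpa using hp
    simp only [coe_product, coe_univ, Set.mem_prod, Set.mem_univ, true_and, coe_filter, mem_univ]
    exact hp'
  · intro p _ q _ h
    simp only [Prod.mk.injEq] at h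
    obtain ⟨h1, h2, h3⟩ := h
    ext i
    have : i = l ∨ i = l + 1 ∨ i = l + 2 :=
      (by decide : ∀ i l : Fin 3, i = l ∨ i = l + 1 ∨ i = l + 2) i l
    rcases this with h | h | h <;> rw [h] <;> assumption

omit [Fintype C] in
theorem card_tval_pair_le [Nonempty V] (f : V → V → C) (hf : ∀ x y, f x y = f y x) (Λ : ℝ)
    (hΛ : 0 < Λ) (hΛn : Λ ≤ Fintype.card V)
    (hloc : ∀ v c, (#{x | f v x = c} : ℝ) ≤ Fintype.card V / Λ)
    (hglob : ∀ c, (#({q | f q.1 q.2 = c} : Finset (V × V)) : ℝ) ≤ Fintype.card V)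
    (a b : Fin 3 ⊕ Fin 3) (hab : a ≠ b) (x y : V ⊕ C) :
    (#({p | tval f p a = x ∧ tval f p b = y} : Finset (Fin 3 → V)) : ℝ) ≤
      (Fintype.card V : ℝ) ^ 2 / Λ := by
  classical
  have hn : (0 : ℝ) < Fintype.card V := by exact_mod_cast Fintype.card_pos
  have hn1 : (1 : ℝ) ≤ Fintype.card V / Λ := by rw [le_div_iff₀ hΛ]; linarith
  have main : ∀ (S : Finset (Fin 3 → V)) (j : Fin 3) (P : (Fin 3 → V) → Prop) [DecidablePred P],
      (∀ p ∈ S, ∀ v, Function.update p j v ∈ S) → (#S : ℝ) ≤ (Fintype.card V : ℝ) ^ 2 →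
      (∀ p ∈ S, (#{v | P (Function.update p j v)} : ℝ) ≤ Fintype.card V / Λ) →
      (#{p ∈ S | P p} : ℝ) ≤ (Fintype.card V : ℝ) ^ 2 / Λ := by
    intro S j P _ hS hS2 hP
    have := card_filter_mul_le S j hS P _ hP
    have h2 : (#S : ℝ) * (Fintype.card V / Λ) = #S / Λ * Fintype.card V := by ring
    rw [h2] at this
    refine (le_of_mul_le_mul_right this hn).trans ?_
    exact div_le_div_of_nonneg_right hS2 hΛ.le
  have hV2 : ∀ i x, (#({p | p i = x} : Finset (Fin 3 → V)) : ℝ) ≤ (Fintype.card V : ℝ) ^ 2 := by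
    intro i x
    rw [card_coord_eq]; push_cast; rfl
  have hC2 : ∀ l c, (#({p | tcol f p l = c} : Finset (Fin 3 → V)) : ℝ) ≤
      (Fintype.card V : ℝ) ^ 2 := by
    intro l c
    have h1 : (#({p | tcol f p l = c} : Finset (Fin 3 → V)) : ℝ) ≤
        Fintype.card V * #({q | f q.1 q.2 = c} : Finset (V × V)) := by
      exact_mod_cast card_tcol_eq_le f l c
    nlinarith [hglob c]
  have hcol : ∀ (l j : Fin 3) (c : C) (p : Fin 3 → V), (j = l ∨ j = l + 1) →
      (#{v | tcol f (Function.update p j v) l = c} : ℝ) ≤ Fintype.card V / Λ := by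
    intro l j c p hj
    have e : l ≠ l + 1 := by fin_cases l <;> decide
    rcases hj with rfl | rfl
    · refine le_trans (le_of_eq ?_) (hloc (p (j + 1)) c)
      congr 2
      ext v
      simp only [mem_filter, mem_univ, true_and]
      rw [tcol, Function.update_self, Function.update_of_ne e.symm, hf]
    · refine le_trans (le_of_eq ?_) (hloc (p l) c)
      congr 2
      ext v
      simp only [mem_filter, mem_univ, true_and]
      rw [tcol, Function.update_self, Function.update_of_ne e]
  have vc : ∀ (i l : Fin 3) (x : V) (c : C),
      (#({p | p i = x ∧ tcol f p l = c} : Finset (Fin 3 → V)) : ℝ) ≤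
        (Fintype.card V : ℝ) ^ 2 / Λ := by
    intro i l x c
    obtain ⟨j, hj, hji⟩ : ∃ j, (j = l ∨ j = l + 1) ∧ i ≠ j := by revert i l; decide
    rw [← Finset.filter_filter]
    refine main _ j _ ?_ (hV2 i x) (fun p _ => hcol l j c p hj)
    intro p hp v
    simp only [mem_filter, mem_univ, true_and] at hp ⊢
    rw [Function.update_of_ne hji, hp]
  rcases a with a | a <;> rcases b with b | b <;> rcases x with x | x <;> rcases y with y | y <;>
    simp only [tval, Sum.elim_inl, Sum.elim_inr, Sum.inl.injEq, Sum.inr.injEq, reduceCtorEq,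
      false_and, and_false, Finset.filter_false, card_empty, Nat.cast_zero] <;>
    try positivity
  · rw [← Finset.filter_filter]
    have hab' : a ≠ b := fun h => hab (by rw [h])
    refine main _ b _ ?_ (hV2 a x) ?_
    · intro p hp v
      simp only [mem_filter, mem_univ, true_and] at hp ⊢
      rw [Function.update_of_ne hab', hp]
    · intro p _
      refine le_trans ?_ hn1
      simp only [Function.update_self]
      simp [Finset.filter_eq']
  · exact vc a b x y
  · simp_rw [and_comm (a := tcol f _ a = x)]
    exact vc b a y x
  · have hab' : a ≠ b := fun h => hab (by rw [h])
    rw [← Finset.filter_filter]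
    obtain ⟨j, hj, h1, h2⟩ : ∃ j, (j = b ∨ j = b + 1) ∧ a ≠ j ∧ a + 1 ≠ j := by
      revert a b; decide
    refine main _ j _ ?_ (hC2 a x) (fun p _ => hcol b j y p hj)
    intro p hp v
    simp only [mem_filter, mem_univ, true_and] at hp ⊢
    rw [tcol] at hp ⊢
    rw [Function.update_of_ne h1, Function.update_of_ne h2, hp]


theorem exists_triangle_matching (γ : ℝ) (hγ : 0 < γ) :
    ∃ K : ℝ, 1 ≤ K ∧ ∀ {V C J T : Type} [Fintype V] [DecidableEq V] [Fintype C] [DecidableEq C]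
      [Fintype J] [Fintype T] (f : V → V → C) (_ : ∀ x y, f x y = f y x) (Λ : ℝ)
      (_ : 11 ≤ Fintype.card V) (_ : Fintype.card C ≤ 2 * Fintype.card V ^ 2)
      (_ : Fintype.card J ≤ 2 * Fintype.card V ^ 2) (_ : Fintype.card T ≤ 2 * Fintype.card V ^ 3)
      (_ : K * Real.log (Fintype.card V) ≤ Λ)
      (_ : ∀ v c, (#{x | f v x = c} : ℝ) ≤ Fintype.card V / Λ)
      (θ δ β : ℝ) (_ : 1 / 2 ≤ θ) (_ : θ ≤ 1) (_ : 0 < δ) (_ : δ ≤ 1 / 4) (_ : 0 < β) (_ : β ≤ 1)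
      (_ : Λ ≤ β * Fintype.card V)
      (_ : ∀ c, (#({q | f q.1 q.2 = c} : Finset (V × V)) : ℝ) ≤ θ * Fintype.card V)
      (H : Finset (Fin 3 → V)) (_ : ∀ p ∈ H, Function.Injective (tcol f p))
      (_ : ∀ i v, |(#{p ∈ H | p i = v} : ℝ) - θ * (Fintype.card V : ℝ) ^ 2| ≤
            δ * (Fintype.card V : ℝ) ^ 2)
      (w : J → V → ℝ) (_ : ∀ j v, 0 ≤ w j v) (_ : ∀ j v, w j v ≤ 2 * (Fintype.card V / Λ))
      (_ : ∀ j, Fintype.card V ≤ ∑ v, w j v)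
      (Q : T → Finset (Fin 3 → V)) (_ : ∀ t, Q t ⊆ H)
      (_ : ∀ t, β * (Fintype.card V : ℝ) ^ 3 ≤ #(Q t)),
      ∃ M ⊆ H, (∀ p ∈ M, ∀ q ∈ M, p ≠ q → ∀ a b, tval f p a ≠ tval f q b) ∧
        (∀ j, (1 - γ) * ((θ - δ) / (θ + δ) * ∑ v, w j v) ≤ ∑ p ∈ M, ∑ i, w j (p i)) ∧
        ∀ t, (1 - γ) * (β * Fintype.card V / 6) ≤ #(M ∩ Q t) := by
  obtain ⟨K, hK, hmatch⟩ := exists_pseudorandom_matching 6 (by norm_num) (min γ 1) (by positivity)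
  refine ⟨288 * K, by linarith, ?_⟩
  intro V C J T _ _ _ _ _ _ f hf Λ hn hC hJ hT hKΛ hloc θ δ β hθ hθ1 hδ hδ1 hβ hβ1 hΛβ hglob
    H hH hdeg w hw0 hw hwsum Q hQH hQ
  classical
  set n := Fintype.card V with hndef
  have hn' : (11 : ℝ) ≤ n := by exact_mod_cast hn
  have : Nonempty V := Fintype.card_pos_iff.1 (by omega)
  have hlog : 1 ≤ Real.log n := by
    rw [Real.le_log_iff_exp_le (by linarith)]
    linarith [Real.exp_one_lt_d9]
  have hΛ1 : 288 ≤ Λ := by nlinarith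
  have hΛ : 0 < Λ := by linarith
  have hΛn : Λ ≤ n := by nlinarith
  set D : ℝ := 3 * (θ + δ) * (n : ℝ) ^ 2 with hD
  set L : ℝ := Λ / 48 with hL
  have hn2 : (0 : ℝ) < (n : ℝ) ^ 2 := by positivity
  have hD0 : 0 < D := by positivity
  have hL0 : 0 < L := by positivity
  have hdeg1 : ∀ i v, (#{p ∈ H | p i = v} : ℝ) ≤ (θ + δ) * (n : ℝ) ^ 2 := by
    intro i v
    have := (abs_le.1 (hdeg i v)).2
    linarith
  have hdeg2 : ∀ i v, (θ - δ) * (n : ℝ) ^ 2 ≤ (#{p ∈ H | p i = v} : ℝ) := by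
    intro i v
    have := (abs_le.1 (hdeg i v)).1
    linarith
  let vs : (Fin 3 → V) → Finset (V ⊕ C) := fun p => univ.image (tval f p)
  have hmem : ∀ x p, x ∈ vs p ↔ ∃ a, tval f p a = x := by
    intro x p; simp only [vs, mem_image, mem_univ, true_and]
  have hvsdeg : ∀ x, (#(H.filter (x ∈ vs ·)) : ℝ) ≤ D := by
    intro x
    have h1 : H.filter (x ∈ vs ·) ⊆ univ.biUnion fun a => {p ∈ H | tval f p a = x} := by
      intro p hp
      simp only [mem_filter, hmem, mem_biUnion, mem_univ, true_and] at hp ⊢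
      obtain ⟨h1, a, h2⟩ := hp
      exact ⟨a, h1, h2⟩
    have h2 : (#(H.filter (x ∈ vs ·)) : ℝ) ≤ ∑ a, (#{p ∈ H | tval f p a = x} : ℝ) := by
      exact_mod_cast (Finset.card_le_card h1).trans card_biUnion_le
    refine h2.trans ?_
    rw [Fintype.sum_sum_type]
    rcases x with x | c
    · simp only [tval, Sum.elim_inl, Sum.elim_inr, Sum.inl.injEq, reduceCtorEq, Finset.filter_false,
        card_empty, Nat.cast_zero, sum_const_zero, add_zero]
      refine (Finset.sum_le_sum fun i _ => hdeg1 i x).trans (le_of_eq ?_)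
      simp [hD]; ring
    · simp only [tval, Sum.elim_inl, Sum.elim_inr, Sum.inr.injEq, reduceCtorEq, Finset.filter_false,
        card_empty, Nat.cast_zero, sum_const_zero, zero_add]
      have h3 : ∀ l : Fin 3, (#{p ∈ H | tcol f p l = c} : ℝ) ≤ (θ + δ) * (n : ℝ) ^ 2 := by
        intro l
        have h4 : (#{p ∈ H | tcol f p l = c} : ℝ) ≤
            n * #({q | f q.1 q.2 = c} : Finset (V × V)) := by
          exact_mod_cast (Finset.card_le_card
            (Finset.filter_subset_filter _ (subset_univ H))).trans (card_tcol_eq_le f l c)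
        nlinarith [hglob c]
      refine (Finset.sum_le_sum fun i _ => h3 i).trans (le_of_eq ?_)
      simp [hD]; ring
  have hco : ∀ x y, y ≠ x → (#{p ∈ H | x ∈ vs p ∧ y ∈ vs p} : ℝ) ≤ D / L := by
    intro x y hxy
    have h1 : ({p ∈ H | x ∈ vs p ∧ y ∈ vs p} : Finset _) ⊆
        ({q | q.1 ≠ q.2} : Finset ((Fin 3 ⊕ Fin 3) × (Fin 3 ⊕ Fin 3))).biUnion fun q =>
          ({p | tval f p q.1 = x ∧ tval f p q.2 = y} : Finset (Fin 3 → V)) := by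
      intro p hp
      simp only [mem_filter, hmem, mem_biUnion, mem_univ, true_and] at hp ⊢
      obtain ⟨-, ⟨a, ha⟩, b, hb⟩ := hp
      refine ⟨(a, b), ?_, ha, hb⟩
      rintro h
      simp only at h
      rw [h] at ha
      exact hxy (hb.symm.trans ha)
    have h2 : (#{p ∈ H | x ∈ vs p ∧ y ∈ vs p} : ℝ) ≤
        ∑ q : (Fin 3 ⊕ Fin 3) × (Fin 3 ⊕ Fin 3) with q.1 ≠ q.2,
          (#({p | tval f p q.1 = x ∧ tval f p q.2 = y} : Finset (Fin 3 → V)) : ℝ) := by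
      exact_mod_cast (Finset.card_le_card h1).trans card_biUnion_le
    have h3 : ∀ c, (#({q | f q.1 q.2 = c} : Finset (V × V)) : ℝ) ≤ n := by
      intro c; nlinarith [hglob c]
    have h4 : ∑ q : (Fin 3 ⊕ Fin 3) × (Fin 3 ⊕ Fin 3) with q.1 ≠ q.2,
          (#({p | tval f p q.1 = x ∧ tval f p q.2 = y} : Finset (Fin 3 → V)) : ℝ) ≤
        ∑ q : (Fin 3 ⊕ Fin 3) × (Fin 3 ⊕ Fin 3), ((n : ℝ) ^ 2 / Λ) := by
      refine (Finset.sum_le_sum fun q hq => card_tval_pair_le f hf Λ hΛ hΛn hloc h3 q.1 q.2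
        (mem_filter.1 hq).2 x y).trans ?_
      exact Finset.sum_le_sum_of_subset_of_nonneg (Finset.filter_subset _ _)
        fun _ _ _ => by positivity
    refine h2.trans (h4.trans ?_)
    rw [sum_const, card_univ, Fintype.card_prod, Fintype.card_sum, Fintype.card_fin, nsmul_eq_mul,
      hL, hD, ← mul_div_assoc, div_div_eq_mul_div]
    refine div_le_div_of_nonneg_right ?_ hΛ.le
    push_cast
    nlinarith
  let q : J ⊕ T → (Fin 3 → V) → ℝ :=
    Sum.elim (fun j p => ∑ i, w j (p i)) (fun t p => if p ∈ Q t then 1 else 0)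
  have hq0 : ∀ j p, 0 ≤ q j p := by
    rintro (j | t) p
    · exact Finset.sum_nonneg fun i _ => hw0 j _
    · simp only [q, Sum.elim_inr]; split_ifs <;> norm_num
  have hqJ : ∀ j, 3 * (θ - δ) * (n : ℝ) ^ 2 * ∑ v, w j v ≤ ∑ p ∈ H, q (Sum.inl j) p := by
    intro j
    simp only [q, Sum.elim_inl]
    rw [Finset.sum_comm]
    have h1 : ∀ i, (θ - δ) * (n : ℝ) ^ 2 * ∑ v, w j v ≤ ∑ p ∈ H, w j (p i) := by
      intro i
      rw [← Finset.sum_fiberwise H (fun p => p i) (fun p => w j (p i)), Finset.mul_sum]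
      refine Finset.sum_le_sum fun v _ => ?_
      rw [Finset.sum_congr rfl (g := fun _ => w j v) (fun p hp => by rw [(mem_filter.1 hp).2]),
        sum_const, nsmul_eq_mul]
      exact mul_le_mul_of_nonneg_right (hdeg2 i v) (hw0 j v)
    refine le_trans (le_of_eq ?_) (Finset.sum_le_sum fun i _ => h1 i)
    simp; ring
  have hqT : ∀ t, ∑ p ∈ H, q (Sum.inr t) p = #(Q t) := by
    intro t
    simp only [q, Sum.elim_inr]
    rw [Finset.sum_ite_mem, Finset.inter_eq_right.2 (hQH t)]
    simp
  have hbig : ∀ j p, q j p * (D * L) ≤ ∑ p ∈ H, q j p := by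
    rintro (j | t) p
    · refine le_trans ?_ (hqJ j)
      have h1 : q (Sum.inl j) p ≤ 6 * (n / Λ) := by
        refine (Finset.sum_le_sum fun i _ => hw j (p i)).trans (le_of_eq ?_)
        simp; ring
      have h2 : q (Sum.inl j) p * (D * L) ≤ 6 * (n / Λ) * (D * L) :=
        mul_le_mul_of_nonneg_right h1 (by positivity)
      refine h2.trans ?_
      have h3 : 6 * (n / Λ) * (D * L) = 3 / 8 * (θ + δ) * (n : ℝ) ^ 2 * n := by
        rw [hD, hL]; field_simp; ring
      rw [h3]
      refine mul_le_mul ?_ (hwsum j) (by positivity) (mul_nonneg (by linarith) hn2.le)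
      refine mul_le_mul_of_nonneg_right ?_ hn2.le
      linarith
    · rw [hqT]
      refine le_trans ?_ (hQ t)
      have h1 : q (Sum.inr t) p ≤ 1 := by
        simp only [q, Sum.elim_inr]; split_ifs <;> norm_num
      refine (mul_le_mul_of_nonneg_right h1 (by positivity)).trans ?_
      rw [one_mul, hD, hL]
      have h2 : 3 * (θ + δ) * (n : ℝ) ^ 2 * (Λ / 48) ≤ 3 * 2 * (n : ℝ) ^ 2 * (β * n / 48) := by
        gcongr; linarith
      have h3 : (0 : ℝ) ≤ β * (n : ℝ) ^ 3 := by positivity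
      nlinarith
  have hQpos : ∀ j, 0 < ∑ p ∈ H, q j p := by
    rintro (j | t)
    · refine lt_of_lt_of_le ?_ (hqJ j)
      have := hwsum j
      have h1 : 0 < 3 * (θ - δ) * (n : ℝ) ^ 2 := mul_pos (by linarith) hn2
      exact mul_pos h1 (by linarith)
    · rw [hqT]
      exact lt_of_lt_of_le (by positivity) (hQ t)
  obtain ⟨M, hMH, hMd, -, hMq⟩ := hmatch (J := J ⊕ T) H vs (fun _ => True)
    (fun p hp => by
      simp only [vs]
      rw [Finset.card_image_of_injective _ (tval_injective f hf p (hH p hp))]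
      rfl)
    (fun p => by
      refine Finset.card_image_le.trans ?_
      rfl)
    D L hD0 (by
      have h1 : Real.log (Fintype.card (V ⊕ C) + Fintype.card (J ⊕ T) + 2) ≤ 5 * Real.log n := by
        rw [show (5 : ℝ) * Real.log n = (5 : ℕ) * Real.log n by norm_num, ← Real.log_pow]
        refine Real.log_le_log (by positivity) ?_
        rw [Fintype.card_sum, Fintype.card_sum]
        have : n + Fintype.card C + (Fintype.card J + Fintype.card T) + 2 ≤ n ^ 5 := by
          have e1 : 11 * n ≤ n ^ 2 := by rw [sq]; exact Nat.mul_le_mul_right _ hn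
          have e2 : 11 * n ^ 2 ≤ n ^ 3 := by
            rw [pow_succ n 2, mul_comm]; exact Nat.mul_le_mul_left _ hn
          have e3 : 11 * n ^ 3 ≤ n ^ 4 := by
            rw [pow_succ n 3, mul_comm]; exact Nat.mul_le_mul_left _ hn
          have e4 : 11 * n ^ 4 ≤ n ^ 5 := by
            rw [pow_succ n 4, mul_comm]; exact Nat.mul_le_mul_left _ hn
          omega
        exact_mod_cast this
      rw [hL, le_div_iff₀ (by norm_num)]
      have h2 : K * (Real.log (Fintype.card (V ⊕ C) + Fintype.card (J ⊕ T) + 2) + 1) ≤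
          K * (6 * Real.log n) := mul_le_mul_of_nonneg_left (by linarith) (by linarith)
      linarith)
    hvsdeg hco q hq0 (fun j => ∑ p ∈ H, q j p) hQpos (fun _ => rfl)
    (fun j p => by rw [le_div_iff₀ (by positivity)]; exact hbig j p)
    (fun j x => by
      rw [le_div_iff₀ hL0]
      have h1 : ∀ p ∈ H.filter (x ∈ vs ·), q j p ≤ (∑ p ∈ H, q j p) / (D * L) := by
        intro p _; rw [le_div_iff₀ (by positivity)]; exact hbig j p
      have h2 := Finset.sum_le_sum h1
      rw [sum_const, nsmul_eq_mul] at h2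
      have h3 : (#(H.filter (x ∈ vs ·)) : ℝ) * ((∑ p ∈ H, q j p) / (D * L)) ≤
          D * ((∑ p ∈ H, q j p) / (D * L)) :=
        mul_le_mul_of_nonneg_right (hvsdeg x) (div_nonneg (hQpos j).le (by positivity))
      have h4 : D * ((∑ p ∈ H, q j p) / (D * L)) * L = ∑ p ∈ H, q j p := by
        field_simp
      calc _ ≤ D * ((∑ p ∈ H, q j p) / (D * L)) * L :=
            mul_le_mul_of_nonneg_right (h2.trans h3) hL0.le
        _ = _ := h4)
    trivial
    (fun M _ _ _ j S _ hS => by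
      have : S = ∅ := by
        rw [Finset.eq_empty_iff_forall_notMem]
        intro e he
        exact (hS e he).2 trivial
      rw [this, sum_empty]
      exact div_nonneg (hQpos j).le hL0.le)
  have hγ1 : 0 ≤ 1 - min γ 1 := by linarith [min_le_right γ 1]
  have hγ2 : 1 - γ ≤ 1 - min γ 1 := by linarith [min_le_left γ 1]
  refine ⟨M, hMH, ?_, ?_, ?_⟩
  · intro p hp p' hp' hpp a b hab
    exact Finset.disjoint_left.1 (hMd p hp p' hp' hpp) ((hmem _ _).2 ⟨a, rfl⟩)
      ((hmem _ _).2 ⟨b, hab.symm⟩)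
  · intro j
    refine le_trans ?_ (hMq (Sum.inl j))
    have h1 : (θ - δ) / (θ + δ) * ∑ v, w j v ≤ (∑ p ∈ H, q (Sum.inl j) p) / D := by
      rw [le_div_iff₀ hD0, hD]
      refine le_trans (le_of_eq ?_) (hqJ j)
      have : θ + δ ≠ 0 := by positivity
      field_simp
    have h0 : 0 ≤ (θ - δ) / (θ + δ) * ∑ v, w j v :=
      mul_nonneg (div_nonneg (by linarith) (by positivity)) (Finset.sum_nonneg fun v _ => hw0 j v)
    exact mul_le_mul hγ2 h1 h0 hγ1
  · intro t
    have h2 := hMq (Sum.inr t)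
    have h3 : ∑ p ∈ M, q (Sum.inr t) p = #(M ∩ Q t) := by
      simp only [q, Sum.elim_inr]
      rw [Finset.sum_ite_mem]; simp
    rw [h3] at h2
    simp only [hqT] at h2
    refine le_trans ?_ h2
    have h1 : β * n / 6 ≤ #(Q t) / D := by
      rw [le_div_iff₀ hD0, hD]
      refine le_trans ?_ (hQ t)
      have h4 : (0 : ℝ) ≤ β * (n : ℝ) ^ 3 := by positivity
      have h5 : β * n / 6 * (3 * (θ + δ) * (n : ℝ) ^ 2) = (θ + δ) / 2 * (β * (n : ℝ) ^ 3) := by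
        ring
      rw [h5]
      nlinarith
    exact mul_le_mul hγ2 h1 (by positivity) hγ1

end Matching

section Completion

variable {V C : Type} [Fintype V] [DecidableEq V] [Fintype C] [DecidableEq C]

/-- The colours in the reserved classes used by a switch with two triangles. -/
def ncol (f : V → V → C) (u : Fin 3 → V) (T : (Fin 3 → V) × (Fin 3 → V)) : Fin 7 → C :=
  ![f (T.1 0) (u 0), f (T.1 1) (u 0), f (T.1 2) (u 2), f (T.2 0) (u 1), f (T.2 1) (u 1),
    f (T.2 2) (u 2), f (T.2 2) (T.1 2)]

/-- The three triangles resulting from a switch. -/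
def ntri (u : Fin 3 → V) (T : (Fin 3 → V) × (Fin 3 → V)) : Fin 3 → Fin 3 → V :=
  ![![u 0, T.1 0, T.1 1], ![u 1, T.2 0, T.2 1], ![u 2, T.1 2, T.2 2]]

/-- The origin of the sides after a switch. -/
def ntag {I M : Type} (i : I) (T : M × M) : Fin 3 → Fin 3 → (M × Fin 3) ⊕ (I × Fin 7) :=
  ![![Sum.inr (i, 0), Sum.inl (T.1, 0), Sum.inr (i, 1)],
    ![Sum.inr (i, 3), Sum.inl (T.2, 0), Sum.inr (i, 4)],
    ![Sum.inr (i, 2), Sum.inr (i, 6), Sum.inr (i, 5)]]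

/-- The conflicts of a switch. -/
def nkey (f : V → V → C) (u : Fin 3 → V) (T : (Fin 3 → V) × (Fin 3 → V)) :
    Fin 9 → C ⊕ (Fin 3 → V) :=
  ![Sum.inl (ncol f u T 0), Sum.inl (ncol f u T 1), Sum.inl (ncol f u T 2),
    Sum.inl (ncol f u T 3), Sum.inl (ncol f u T 4), Sum.inl (ncol f u T 5),
    Sum.inl (ncol f u T 6), Sum.inr T.1, Sum.inr T.2]

omit [DecidableEq V] [Fintype C] in
theorem sum_card_pair_le {I : Type} [Fintype I] (f : V → V → C) (hf : ∀ x y, f x y = f y x)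
    (M : Finset (Fin 3 → V)) (hM : ∀ p ∈ M, ∀ q ∈ M, ∀ i j, p i = q j → p = q)
    (hMn : #M ≤ Fintype.card V)
    (R : Finset V) (x : ℝ) (c : C) (hR : ∑ v ∈ R, (#{u | f v u = c} + 1 : ℝ) ≤ x)
    (e : I → V) (he : Function.Injective e) (heR : ∀ i, e i ∈ R) (i : Fin 3) :
    ∑ j, ((#{T ∈ M | f (T i) (e j) = c} * #M : ℕ) : ℝ) ≤ x * Fintype.card V := by
  have h1 : ∀ j, #{T ∈ M | f (T i) (e j) = c} ≤ #{u | f (e j) u = c} := by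
    intro j
    refine Finset.card_le_card_of_injOn (fun T => T i) ?_ ?_
    · intro T hT
      simp only [coe_filter, Set.mem_ofPred_eq, mem_univ, true_and] at hT ⊢
      rw [hf]; exact hT.2
    · intro T hT T' hT' h
      simp only [coe_filter, Set.mem_ofPred_eq] at hT hT'
      exact hM T hT.1 T' hT'.1 i i h
  have h2 : ∀ j, ((#{T ∈ M | f (T i) (e j) = c} * #M : ℕ) : ℝ) ≤
      (#{u | f (e j) u = c} + 1 : ℝ) * Fintype.card V := by
    intro j
    push_cast
    have : (#{T ∈ M | f (T i) (e j) = c} : ℝ) ≤ #{u | f (e j) u = c} := by exact_mod_cast h1 j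
    have h3 : (#M : ℝ) ≤ Fintype.card V := by exact_mod_cast hMn
    exact mul_le_mul (by linarith) h3 (by positivity) (by positivity)
  refine (Finset.sum_le_sum fun j _ => h2 j).trans ?_
  rw [← Finset.sum_mul]
  refine mul_le_mul_of_nonneg_right (le_trans ?_ hR) (by positivity)
  have h4 := Finset.sum_map univ ⟨e, he⟩ (fun v => (#{u | f v u = c} + 1 : ℝ))
  simp only [Function.Embedding.coeFn_mk] at h4
  rw [← h4]
  refine Finset.sum_le_sum_of_subset_of_nonneg ?_ fun _ _ _ => by positivity
  intro v hv
  simp only [mem_map, mem_univ, true_and, Function.Embedding.coeFn_mk] at hv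
  obtain ⟨j, rfl⟩ := hv
  exact heR j

omit [Fintype C] in
theorem sum_nkey_le {I : Type} [Fintype I] (f : V → V → C) (hf : ∀ x y, f x y = f y x)
    (M : Finset (Fin 3 → V)) (hM : ∀ p ∈ M, ∀ q ∈ M, ∀ i j, p i = q j → p = q)
    (hMn : #M ≤ Fintype.card V)
    (R : Finset V) (x : ℝ) (hR : ∀ c, ∑ v ∈ R, (#{u | f v u = c} + 1 : ℝ) ≤ x)
    (hglob : ∀ c, (#({q | f q.1 q.2 = c} : Finset (V × V)) : ℝ) ≤ Fintype.card V)
    (u : I → Fin 3 → V) (hu : ∀ a, Function.Injective fun i => u i a) (huR : ∀ i a, u i a ∈ R)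
    (hI : (Fintype.card I : ℝ) ≤ x) (b : Fin 9) (y : C ⊕ (Fin 3 → V)) :
    ∑ j, (#{T ∈ M ×ˢ M | nkey f (u j) T b = y} : ℝ) ≤ x * Fintype.card V := by
  classical
  have hMn' : (#M : ℝ) ≤ Fintype.card V := by exact_mod_cast hMn
  have hx0 : 0 ≤ x := le_trans (by positivity) hI
  have fst : ∀ (P : (Fin 3 → V) → Prop) [DecidablePred P],
      #{T ∈ M ×ˢ M | P T.1} = #{T ∈ M | P T} * #M := by
    intro P _
    rw [← card_product]
    congr 1; ext T; simp only [mem_filter, mem_product]; tauto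
  have snd : ∀ (P : (Fin 3 → V) → Prop) [DecidablePred P],
      #{T ∈ M ×ˢ M | P T.2} = #{T ∈ M | P T} * #M := by
    intro P _
    rw [mul_comm, ← card_product]
    congr 1; ext T; simp only [mem_filter, mem_product]; tauto
  have c1 : ∀ (i a : Fin 3) (c : C),
      ∑ j, (#{T ∈ M ×ˢ M | f (T.1 i) (u j a) = c} : ℝ) ≤ x * Fintype.card V := by
    intro i a c
    refine le_trans (le_of_eq ?_) (sum_card_pair_le f hf M hM hMn R x c (hR c) (fun j => u j a)
      (hu a) (fun j => huR j a) i)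
    refine Finset.sum_congr rfl fun j _ => ?_
    rw [fst (fun T => f (T i) (u j a) = c)]
  have c2 : ∀ (i a : Fin 3) (c : C),
      ∑ j, (#{T ∈ M ×ˢ M | f (T.2 i) (u j a) = c} : ℝ) ≤ x * Fintype.card V := by
    intro i a c
    refine le_trans (le_of_eq ?_) (sum_card_pair_le f hf M hM hMn R x c (hR c) (fun j => u j a)
      (hu a) (fun j => huR j a) i)
    refine Finset.sum_congr rfl fun j _ => ?_
    rw [snd (fun T => f (T i) (u j a) = c)]
  have const : ∀ N : ℝ, N ≤ Fintype.card V → ∑ _j : I, N ≤ x * Fintype.card V := by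
    intro N hN
    rw [sum_const, card_univ, nsmul_eq_mul]
    exact (mul_le_mul_of_nonneg_left hN (by positivity)).trans
      (mul_le_mul_of_nonneg_right hI (by positivity))
  have c3 : ∀ c, ∑ j : I, (#{T ∈ M ×ˢ M | f (T.2 2) (T.1 2) = c} : ℝ) ≤ x * Fintype.card V := by
    intro c
    refine const _ (le_trans ?_ (hglob c))
    norm_cast
    refine Finset.card_le_card_of_injOn (fun T => (T.2 2, T.1 2)) ?_ ?_
    · intro T hT
      simp only [coe_filter, Set.mem_ofPred_eq, mem_univ, true_and] at hT ⊢
      exact hT.2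
    · intro T hT T' hT' h
      simp only [coe_filter, Set.mem_ofPred_eq, mem_product] at hT hT'
      simp only [Prod.mk.injEq] at h
      exact Prod.ext (hM _ hT.1.1 _ hT'.1.1 _ _ h.2) (hM _ hT.1.2 _ hT'.1.2 _ _ h.1)
  have one : ∀ t, #{T ∈ M | T = t} ≤ 1 := by
    intro t
    rw [Finset.card_le_one]
    intro a ha b hb
    rw [(mem_filter.1 ha).2, (mem_filter.1 hb).2]
  have c4 : ∀ t, ∑ j : I, (#{T ∈ M ×ˢ M | T.1 = t} : ℝ) ≤ x * Fintype.card V := by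
    intro t
    refine const _ (le_trans ?_ hMn')
    rw [fst (fun T => T = t)]
    exact_mod_cast (Nat.mul_le_mul_right _ (one t)).trans (by rw [one_mul])
  have c5 : ∀ t, ∑ j : I, (#{T ∈ M ×ˢ M | T.2 = t} : ℝ) ≤ x * Fintype.card V := by
    intro t
    refine const _ (le_trans ?_ hMn')
    rw [snd (fun T => T = t)]
    exact_mod_cast (Nat.mul_le_mul_right _ (one t)).trans (by rw [one_mul])
  have h0 : 0 ≤ x * (Fintype.card V : ℝ) := by positivity
  have red : ∀ (P Q : I → (Fin 3 → V) × (Fin 3 → V) → Prop) [∀ j, DecidablePred (P j)]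
      [∀ j, DecidablePred (Q j)], (∀ j T, P j T → Q j T) →
      ∑ j, (#{T ∈ M ×ˢ M | Q j T} : ℝ) ≤ x * Fintype.card V →
      ∑ j, (#{T ∈ M ×ˢ M | P j T} : ℝ) ≤ x * Fintype.card V := by
    intro P Q _ _ hPQ h
    refine (Finset.sum_le_sum fun j _ => ?_).trans h
    exact_mod_cast Finset.card_le_card (Finset.monotone_filter_right _ fun T _ => hPQ j T)
  have red0 : ∀ (P : I → (Fin 3 → V) × (Fin 3 → V) → Prop) [∀ j, DecidablePred (P j)],
      (∀ j T, ¬ P j T) → ∑ j, (#{T ∈ M ×ˢ M | P j T} : ℝ) ≤ x * Fintype.card V := by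
    intro P _ hP
    rw [Finset.sum_eq_zero]
    · exact h0
    · intro j _
      rw [Finset.filter_false_of_mem fun T _ => hP j T, card_empty, Nat.cast_zero]
  rcases y with c | t
  · fin_cases b
    · exact red _ _ (fun j T h => Sum.inl.inj h) (c1 0 0 c)
    · exact red _ _ (fun j T h => Sum.inl.inj h) (c1 1 0 c)
    · exact red _ _ (fun j T h => Sum.inl.inj h) (c1 2 2 c)
    · exact red _ _ (fun j T h => Sum.inl.inj h) (c2 0 1 c)
    · exact red _ _ (fun j T h => Sum.inl.inj h) (c2 1 1 c)
    · exact red _ _ (fun j T h => Sum.inl.inj h) (c2 2 2 c)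
    · exact red _ _ (fun j T h => Sum.inl.inj h) (c3 c)
    · exact red0 _ fun j T h => Sum.inr_ne_inl h
    · exact red0 _ fun j T h => Sum.inr_ne_inl h
  · fin_cases b
    iterate 7 exact red0 _ fun j T h => Sum.inl_ne_inr h
    · exact red _ _ (fun j T h => Sum.inr.inj h) (c4 t)
    · exact red _ _ (fun j T h => Sum.inr.inj h) (c5 t)

end Completion

section Completion

variable {V C : Type} [Fintype V] [DecidableEq V] [Fintype C] [DecidableEq C]

/-- The side colours before or after a switch, by origin. -/
def tagCol {I : Type} (f : V → V → C) (M : Finset (Fin 3 → V)) (u : I → Fin 3 → V)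
    (T : I → M × M) : (M × Fin 3) ⊕ (I × Fin 7) → C :=
  Sum.elim (fun q => tcol f q.1.1 q.2)
    (fun q => ncol f (u q.1) ((T q.1).1.1, (T q.1).2.1) q.2)

omit [Fintype V] [DecidableEq V] [Fintype C] [DecidableEq C] in
theorem tcol_ntri {I : Type} (f : V → V → C) (hf : ∀ x y, f x y = f y x)
    (M : Finset (Fin 3 → V)) (u : I → Fin 3 → V) (T : I → M × M) (i : I) (a l : Fin 3) :
    tcol f (ntri (u i) ((T i).1.1, (T i).2.1) a) l = tagCol f M u T (ntag i (T i) a l) := by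
  fin_cases a <;> fin_cases l <;> first | rfl | exact hf _ _

omit [Fintype V] [DecidableEq V] [Fintype C] [DecidableEq C] in
theorem exists_triangle_cover {I : Type} (M : Finset (Fin 3 → V)) (u : I → Fin 3 → V)
    (T : I → M × M) (v : V)
    (hv : (∃ i a, u i a = v) ∨ ∃ p ∈ M, ∃ j, p j = v) :
    (∃ p : M, (∀ i, p ≠ (T i).1 ∧ p ≠ (T i).2) ∧ ∃ j, p.1 j = v) ∨
      ∃ i a j, ntri (u i) ((T i).1.1, (T i).2.1) a j = v := by
  rcases hv with ⟨i, a, rfl⟩ | ⟨p, hp, j, rfl⟩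
  · right
    refine ⟨i, a, 0, ?_⟩
    fin_cases a <;> rfl
  · by_cases h : ∀ i, (⟨p, hp⟩ : M) ≠ (T i).1 ∧ (⟨p, hp⟩ : M) ≠ (T i).2
    · exact Or.inl ⟨⟨p, hp⟩, h, j, rfl⟩
    · right
      push Not at h
      obtain ⟨i, hi⟩ := h
      by_cases h1 : (⟨p, hp⟩ : M) = (T i).1
      · fin_cases j
        · exact ⟨i, 0, 1, by rw [← h1]; rfl⟩
        · exact ⟨i, 0, 2, by rw [← h1]; rfl⟩
        · exact ⟨i, 2, 1, by rw [← h1]; rfl⟩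
      · have h2 := hi h1
        fin_cases j
        · exact ⟨i, 1, 1, by rw [← h2]; rfl⟩
        · exact ⟨i, 1, 2, by rw [← h2]; rfl⟩
        · exact ⟨i, 2, 2, by rw [← h2]; rfl⟩

omit [Fintype C] in
theorem exists_triangle_factor_of_switches {I : Type} [Fintype I] {m : ℕ} (f : V → V → C)
    (hf : ∀ x y, f x y = f y x) (k : C → Fin m) (M : Finset (Fin 3 → V)) (hMH : M ⊆ triH f k)
    (hM : ∀ p ∈ M, ∀ q ∈ M, p ≠ q → ∀ a b, tval f p a ≠ tval f q b)
    (u : I → Fin 3 → V) (T : I → M × M)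
    (hcov : ∀ v, (∃ i a, u i a = v) ∨ ∃ p ∈ M, ∃ j, p j = v)
    (hcard : Fintype.card V = 3 * #M + 3 * Fintype.card I)
    (hT1 : ∀ i, (T i).1.1 ∈ triQ f k (u i 0) (u i 2))
    (hT2 : ∀ i, (T i).2.1 ∈ triQ' f k ((T i).1.1 2) (u i 1) (u i 2))
    (hkey : ∀ i j, i ≠ j → ∀ a b, nkey f (u i) ((T i).1.1, (T i).2.1) a ≠
      nkey f (u j) ((T j).1.1, (T j).2.1) b) :
    ∃ (Y : Type) (_ : Fintype Y) (g : Y → Fin 3 → V),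
      Function.Bijective (fun q : Y × Fin 3 => g q.1 q.2) ∧
      Function.Injective (fun q : Y × Fin 3 => tcol f (g q.1) q.2) := by
  classical
  have hk : ∀ i a, (k (ncol f (u i) ((T i).1.1, (T i).2.1) a)).1 = a.1 := by
    intro i a
    have h1 := (mem_filter.1 (hT1 i)).2
    have h2 := (mem_filter.1 (hT2 i)).2
    fin_cases a
    exacts [h1.1, h1.2.1, h1.2.2, h2.1, h2.2.1, h2.2.2.1, h2.2.2.2]
  have hkM : ∀ (p : M) l, 7 ≤ (k (tcol f p.1 l)).1 := fun p l =>
    (mem_filter.1 (hMH p.2)).2.2 l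
  have hT12 : ∀ i, (T i).1 ≠ (T i).2 := by
    intro i h
    have h1 := hk i 2
    have h2 := hk i 5
    have h3 : ncol f (u i) ((T i).1.1, (T i).2.1) 2 = ncol f (u i) ((T i).1.1, (T i).2.1) 5 := by
      simp only [ncol, h]; rfl
    rw [h3, h2] at h1
    exact absurd h1 (by decide)
  have hneq : ∀ i j, i ≠ j → (T i).1 ≠ (T j).1 ∧ (T i).1 ≠ (T j).2 ∧ (T i).2 ≠ (T j).2 := by
    intro i j hij
    refine ⟨fun h => hkey i j hij 7 7 ?_, fun h => hkey i j hij 7 8 ?_,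
      fun h => hkey i j hij 8 8 ?_⟩
    · exact congrArg (fun p : M => (Sum.inr p.1 : C ⊕ (Fin 3 → V))) h
    · exact congrArg (fun p : M => (Sum.inr p.1 : C ⊕ (Fin 3 → V))) h
    · exact congrArg (fun p : M => (Sum.inr p.1 : C ⊕ (Fin 3 → V))) h
  have hcolinj : Function.Injective (tagCol f M u T) := by
    rintro (⟨p, l⟩ | ⟨i, a⟩) (⟨q, l'⟩ | ⟨j, b⟩) h
    · simp only [tagCol, Sum.elim_inl] at h
      by_cases hpq : p = q
      · subst hpq
        rw [(mem_filter.1 (hMH p.2)).2.1 h]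
      · exact absurd (congrArg Sum.inr h) (hM p.1 p.2 q.1 q.2
          (fun h => hpq (Subtype.ext h)) (Sum.inr l) (Sum.inr l'))
    · simp only [tagCol, Sum.elim_inl, Sum.elim_inr] at h
      have h1 := hkM p l
      rw [h, hk] at h1
      have := b.2
      omega
    · simp only [tagCol, Sum.elim_inl, Sum.elim_inr] at h
      have h1 := hkM q l'
      rw [← h, hk] at h1
      have := a.2
      omega
    · simp only [tagCol, Sum.elim_inr] at h
      have h1 := hk i a
      rw [h, hk] at h1
      have hab : b = a := Fin.ext h1
      subst hab
      by_cases hij : i = j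
      · rw [hij]
      · refine absurd ?_ (hkey i j hij (Fin.castLE (by norm_num) b) (Fin.castLE (by norm_num) b))
        have h2 : ∀ (u : Fin 3 → V) T, nkey f u T (Fin.castLE (by norm_num) b) =
            Sum.inl (ncol f u T b) := by
          intro u T; fin_cases b <;> rfl
        rw [h2, h2, h]
  let Y := {p : M // ∀ i, p ≠ (T i).1 ∧ p ≠ (T i).2} ⊕ (I × Fin 3)
  let g : Y → Fin 3 → V := Sum.elim (fun p => p.1.1)
    (fun q => ntri (u q.1) ((T q.1).1.1, (T q.1).2.1) q.2)
  have hsurj : Function.Surjective (fun q : Y × Fin 3 => g q.1 q.2) := by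
    intro v
    rcases exists_triangle_cover M u T v (hcov v) with ⟨p, hp, j, hj⟩ | ⟨i, a, j, hj⟩
    · exact ⟨(Sum.inl ⟨p, hp⟩, j), hj⟩
    · exact ⟨(Sum.inr (i, a), j), hj⟩
  have hused : Fintype.card {p : M // ∀ i, p ≠ (T i).1 ∧ p ≠ (T i).2} + 2 * Fintype.card I =
      #M := by
    have h1 : Function.Bijective
        (Sum.elim (fun p : {p : M // ∀ i, p ≠ (T i).1 ∧ p ≠ (T i).2} => p.1)
          (Sum.elim (fun i => (T i).1) (fun i => (T i).2)) : _ ⊕ (I ⊕ I) → M) := by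
      constructor
      · rintro (p | i | i) (q | j | j) h <;>
          simp only [Sum.elim_inl, Sum.elim_inr] at h
        · rw [Subtype.ext h]
        · exact absurd h (p.2 j).1
        · exact absurd h (p.2 j).2
        · exact absurd h.symm (q.2 i).1
        · by_cases hij : i = j
          · rw [hij]
          · exact absurd h (hneq i j hij).1
        · by_cases hij : i = j
          · subst hij; exact absurd h (hT12 i)
          · exact absurd h (hneq i j hij).2.1
        · exact absurd h.symm (q.2 i).2
        · by_cases hij : j = i
          · subst hij; exact absurd h.symm (hT12 j)
          · exact absurd h.symm (hneq j i hij).2.1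
        · by_cases hij : i = j
          · rw [hij]
          · exact absurd h (hneq i j hij).2.2
      · intro p
        by_cases h : ∀ i, p ≠ (T i).1 ∧ p ≠ (T i).2
        · exact ⟨Sum.inl ⟨p, h⟩, rfl⟩
        · push Not at h
          obtain ⟨i, hi⟩ := h
          by_cases h1 : p = (T i).1
          · exact ⟨Sum.inr (Sum.inl i), h1.symm⟩
          · exact ⟨Sum.inr (Sum.inr i), (hi h1).symm⟩
    have h2 := Fintype.card_of_bijective h1
    rw [Fintype.card_sum, Fintype.card_sum, Fintype.card_coe] at h2
    omega
  refine ⟨Y, inferInstance, g, ?_, ?_⟩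
  · rw [Fintype.bijective_iff_surjective_and_card]
    refine ⟨hsurj, ?_⟩
    rw [Fintype.card_prod, Fintype.card_sum, Fintype.card_prod, Fintype.card_fin]
    omega
  · let tag : Y × Fin 3 → (M × Fin 3) ⊕ (I × Fin 7) := fun q =>
      Sum.elim (fun p => Sum.inl (p.1, q.2)) (fun r => ntag r.1 (T r.1) r.2 q.2) q.1
    have htag : (fun q : Y × Fin 3 => tcol f (g q.1) q.2) = tagCol f M u T ∘ tag := by
      ext ⟨y, l⟩
      rcases y with p | ⟨i, a⟩
      · rfl
      · exact tcol_ntri f hf M u T i a l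
    rw [htag]
    refine hcolinj.comp ?_
    have nt1 : ∀ i a l p l', ntag i (T i) a l = Sum.inl (p, l') →
        l' = 0 ∧ ((p = (T i).1 ∧ a = 0 ∧ l = 1) ∨ (p = (T i).2 ∧ a = 1 ∧ l = 1)) := by
      intro i a l p l' h
      fin_cases a <;> fin_cases l <;> simp [ntag] at h ⊢ <;> exact ⟨h.2.symm, h.1.symm⟩
    have nt2 : ∀ i a l j b, ntag i (T i) a l = Sum.inr (j, b) → i = j ∧
        (a, l) = (![(0, 0), (0, 2), (2, 0), (1, 0), (1, 2), (2, 2), (2, 1)] :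
          Fin 7 → Fin 3 × Fin 3) b := by
      intro i a l j b h
      fin_cases a <;> fin_cases l <;> simp [ntag] at h <;> obtain ⟨h1, h2⟩ := h <;> subst h2 <;>
        exact ⟨h1, rfl⟩
    rintro ⟨y, l⟩ ⟨y', l'⟩ h
    simp only [tag] at h
    rcases y with p | ⟨i, a⟩ <;> rcases y' with q | ⟨j, b⟩ <;>
      simp only [Sum.elim_inl, Sum.elim_inr] at h
    · simp only [Sum.inl.injEq, Prod.mk.injEq] at h
      rw [Subtype.ext h.1, h.2]
    · obtain ⟨-, ⟨h1, -⟩ | ⟨h1, -⟩⟩ := nt1 _ _ _ _ _ h.symm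
      · exact absurd h1 (p.2 j).1
      · exact absurd h1 (p.2 j).2
    · obtain ⟨-, ⟨h1, -⟩ | ⟨h1, -⟩⟩ := nt1 _ _ _ _ _ h
      · exact absurd h1 (q.2 i).1
      · exact absurd h1 (q.2 i).2
    · rcases hx : ntag j (T j) b l' with ⟨p, r⟩ | ⟨j', r⟩
      · obtain ⟨-, h1⟩ := nt1 _ _ _ _ _ hx
        obtain ⟨-, h2⟩ := nt1 _ _ _ _ _ (h.trans hx)
        by_cases hij : i = j
        · subst hij
          rcases h1 with ⟨e1, e2, e3⟩ | ⟨e1, e2, e3⟩ <;>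
            rcases h2 with ⟨e4, e5, e6⟩ | ⟨e4, e5, e6⟩
          · rw [e2, e3, e5, e6]
          · exact absurd (e1.symm.trans e4) (hT12 i)
          · exact absurd (e4.symm.trans e1) (hT12 i)
          · rw [e2, e3, e5, e6]
        · exfalso
          rcases h1 with ⟨e1, -⟩ | ⟨e1, -⟩ <;> rcases h2 with ⟨e4, -⟩ | ⟨e4, -⟩
          · exact (hneq i j hij).1 (e4.symm.trans e1)
          · exact (hneq j i (Ne.symm hij)).2.1 (e1.symm.trans e4)
          · exact (hneq i j hij).2.1 (e4.symm.trans e1)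
          · exact (hneq i j hij).2.2 (e4.symm.trans e1)
      · obtain ⟨e1, e2⟩ := nt2 _ _ _ _ _ hx
        obtain ⟨e3, e4⟩ := nt2 _ _ _ _ _ (h.trans hx)
        have e5 := e4.trans e2.symm
        simp only [Prod.mk.injEq] at e5
        rw [e3, e1, e5.1, e5.2]

end Completion

section Completion

variable {V C : Type} [Fintype V] [DecidableEq V] [Fintype C] [DecidableEq C]

omit [DecidableEq V] [Fintype C] in
theorem card_similar_le (f : V → V → C) (Λ : ℝ)
    (hV : 0 < Fintype.card V)
    (hloc : ∀ v c, (#{x | f v x = c} : ℝ) ≤ Fintype.card V / Λ) (u : V) :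
    (#{z | Fintype.card V < 2 * #{x | f x u = f x z}} : ℝ) ≤ 2 * (Fintype.card V / Λ) := by
  set n := Fintype.card V with hn
  have hn0 : (0 : ℝ) < n := by exact_mod_cast hV
  set S : Finset V := {z | n < 2 * #{x | f x u = f x z}} with hS
  have h1 : (#S : ℝ) * n ≤ ∑ z ∈ S, (2 * #{x | f x u = f x z} : ℝ) := by
    rw [← nsmul_eq_mul, ← sum_const]
    refine Finset.sum_le_sum fun z hz => ?_
    have := (mem_filter.1 hz).2
    exact_mod_cast this.le
  have h2 : ∑ z ∈ S, (2 * #{x | f x u = f x z} : ℝ) ≤ ∑ z, (2 * #{x | f x u = f x z} : ℝ) :=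
    Finset.sum_le_sum_of_subset_of_nonneg (subset_univ _) fun _ _ _ => by positivity
  have h3 : ∑ z, (#{x | f x u = f x z} : ℝ) = ∑ x, (#{z | f x u = f x z} : ℝ) := by
    have := Finset.sum_card_bipartiteAbove_eq_sum_card_bipartiteBelow (s := (univ : Finset V))
      (t := (univ : Finset V)) (fun x z => f x u = f x z)
    simp only [Finset.bipartiteAbove, Finset.bipartiteBelow] at this
    exact_mod_cast this.symm
  have h4 : ∑ x, (#{z | f x u = f x z} : ℝ) ≤ n * (n / Λ) := by
    calc _ ≤ ∑ x : V, (n / Λ : ℝ) := by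
          refine Finset.sum_le_sum fun x _ => ?_
          simp_rw [eq_comm (a := f x u)]
          exact hloc x _
      _ = _ := by rw [sum_const, card_univ, nsmul_eq_mul]
  rw [← Finset.mul_sum univ, h3] at h2
  have h5 : (#S : ℝ) * n ≤ 2 * (n / Λ) * n := by nlinarith
  exact le_of_mul_le_mul_right h5 hn0

omit [Fintype C] in
theorem exists_triangle_factor_of_matching {m : ℕ} (f : V → V → C)
    (hf : ∀ x y, f x y = f y x) (k : C → Fin m) (M : Finset (Fin 3 → V)) (hMH : M ⊆ triH f k)
    (hM : ∀ p ∈ M, ∀ q ∈ M, p ≠ q → ∀ a b, tval f p a ≠ tval f q b)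
    (Λ β γ : ℝ) (h3 : 3 ∣ Fintype.card V) (hV : 0 < Fintype.card V) (hβ : 0 < β)
    (hγ0 : 0 ≤ γ) (hΛβ : 2 / Λ ≤ β / 2)
    (hγβ : 1296 * γ ≤ β ^ 4)
    (hloc : ∀ v c, (#{x | f v x = c} : ℝ) ≤ Fintype.card V / Λ)
    (hglob : ∀ c, (#({q | f q.1 q.2 = c} : Finset (V × V)) : ℝ) ≤ Fintype.card V)
    (hQ : ∀ u₁ u₃, β * Fintype.card V ≤ #(M ∩ triQ f k u₁ u₃))
    (hQ' : ∀ z u₂ u₃, 2 * #{x | f x u₃ = f x z} ≤ Fintype.card V →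
      β * Fintype.card V ≤ #(M ∩ triQ' f k z u₂ u₃))
    (hR : ∀ c, ∑ v with ∀ p ∈ M, ∀ i, p i ≠ v, (#{u | f v u = c} + 1 : ℝ) ≤
      γ * Fintype.card V) :
    ∃ (Y : Type) (_ : Fintype Y) (g : Y → Fin 3 → V),
      Function.Bijective (fun q : Y × Fin 3 => g q.1 q.2) ∧
      Function.Injective (fun q : Y × Fin 3 => tcol f (g q.1) q.2) := by
  classical
  set n := Fintype.card V with hn
  have hn0 : (0 : ℝ) < n := by exact_mod_cast hV
  set R : Finset V := {v | ∀ p ∈ M, ∀ i, p i ≠ v} with hRdef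
  have hMinj : ∀ p ∈ M, Function.Injective p := by
    intro p hp i j hij
    have := tval_injective f hf p (mem_filter.1 (hMH hp)).2.1
      (a₁ := Sum.inl i) (a₂ := Sum.inl j) (congrArg Sum.inl hij)
    exact Sum.inl_injective this
  have hMd : ∀ p ∈ M, ∀ q ∈ M, ∀ i j, p i = q j → p = q := by
    intro p hp q hq i j hij
    by_contra h
    exact hM p hp q hq h (Sum.inl i) (Sum.inl j) (congrArg Sum.inl hij)
  have hcov : #R + 3 * #M = n := by
    have h1 : R = (M.biUnion fun p => univ.image p)ᶜ := by
      ext v; simp [hRdef]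
    have h2 : #(M.biUnion fun p => univ.image p) = 3 * #M := by
      rw [Finset.card_biUnion]
      · rw [Finset.sum_congr rfl (g := fun _ => 3), sum_const, smul_eq_mul, mul_comm]
        intro p hp
        rw [Finset.card_image_of_injective _ (hMinj p hp)]; rfl
      · intro p hp q hq hpq
        rw [Function.onFun, Finset.disjoint_left]
        intro v hv hv'
        simp only [mem_image, mem_univ, true_and] at hv hv'
        obtain ⟨i, rfl⟩ := hv
        obtain ⟨j, hj⟩ := hv'
        exact hpq (hMd p hp q hq i j hj.symm)
    rw [h1, Finset.card_compl, h2]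
    have := Finset.card_le_univ (M.biUnion fun p => univ.image p)
    omega
  have hMn : #M ≤ n := by omega
  obtain ⟨N, hN⟩ : ∃ N, #R = N * 3 := by
    obtain ⟨a, ha⟩ := h3
    exact ⟨a - #M, by omega⟩
  have hc : Fintype.card (Fin N × Fin 3) = Fintype.card R := by
    rw [Fintype.card_prod, Fintype.card_fin, Fintype.card_fin, Fintype.card_coe, hN]
  let e : Fin N × Fin 3 ≃ R := Fintype.equivOfCardEq hc
  let u : Fin N → Fin 3 → V := fun i a => (e (i, a)).1
  have hu : ∀ a, Function.Injective fun i => u i a := by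
    intro a i j h
    have := e.injective (Subtype.ext h)
    exact (Prod.mk.inj this).1
  -- the leftover is small
  have hRn : (#R : ℝ) ≤ γ * n := by
    obtain ⟨v⟩ : Nonempty V := Fintype.card_pos_iff.1 hV
    refine le_trans ?_ (hR (f v v))
    rw [← nsmul_one, ← sum_const]
    exact Finset.sum_le_sum fun v _ => le_add_of_nonneg_left (Nat.cast_nonneg _)
  have hNn : (Fintype.card (Fin N) : ℝ) ≤ γ * n := by
    refine le_trans ?_ hRn
    rw [Fintype.card_fin, hN]
    exact_mod_cast Nat.le_mul_of_pos_right N (by norm_num)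
  let G : Fin N → Finset ((Fin 3 → V) × (Fin 3 → V)) := fun i =>
    {T ∈ M ×ˢ M | T.1 ∈ triQ f k (u i 0) (u i 2) ∧ T.2 ∈ triQ' f k (T.1 2) (u i 1) (u i 2)}
  have hG1 : ∀ i, (#(G i) : ℝ) ≤ (n : ℝ) ^ 2 := by
    intro i
    have h1 : #(G i) ≤ n * n := by
      refine (Finset.card_le_card (Finset.filter_subset _ _)).trans ?_
      rw [card_product]
      exact Nat.mul_le_mul hMn hMn
    rw [sq]; exact_mod_cast h1
  have hG0 : ∀ i, β ^ 2 / 2 * (n : ℝ) ^ 2 ≤ #(G i) := by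
    intro i
    set A : Finset (Fin 3 → V) :=
      {p ∈ M ∩ triQ f k (u i 0) (u i 2) | 2 * #{x | f x (u i 2) = f x (p 2)} ≤ n} with hA
    have hAc : β / 2 * n ≤ #A := by
      have h1 := Finset.card_filter_add_card_filter_not (s := M ∩ triQ f k (u i 0) (u i 2))
        (fun p => 2 * #{x | f x (u i 2) = f x (p 2)} ≤ n)
      have h2 : #{p ∈ M ∩ triQ f k (u i 0) (u i 2) | ¬ 2 * #{x | f x (u i 2) = f x (p 2)} ≤ n} ≤
          #{z | n < 2 * #{x | f x (u i 2) = f x z}} := by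
        refine Finset.card_le_card_of_injOn (fun p => p 2) ?_ ?_
        · intro p hp
          simp only [coe_filter, Set.mem_ofPred_eq, mem_univ, true_and, not_le] at hp ⊢
          exact hp.2
        · intro p hp q hq h
          simp only [coe_filter, Set.mem_ofPred_eq, mem_inter] at hp hq
          exact hMd p hp.1.1 q hq.1.1 2 2 h
      have h3 := card_similar_le f Λ hV hloc (u i 2)
      have h4 : (#{p ∈ M ∩ triQ f k (u i 0) (u i 2) |
          ¬ 2 * #{x | f x (u i 2) = f x (p 2)} ≤ n} : ℝ) ≤
          #{z | n < 2 * #{x | f x (u i 2) = f x z}} := by exact_mod_cast h2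
      have h5 : (#A : ℝ) + #{p ∈ M ∩ triQ f k (u i 0) (u i 2) |
          ¬ 2 * #{x | f x (u i 2) = f x (p 2)} ≤ n} = #(M ∩ triQ f k (u i 0) (u i 2)) := by
        exact_mod_cast h1
      have h6 := hQ (u i 0) (u i 2)
      have h7 : 2 * ((n : ℝ) / Λ) = 2 / Λ * n := by ring
      rw [← hn, h7] at h3
      have h8 : 2 / Λ * n ≤ β / 2 * n := mul_le_mul_of_nonneg_right hΛβ hn0.le
      linarith
    have h2 : #(A.sigma fun p => M ∩ triQ' f k (p 2) (u i 1) (u i 2)) ≤ #(G i) := by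
      refine Finset.card_le_card_of_injOn (fun q => (q.1, q.2)) ?_ ?_
      · rintro ⟨p, q⟩ hq
        simp only [coe_sigma, Set.mem_sigma_iff, mem_coe, hA, mem_filter, mem_inter] at hq
        simp only [G, coe_filter, Set.mem_ofPred_eq, mem_product]
        exact ⟨⟨hq.1.1.1, hq.2.1⟩, hq.1.1.2, hq.2.2⟩
      · rintro ⟨p, q⟩ _ ⟨p', q'⟩ _ h
        simp only [Prod.mk.injEq] at h
        rw [h.1, h.2]
    rw [card_sigma] at h2
    have h3 : (#A : ℝ) * (β * n) ≤ ∑ p ∈ A, (#(M ∩ triQ' f k (p 2) (u i 1) (u i 2)) : ℝ) := by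
      rw [← nsmul_eq_mul, ← sum_const]
      exact Finset.sum_le_sum fun p hp => hQ' _ _ _ (mem_filter.1 hp).2
    have h4 : ∑ p ∈ A, (#(M ∩ triQ' f k (p 2) (u i 1) (u i 2)) : ℝ) ≤ #(G i) := by
      exact_mod_cast h2
    have h5 : β / 2 * n * (β * n) ≤ #A * (β * n) :=
      mul_le_mul_of_nonneg_right hAc (by positivity)
    calc _ = β / 2 * n * (β * n) := by ring
      _ ≤ _ := h5.trans (h3.trans h4)
  obtain ⟨g, hg, hgk⟩ := exists_key_free 9 (fun b j T => nkey f (u j) T b) G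
    (β ^ 2 / 2 * (n : ℝ) ^ 2) ((n : ℝ) ^ 2) (γ * n * n) (by positivity) hG0 hG1
    (fun b x => by
      refine le_trans (Finset.sum_le_sum fun j _ => ?_)
        (sum_nkey_le f hf M hMd hMn R (γ * n) hR hglob u hu (fun i a => (e (i, a)).2) hNn b x)
      exact_mod_cast Finset.card_le_card
        (Finset.filter_subset_filter _ (Finset.filter_subset _ _)))
    (by positivity)
    (by
      have h4 : (0 : ℝ) < (n : ℝ) ^ 4 := by positivity
      have : (n : ℝ) ^ 2 * (((9 : ℕ) : ℝ) ^ 2 * (γ * n * n)) = 81 * γ * (n : ℝ) ^ 4 := by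
        push_cast; ring
      rw [this]
      nlinarith)
  have hg' : ∀ i, g i ∈ M ×ˢ M ∧ (g i).1 ∈ triQ f k (u i 0) (u i 2) ∧
      (g i).2 ∈ triQ' f k ((g i).1 2) (u i 1) (u i 2) := fun i => mem_filter.1 (hg i)
  refine exists_triangle_factor_of_switches f hf k M hMH hM u
    (fun i => (⟨(g i).1, (mem_product.1 (hg' i).1).1⟩, ⟨(g i).2, (mem_product.1 (hg' i).1).2⟩))
    ?_ ?_ (fun i => (hg' i).2.1) (fun i => (hg' i).2.2) (fun i j hij a b => hgk i j hij a b)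
  · intro v
    by_cases hv : v ∈ R
    · left
      obtain ⟨⟨i, a⟩, hia⟩ := e.surjective ⟨v, hv⟩
      exact ⟨i, a, congrArg Subtype.val hia⟩
    · right
      simp only [hRdef, mem_filter, mem_univ, true_and] at hv
      push Not at hv
      exact hv
  · rw [Fintype.card_fin]
    omega

end Completion

theorem exists_reserve_size (ε : ℝ) (hε : 0 < ε) : ∃ m : ℕ, 7 < m ∧
    1 - ε ≤ ((m - 7 : ℕ) / (m : ℝ)) ^ 3 ∧ 1 / 2 ≤ ((m - 7 : ℕ) / (m : ℝ)) ^ 3 := by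
  obtain ⟨m, hm⟩ := exists_nat_ge (21 / ε + 42)
  have h0 : 0 < 21 / ε := by positivity
  have hm42 : (42 : ℝ) ≤ m := by linarith
  have hm42' : 42 ≤ m := by exact_mod_cast hm42
  have hm0 : (0 : ℝ) < m := by linarith
  have h1 : ((m - 7 : ℕ) / (m : ℝ)) = 1 + -(7 / m) := by
    rw [Nat.cast_sub (by omega)]; field_simp; push_cast; ring
  have h2 : 1 - 21 / (m : ℝ) ≤ ((m - 7 : ℕ) / (m : ℝ)) ^ 3 := by
    rw [h1]
    have h7 : 7 / (m : ℝ) ≤ 1 := by rw [div_le_one hm0]; linarith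
    have := one_add_mul_le_pow (a := -(7 / (m : ℝ))) (by linarith) 3
    refine le_trans (le_of_eq ?_) this
    push_cast; ring
  refine ⟨m, by omega, le_trans ?_ h2, le_trans ?_ h2⟩
  · have : 21 / (m : ℝ) ≤ ε := by
      rw [div_le_iff₀ hm0]
      have := mul_le_mul_of_nonneg_left (show 21 / ε ≤ m by linarith) hε.le
      rwa [mul_div_cancel₀ _ hε.ne'] at this
    linarith
  · have : 21 / (m : ℝ) ≤ 1 / 2 := by
      rw [div_le_iff₀ hm0]; linarith
    linarith

theorem exists_log_le (K β : ℝ) (hβ : 0 < β) :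
    ∃ n₀ : ℕ, ∀ n : ℕ, n₀ ≤ n → K * Real.log n ≤ β * n := by
  have h := (Real.isLittleO_log_id_atTop).const_mul_left K
  have h1 := (h.comp_tendsto tendsto_natCast_atTop_atTop).bound hβ
  obtain ⟨n₀, hn₀⟩ := Filter.eventually_atTop.1 h1
  refine ⟨n₀, fun n hn => ?_⟩
  have := hn₀ n hn
  simp only [Function.comp, id, Real.norm_eq_abs, Nat.abs_cast] at this
  exact (le_abs_self _).trans this

theorem leftover_sum_le {V C : Type} [Fintype V] [DecidableEq V] (f : V → V → C)
    (hf : ∀ x y, f x y = f y x) (M : Finset (Fin 3 → V))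
    (hMi : ∀ p ∈ M, Function.Injective (tcol f p))
    (hMd : ∀ p ∈ M, ∀ q ∈ M, p ≠ q → ∀ a b, tval f p a ≠ tval f q b) (w : V → ℝ)
    (hw : ∀ v, 0 ≤ w v) (n θ δ γ : ℝ) (hθ : 1 / 2 ≤ θ) (hδ0 : 0 < δ) (hδ : δ ≤ γ / 16)
    (hγ0 : 0 < γ) (hγ1 : γ ≤ 1) (hW : ∑ v, w v ≤ 2 * n)
    (h1 : (1 - γ / 4) * ((θ - δ) / (θ + δ) * ∑ v, w v) ≤ ∑ p ∈ M, ∑ i, w (p i)) :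
    ∑ v with ∀ p ∈ M, ∀ i, p i ≠ v, w v ≤ γ * n := by
  have hMinj : ∀ p ∈ M, Function.Injective p := by
    intro p hp i j hij
    exact Sum.inl_injective (tval_injective f hf p (hMi p hp)
      (a₁ := Sum.inl i) (a₂ := Sum.inl j) (congrArg Sum.inl hij))
  have h2 : ∑ v with ∀ p ∈ M, ∀ i, p i ≠ v, w v + ∑ p ∈ M, ∑ i, w (p i) = ∑ v, w v := by
    have e1 : ({v | ∀ p ∈ M, ∀ i, p i ≠ v} : Finset V) = (M.biUnion fun p => univ.image p)ᶜ := by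
      ext v; simp
    have e2 : ∑ p ∈ M, ∑ i, w (p i) = ∑ v ∈ M.biUnion fun p => univ.image p, w v := by
      rw [Finset.sum_biUnion]
      · refine Finset.sum_congr rfl fun p hp => ?_
        rw [Finset.sum_image fun i _ j _ h => hMinj p hp h]
      · intro p hp q hq hpq
        rw [Function.onFun, Finset.disjoint_left]
        intro v hv hv'
        simp only [mem_image, mem_univ, true_and] at hv hv'
        obtain ⟨i, rfl⟩ := hv
        obtain ⟨j, hj⟩ := hv'
        exact hMd p hp q hq hpq (Sum.inl i) (Sum.inl j) (congrArg Sum.inl hj.symm)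
    rw [e1, e2, Finset.sum_compl_add_sum]
  have hW0 : 0 ≤ ∑ v, w v := Finset.sum_nonneg fun v _ => hw v
  generalize ∑ v, w v = W at *
  generalize ∑ p ∈ M, ∑ i, w (p i) = N at *
  generalize ∑ v with ∀ p ∈ M, ∀ i, p i ≠ v, w v = R at *
  have h3 : 1 - 4 * δ ≤ (θ - δ) / (θ + δ) := by
    rw [le_div_iff₀ (by linarith)]
    nlinarith
  have h4 : (1 - γ / 4) * ((1 - 4 * δ) * W) ≤ (1 - γ / 4) * ((θ - δ) / (θ + δ) * W) :=
    mul_le_mul_of_nonneg_left (mul_le_mul_of_nonneg_right h3 hW0) (by linarith)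
  have h5 : (1 - γ / 2) ≤ (1 - γ / 4) * (1 - 4 * δ) := by nlinarith
  have h6 := mul_le_mul_of_nonneg_right h5 hW0
  have h7 : γ / 2 * W ≤ γ / 2 * (2 * n) := mul_le_mul_of_nonneg_left hW (by positivity)
  have h8 : (1 - γ / 4) * (1 - 4 * δ) * W = (1 - γ / 4) * ((1 - 4 * δ) * W) := by ring
  linarith

set_option maxHeartbeats 1000000 in
theorem exists_rainbow_triangle_factor (ε : ℝ) (hε : 0 < ε) :
    ∃ (K : ℝ) (n₀ : ℕ), 1 ≤ K ∧ ∀ {V C : Type} [Fintype V] [DecidableEq V] [Fintype C]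
      [DecidableEq C] (f : V → V → C) (_ : ∀ x y, f x y = f y x) (_ : n₀ ≤ Fintype.card V)
      (_ : Fintype.card C ≤ 2 * Fintype.card V ^ 2) (_ : 3 ∣ Fintype.card V)
      (_ : ∀ v c, (#{x | f v x = c} : ℝ) ≤
        Fintype.card V / (K * Real.log (Fintype.card V)))
      (_ : ∀ c, (#({q | f q.1 q.2 = c} : Finset (V × V)) : ℝ) ≤ (1 - ε) * Fintype.card V),
      ∃ (Y : Type) (_ : Fintype Y) (g : Y → Fin 3 → V),
        Function.Bijective (fun q : Y × Fin 3 => g q.1 q.2) ∧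
        Function.Injective (fun q : Y × Fin 3 => tcol f (g q.1) q.2) := by
  obtain ⟨m, hm, hm1, hm2⟩ := exists_reserve_size ε hε
  set θ : ℝ := ((m - 7 : ℕ) / (m : ℝ)) ^ 3 with hθ
  have hm0 : (0 : ℝ) < m := by
    have : 0 < m := by omega
    exact_mod_cast this
  have hm1' : (1 : ℝ) ≤ m := by
    have : 1 ≤ m := by omega
    exact_mod_cast this
  have hθ1 : θ ≤ 1 := by
    refine pow_le_one₀ (by positivity) ?_
    rw [div_le_one hm0]
    exact_mod_cast Nat.sub_le _ _
  have hθ0 : 0 < θ := by linarith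
  set β : ℝ := θ * (1 / m) ^ 4 / 4 with hβdef
  have hβ : 0 < β := by positivity
  have hm4 : (1 / (m : ℝ)) ^ 4 ≤ (1 / m) ^ 3 :=
    pow_le_pow_of_le_one (by positivity) (by rw [div_le_one hm0]; exact hm1') (by norm_num)
  have hm5 : (1 / (m : ℝ)) ^ 4 ≤ 1 :=
    pow_le_one₀ (by positivity) (by rw [div_le_one hm0]; exact hm1')
  have hβ1 : β ≤ 1 := by
    have := mul_le_mul hθ1 hm5 (by positivity) zero_le_one
    rw [hβdef]; linarith
  set β' : ℝ := β / 12 with hβ'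
  have hβ'0 : 0 < β' := by positivity
  set γ₁ : ℝ := β' ^ 4 / 1296 with hγ₁
  have hγ₁0 : 0 < γ₁ := by positivity
  have hγ₁1 : γ₁ ≤ 1 := by
    have : β' ^ 4 ≤ 1 := pow_le_one₀ hβ'0.le (by rw [hβ']; linarith)
    rw [hγ₁]; linarith
  set δ : ℝ := min β (γ₁ / 16) with hδ
  have hδ0 : 0 < δ := by positivity
  have hδβ : δ ≤ β := min_le_left _ _
  have hδγ : δ ≤ γ₁ / 16 := min_le_right _ _
  obtain ⟨K₁, hK₁, lottery⟩ := exists_triangle_lottery m hm δ hδ0 (by linarith)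
  obtain ⟨K₂, hK₂, matching⟩ := exists_triangle_matching (γ₁ / 4) (by positivity)
  set K : ℝ := K₁ + K₂ + 4 / β' with hK
  have h4β : 0 < 4 / β' := by positivity
  obtain ⟨n₁, hn₁⟩ := exists_log_le K β hβ
  refine ⟨K, max 11 n₁, by linarith, ?_⟩
  intro V C _ _ _ _ f hf hn hC h3 hloc hglob
  classical
  have hn11 : 11 ≤ Fintype.card V := (le_max_left _ _).trans hn
  have hKn := hn₁ _ ((le_max_right _ _).trans hn)
  set n := Fintype.card V with hndef
  have hn' : (11 : ℝ) ≤ n := by exact_mod_cast hn11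
  have hlog : 1 ≤ Real.log n := by
    rw [Real.le_log_iff_exp_le (by linarith)]
    linarith [Real.exp_one_lt_d9]
  set Λ : ℝ := K * Real.log n with hΛ
  have hKΛ : K ≤ Λ := le_mul_of_one_le_right (by linarith) hlog
  have hΛ0 : 0 < Λ := by linarith
  have hΛn : Λ ≤ n := by nlinarith
  have hnΛ : 1 ≤ (n : ℝ) / Λ := by rw [le_div_iff₀ hΛ0]; linarith
  obtain ⟨k, hk1, hk2, hk3⟩ := lottery f hf Λ hn11
    (mul_le_mul_of_nonneg_right (by linarith) (by linarith)) hloc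
  have hK₂Λ : K₂ * Real.log n ≤ Λ := by
    rw [hΛ]
    exact mul_le_mul_of_nonneg_right (by linarith) (by linarith)
  rw [← hθ] at hk1 hk2 hk3
  clear_value Λ K δ γ₁ β' β θ
  let w : C → V → ℝ := fun c v => #{u | f v u = c} + 1
  have hwsum : ∀ c, ∑ v, w c v = #({q | f q.1 q.2 = c} : Finset (V × V)) + n := by
    intro c
    simp only [w]
    rw [sum_add_distrib, sum_const, card_univ, nsmul_one]
    congr 1
    have : #({q | f q.1 q.2 = c} : Finset (V × V)) = ∑ v, #{u | f v u = c} := by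
      rw [Finset.card_eq_sum_card_fiberwise (f := Prod.fst) (t := univ) (fun _ _ => mem_univ _)]
      refine Finset.sum_congr rfl fun v _ => ?_
      refine Finset.card_nbij' (fun q => q.2) (fun u => (v, u)) ?_ ?_ ?_ ?_
      · rintro ⟨a, b⟩ h
        simp only [coe_filter, Set.mem_ofPred_eq, mem_filter, mem_univ, true_and] at h ⊢
        rw [← h.2]; exact h.1
      · intro u h
        simpa using h
      · rintro ⟨a, b⟩ h
        simp only [coe_filter, Set.mem_ofPred_eq, mem_filter, mem_univ, true_and] at h
        rw [← h.2]
      · intro u h; rfl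
    exact_mod_cast this.symm
  let good := {q : V × V × V // 2 * #{x | f x q.2.2 = f x q.1} ≤ n}
  let Q : (V × V) ⊕ good → Finset (Fin 3 → V) :=
    Sum.elim (fun q => triQ f k q.1 q.2) (fun q => triQ' f k q.1.1 q.1.2.1 q.1.2.2)
  have hn3 : (0 : ℝ) ≤ (n : ℝ) ^ 3 := by positivity
  have hglob' : ∀ c, (#({q | f q.1 q.2 = c} : Finset (V × V)) : ℝ) ≤ θ * n := fun c =>
    (hglob c).trans (mul_le_mul_of_nonneg_right hm1 (by linarith))
  have hglob1 : ∀ c, (#({q | f q.1 q.2 = c} : Finset (V × V)) : ℝ) ≤ n := fun c =>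
    (hglob' c).trans (by nlinarith)
  obtain ⟨M, hMH, hMd, hMw, hMQ⟩ := matching (J := C) (T := (V × V) ⊕ good) f hf Λ hn11 hC hC
    (by
      have h1 : Fintype.card good ≤ n * (n * n) := by
        have := Fintype.card_subtype_le (fun q : V × V × V => 2 * #{x | f x q.2.2 = f x q.1} ≤ n)
        rwa [Fintype.card_prod, Fintype.card_prod] at this
      rw [Fintype.card_sum, Fintype.card_prod, ← hndef]
      have h2 : n * n ≤ n * (n * n) := Nat.le_mul_of_pos_left _ (by omega)
      calc n * n + Fintype.card good ≤ n * (n * n) + n * (n * n) := Nat.add_le_add h2 h1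
        _ = _ := by ring)
    hK₂Λ hloc θ δ β hm2 hθ1 hδ0
    (by linarith) hβ hβ1 hKn hglob' (triH f k) (fun p hp => (mem_filter.1 hp).2.1) hk1 w
    (fun c v => by positivity)
    (fun c v => by
      have := hloc v c
      simp only [w]
      linarith)
    (fun c => by
      rw [hwsum]
      exact le_add_of_nonneg_left (Nat.cast_nonneg _))
    Q
    (by
      rintro (q | q)
      · exact Finset.filter_subset _ _
      · exact Finset.filter_subset _ _)
    (by
      rintro (q | q)
      · refine le_trans (mul_le_mul_of_nonneg_right ?_ hn3) (hk2 q.1 q.2)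
        have := mul_le_mul_of_nonneg_left hm4 hθ0.le
        rw [hβdef] at hδβ ⊢
        linarith
      · refine le_trans (mul_le_mul_of_nonneg_right ?_ hn3) (hk3 _ _ _ q.2)
        rw [hβdef] at hδβ ⊢
        linarith)
  have hQ12 : β' * n ≤ (1 - γ₁ / 4) * (β * n / 6) := by
    have h1 : 0 ≤ β * n := by positivity
    rw [hβ']
    nlinarith
  refine exists_triangle_factor_of_matching f hf k M hMH hMd Λ β' γ₁ h3 (by omega) hβ'0
    hγ₁0.le ?_ (by rw [hγ₁]; linarith) hloc hglob1
    (fun u₁ u₃ => hQ12.trans (hMQ (Sum.inl (u₁, u₃))))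
    (fun z u₂ u₃ h => hQ12.trans (hMQ (Sum.inr ⟨(z, u₂, u₃), h⟩))) ?_
  · rw [div_le_iff₀ hΛ0]
    have h1 : 4 / β' ≤ Λ := by linarith
    rw [div_le_iff₀ hβ'0] at h1
    linarith
  · intro c
    exact leftover_sum_le f hf M (fun p hp => (mem_filter.1 (hMH hp)).2.1) hMd (w c)
      (fun v => by positivity) n θ δ γ₁ hm2 hδ0 hδγ hγ₁0 hγ₁1
      (by rw [hwsum]; linarith [hglob1 c]) (hMw c)


section Arcs

variable {V C : Type} [Fintype V] [DecidableEq V] [Fintype C] [DecidableEq C]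

/-- The arcs with a colour outside the reserve. -/
def arcH (f : V → V → C) {m : ℕ} (k : C → Fin m) : Finset (Fin 2 → V) :=
  {p | 1 ≤ (k (f (p 0) (p 1))).1}

/-- The arcs whose ends are joined to `a` and `b` by edges with reserve colours. -/
def arcQ (f : V → V → C) {m : ℕ} (k : C → Fin m) (a b : V) : Finset (Fin 2 → V) :=
  {p ∈ arcH f k | ((k (f (p 0) a)).1 = 0 ∧ (k (f (p 1) a)).1 = 0 ∧ (k (f (p 0) b)).1 = 0 ∧
    (k (f (p 1) b)).1 = 0) ∧ f (p 0) a ≠ f (p 1) b ∧ f (p 1) a ≠ f (p 0) b}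

theorem card_coord_two_eq (i : Fin 2) (v : V) :
    #({p | p i = v} : Finset (Fin 2 → V)) = Fintype.card V := by
  have : ({p | p i = v} : Finset (Fin 2 → V)) =
      Fintype.piFinset fun j => if j = i then {v} else univ := by
    ext p
    simp only [mem_filter, mem_univ, true_and, Fintype.mem_piFinset]
    constructor
    · intro h j
      split_ifs with hj
      · simp [hj, h]
      · simp
    · intro h
      simpa using h i
  rw [this, Fintype.card_piFinset, Fin.prod_univ_two]
  fin_cases i <;> simp [Finset.card_univ]

theorem card_forall_mem_two (X : Finset V) :
    #({p | p 0 ∈ X ∧ p 1 ∈ X} : Finset (Fin 2 → V)) = #X ^ 2 := by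
  have : ({p | p 0 ∈ X ∧ p 1 ∈ X} : Finset (Fin 2 → V)) = Fintype.piFinset fun _ => X := by
    ext p
    simp [Fintype.mem_piFinset, Fin.forall_fin_two]
  rw [this, Fintype.card_piFinset, Fin.prod_univ_two, sq]

theorem sub_mul_le_of_neg_mul_le {N Z c c' e δ T q : ℝ} (h : -(e * N) ≤ T - Z * c) (he : e ≤ δ)
    (hN : 0 ≤ N) (hT : T ≤ q) (hc : N / 4 * c' ≤ Z * c) : (c' / 4 - δ) * N ≤ q := by
  have := mul_le_mul_of_nonneg_right he hN
  nlinarith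

theorem exists_arc_lottery (m : ℕ) (hm : 1 < m) (δ : ℝ) (hδ : 0 < δ) (hδ1 : δ ≤ 1) :
    ∃ K : ℝ, 1 ≤ K ∧ ∀ {V C : Type} [Fintype V] [DecidableEq V] [Fintype C] [DecidableEq C]
      (f : V → V → C) (_ : ∀ x y, f x y = f y x) (Λ : ℝ) (_ : 11 ≤ Fintype.card V)
      (_ : K * Real.log (Fintype.card V) ≤ Λ)
      (_ : ∀ v c, (#{x | f v x = c} : ℝ) ≤ Fintype.card V / Λ),
      ∃ k : C → Fin m,
        (∀ i v, |(#{p ∈ arcH f k | p i = v} : ℝ) -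
          (m - 1 : ℕ) / (m : ℝ) * Fintype.card V| ≤ δ * Fintype.card V) ∧
        (∀ a b, ((m - 1 : ℕ) / (m : ℝ) * (1 / m) ^ 4 / 4 - δ) * (Fintype.card V : ℝ) ^ 2 ≤
          #(arcQ f k a b)) := by
  refine ⟨16 * 5 ^ 2 / (δ / 2) ^ 2, ?_, ?_⟩
  · rw [le_div_iff₀ (by positivity)]; nlinarith
  intro V C _ _ _ _ f hf Λ hn hKΛ hloc
  classical
  set n := Fintype.card V with hndef
  have hn' : (11 : ℝ) ≤ n := by exact_mod_cast hn
  have : Nonempty V := Fintype.card_pos_iff.1 (by omega)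
  have hlog : 1 ≤ Real.log n := by
    rw [Real.le_log_iff_exp_le (by linarith)]
    linarith [Real.exp_one_lt_d9]
  have hΛ1 : 16 * 5 ^ 2 / (δ / 2) ^ 2 ≤ Λ := by
    refine le_trans ?_ hKΛ
    exact le_mul_of_one_le_right (by positivity) hlog
  have hΛδ : 50 / δ ≤ Λ := by
    refine le_trans ?_ hΛ1
    rw [div_le_div_iff₀ hδ (by positivity)]
    nlinarith
  have hΛ : 0 < Λ := lt_of_lt_of_le (by positivity) hΛδ
  have h49 : 25 / Λ ≤ δ / 2 := by
    rw [div_le_iff₀ hδ] at hΛδ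
    rw [div_le_iff₀ hΛ]
    linarith
  have hx := mul_exp_neg_le (n := n) (δ := δ / 2) (Λ := Λ) (r₀ := 5) (by norm_num) (by positivity)
    (by omega) (by exact_mod_cast hKΛ)
  set x := 2 * (Fintype.card (C → Fin m) : ℝ) *
    Real.exp (-((δ / 2) ^ 2 * Λ / (4 * (5 : ℕ) ^ 2))) with hxdef
  have hmpos : 0 < m := by omega
  have hm' : (0 : ℝ) < m := by exact_mod_cast hmpos
  let main : Finset (Fin m) := {x | 1 ≤ x.1}
  let res : Finset (Fin m) := {x | x.1 = 0}
  have hres : #res = 1 := card_single hmpos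
  have hmain : #main = m - 1 := by
    have h := Finset.card_filter_add_card_filter_not (s := (univ : Finset (Fin m)))
      (fun x => x.1 = 0)
    rw [card_univ, Fintype.card_fin] at h
    have h2 : ({x | ¬ x.1 = 0} : Finset (Fin m)) = main := by
      ext x; simp [main]; omega
    rw [h2] at h
    change #res + _ = _ at h
    omega
  let E1 : Fin 1 → Fin 2 × (Fin 2 ⊕ Fin 2) := ![(0, Sum.inl 1)]
  let E3 : Fin 3 → Fin 2 × (Fin 2 ⊕ Fin 2) := ![(0, Sum.inl 1), (0, Sum.inr 0), (1, Sum.inr 0)]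
  let E5 : Fin 5 → Fin 2 × (Fin 2 ⊕ Fin 2) := ![(0, Sum.inl 1), (0, Sum.inr 0), (1, Sum.inr 0),
    (0, Sum.inr 1), (1, Sum.inr 1)]
  let X : V × V → Finset V := fun q => {x | f x q.1 = f x q.2}
  have t1 := fun q : Fin 2 × V => exists_bad_lottery f hf Λ hloc hmpos (r := 1) (by norm_num) hΛ
    (fun _ => q.2) E1 {p | p q.1 = q.2} {p | p q.1 = q.2} ⟨fun _ => q.2, by simp⟩ subset_rfl
    (univ.erase q.1)
    (by
      intro j hj b hb v
      simp only [mem_erase, mem_filter, mem_univ, and_true, true_and] at hj hb ⊢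
      rw [Function.update_of_ne (Ne.symm hj), hb])
    ((by decide : ∀ i : Fin 2, ∀ l : Fin 1, ∃ j ∈ univ.erase i,
      OnEdge ((![(0, Sum.inl 1)] : Fin 1 → Fin 2 × (Fin 2 ⊕ Fin 2)) l) j) q.1)
    (by
      intro l l' hll
      exact absurd hll (by rw [Subsingleton.elim l l']; exact lt_irrefl _))
    (fun _ => main) (δ / 2) (by positivity) (by linarith) 5 (by norm_num)
  have t3 := fun q : V × V => exists_bad_lottery f hf Λ hloc hmpos (r := 3) (by norm_num) hΛ
    ![q.1, q.2] E3 univ {p | p 0 ∈ X q ∧ p 1 ∈ X q} ⟨fun _ => q.2, by simp⟩ (subset_univ _) univ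
    (fun _ _ _ _ _ => mem_univ _) (by decide)
    (by intro l l' hll; left; revert l l'; decide)
    ![main, res, res] (δ / 2) (by positivity) (by linarith) 5
    (by norm_num)
  have t5 := fun q : V × V => exists_bad_lottery f hf Λ hloc hmpos (r := 5) (by norm_num) hΛ
    ![q.1, q.2] E5 univ {p | p 0 ∈ (X q)ᶜ ∧ p 1 ∈ (X q)ᶜ} ⟨fun _ => q.1, by simp⟩
    (subset_univ _) univ
    (fun _ _ _ _ _ => mem_univ _) (by decide)
    (by
      intro l l' hll
      by_cases h : l = 1 ∧ l' = 3
      · right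
        rw [h.1, h.2]
        intro p hp
        have := (mem_filter.1 hp).2.1
        simpa [ecol, E5, X] using this
      by_cases h' : l = 2 ∧ l' = 4
      · right
        rw [h'.1, h'.2]
        intro p hp
        have := (mem_filter.1 hp).2.2
        simpa [ecol, E5, X] using this
      · left
        revert l l'; decide)
    ![main, res, res, res, res] (δ / 2) (by positivity)
    (by linarith) 5 (by norm_num)
  choose A1 hA1 hA1' using t1
  choose A3 hA3 hA3' using t3
  choose A5 hA5 hA5' using t5
  have hΩ : (0 : ℝ) < Fintype.card (C → Fin m) := by
    have : Nonempty (Fin m) := ⟨⟨0, hmpos⟩⟩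
    exact_mod_cast Fintype.card_pos
  obtain ⟨k, hk1, hk3, hk5⟩ := exists_avoiding A1 A3 A5 x hA1 hA3 hA5 (by
    simp only [Fintype.card_prod, Fintype.card_fin, ← hndef]
    push_cast
    have h1 : x ≤ 2 * (Fintype.card (C → Fin m) : ℝ) * (1 / (n : ℝ) ^ 4) :=
      mul_le_mul_of_nonneg_left hx (by positivity)
    have h2 : (2 * n + n * n + n * n : ℝ) * (2 * (1 / (n : ℝ) ^ 4)) < 1 := by
      have : (2 * n + n * n + n * n : ℝ) * (2 * (1 / (n : ℝ) ^ 4)) =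
          (2 * (2 * n + n * n + n * n)) / (n : ℝ) ^ 4 := by ring
      rw [this, div_lt_one (by positivity)]
      have h3 : (11 : ℝ) * n ≤ n * n := by nlinarith
      have h5 : (11 : ℝ) * 11 * (n * n) ≤ n ^ 4 := by
        have : (n : ℝ) ^ 4 = n * n * (n * n) := by ring
        rw [this]
        exact mul_le_mul_of_nonneg_right (by nlinarith) (by positivity)
      nlinarith
    calc _ ≤ (2 * n + n * n + n * n : ℝ) *
          (2 * (Fintype.card (C → Fin m) : ℝ) * (1 / (n : ℝ) ^ 4)) :=
          mul_le_mul_of_nonneg_left h1 (by positivity)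
      _ = ((2 * n + n * n + n * n : ℝ) * (2 * (1 / (n : ℝ) ^ 4))) *
          Fintype.card (C → Fin m) := by ring
      _ < 1 * Fintype.card (C → Fin m) := mul_lt_mul_of_pos_right h2 hΩ
      _ = _ := one_mul _)
  have hfac : ∀ r : ℕ, r ≤ 5 → δ / 2 + (r : ℝ) ^ 2 / Λ ≤ δ := by
    intro r hr
    have h1 : (r : ℝ) ^ 2 ≤ 25 := by
      have : (r : ℝ) ≤ 5 := by exact_mod_cast hr
      have h0 : (0 : ℝ) ≤ r := Nat.cast_nonneg _
      nlinarith
    have : (r : ℝ) ^ 2 / Λ ≤ 25 / Λ := div_le_div_of_nonneg_right h1 hΛ.le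
    linarith
  have hcard2 : (#(univ : Finset (Fin 2 → V)) : ℝ) = (n : ℝ) ^ 2 := by
    rw [card_univ, Fintype.card_fun, Fintype.card_fin]; push_cast; rfl
  refine ⟨k, ?_, ?_⟩
  · intro i v
    have h := hA1' (i, v) k (hk1 (i, v))
    have h1 : ({p ∈ arcH f k | p i = v} : Finset (Fin 2 → V)) =
        {p ∈ ({p | p i = v} : Finset (Fin 2 → V)) |
          Function.Injective (ecol f (fun _ : Fin 2 => v) E1 p) ∧
            ∀ l, k (ecol f (fun _ : Fin 2 => v) E1 p l) ∈ main} := by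
      ext p
      simp only [arcH, mem_filter, mem_univ, true_and, main]
      constructor
      · rintro ⟨h1, h2⟩
        refine ⟨h2, Function.injective_of_subsingleton _, fun l => ?_⟩
        rw [Subsingleton.elim l 0]
        exact h1
      · rintro ⟨h1, -, h2⟩
        exact ⟨h2 0, h1⟩
    simp only at h
    rw [← h1, card_coord_two_eq, prod_const, card_univ, Fintype.card_fin, hmain, ← hndef,
      pow_one] at h
    rw [mul_comm (n : ℝ)] at h
    refine h.trans (mul_le_mul_of_nonneg_right ?_ (by positivity))
    exact_mod_cast hfac 1 (by norm_num)
  · intro a b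
    have hn2 : (0 : ℝ) ≤ (n : ℝ) ^ 2 := by positivity
    set ρ : ℝ := 1 / m with hρ
    have hρ0 : 0 < ρ := by positivity
    have hρ1 : ρ ≤ 1 := by
      rw [hρ, div_le_one hm']; exact_mod_cast hmpos
    set θ : ℝ := (m - 1 : ℕ) / (m : ℝ) with hθ
    have hθ0 : 0 ≤ θ := by positivity
    by_cases hX : n ≤ 2 * #(X (a, b))
    · have h := hA3' (a, b) k (hk3 (a, b))
      simp only [hcard2] at h
      rw [card_forall_mem_two] at h
      have h1 : ({p ∈ ({p | p 0 ∈ X (a, b) ∧ p 1 ∈ X (a, b)} : Finset (Fin 2 → V)) |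
          Function.Injective (ecol f ![a, b] E3 p) ∧
          ∀ l, k (ecol f ![a, b] E3 p l) ∈ (![main, res, res] : Fin 3 → Finset (Fin m)) l} :
          Finset (Fin 2 → V)) ⊆ arcQ f k a b := by
        intro p hp
        simp only [mem_filter, mem_univ, true_and, X] at hp
        obtain ⟨⟨hp3, hp4⟩, hp1, hp2⟩ := hp
        have e0 := hp2 0
        have e1 := hp2 1
        have e2 := hp2 2
        have hne := hp1.ne (show (1 : Fin 3) ≠ 2 by decide)
        simp only [main, res, E3, ecol, Matrix.cons_val, Sum.elim_inl, Sum.elim_inr, mem_filter,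
          mem_univ, true_and] at e0 e1 e2 hne
        simp only [arcQ, arcH, mem_filter, mem_univ, true_and]
        rw [← hp3, ← hp4]
        exact ⟨e0, ⟨e1, e2, e1, e2⟩, hne, hne.symm⟩
      have h2 : (∏ l, (#((![main, res, res] : Fin 3 → Finset (Fin m)) l) : ℝ) / m) =
          θ * ρ ^ 2 := by
        rw [Fin.prod_univ_three]
        simp only [Matrix.cons_val, hmain, hres, Nat.cast_one]
        rw [← hρ, ← hθ]
        ring
      rw [h2, abs_le] at h
      have h3 : (#_ : ℝ) ≤ _ := Nat.cast_le.2 (Finset.card_le_card h1)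
      have hX' : (n : ℝ) ≤ 2 * #(X (a, b)) := by exact_mod_cast hX
      have h7 : (n : ℝ) ^ 2 / 4 ≤ (#(X (a, b)) : ℝ) ^ 2 := by nlinarith
      have h8 : ρ ^ 4 ≤ ρ ^ 2 := pow_le_pow_of_le_one hρ0.le hρ1 (by norm_num)
      have h9 : (n : ℝ) ^ 2 / 4 * (θ * ρ ^ 4) ≤ (#(X (a, b)) : ℝ) ^ 2 * (θ * ρ ^ 2) :=
        mul_le_mul h7 (mul_le_mul_of_nonneg_left h8 hθ0) (by positivity) (by positivity)
      have h10 := h.1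
      rw [Nat.cast_pow] at h10
      exact sub_mul_le_of_neg_mul_le h10 (hfac 3 (by norm_num)) hn2 h3 h9
    · have h := hA5' (a, b) k (hk5 (a, b))
      simp only [hcard2] at h
      rw [card_forall_mem_two] at h
      have h1 : ({p ∈ ({p | p 0 ∈ (X (a, b))ᶜ ∧ p 1 ∈ (X (a, b))ᶜ} : Finset (Fin 2 → V)) |
          Function.Injective (ecol f ![a, b] E5 p) ∧
          ∀ l, k (ecol f ![a, b] E5 p l) ∈
            (![main, res, res, res, res] : Fin 5 → Finset (Fin m)) l} :
          Finset (Fin 2 → V)) ⊆ arcQ f k a b := by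
        intro p hp
        simp only [mem_filter] at hp
        obtain ⟨-, hp1, hp2⟩ := hp
        have e0 := hp2 0
        have e1 := hp2 1
        have e2 := hp2 2
        have e3 := hp2 3
        have e4 := hp2 4
        have hne := hp1.ne (show (1 : Fin 5) ≠ 4 by decide)
        have hne' := hp1.ne (show (2 : Fin 5) ≠ 3 by decide)
        simp only [main, res, E5, ecol, Matrix.cons_val, Sum.elim_inl, Sum.elim_inr, mem_filter,
          mem_univ, true_and] at e0 e1 e2 e3 e4 hne hne'
        simp only [arcQ, arcH, mem_filter, mem_univ, true_and]
        exact ⟨e0, ⟨e1, e2, e3, e4⟩, hne, hne'⟩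
      have h2 : (∏ l, (#((![main, res, res, res, res] : Fin 5 → Finset (Fin m)) l) : ℝ) / m) =
          θ * ρ ^ 4 := by
        rw [Fin.prod_univ_five]
        simp only [Matrix.cons_val, hmain, hres, Nat.cast_one]
        rw [← hρ, ← hθ]
        ring
      rw [h2, abs_le] at h
      have h3 : (#_ : ℝ) ≤ _ := Nat.cast_le.2 (Finset.card_le_card h1)
      have hX' : (n : ℝ) ≤ 2 * #(X (a, b))ᶜ := by
        have := Finset.card_compl_add_card (X (a, b))
        have : n ≤ 2 * #(X (a, b))ᶜ := by omega
        exact_mod_cast this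
      have h7 : (n : ℝ) ^ 2 / 4 ≤ (#(X (a, b))ᶜ : ℝ) ^ 2 := by nlinarith
      have h9 : (n : ℝ) ^ 2 / 4 * (θ * ρ ^ 4) ≤ (#(X (a, b))ᶜ : ℝ) ^ 2 * (θ * ρ ^ 4) :=
        mul_le_mul_of_nonneg_right h7 (by positivity)
      have h10 := h.1
      rw [Nat.cast_pow] at h10
      exact sub_mul_le_of_neg_mul_le h10 (hfac 5 (by norm_num)) hn2 h3 h9

end Arcs

section Ordering

variable {V : Type} [DecidableEq V]

omit [DecidableEq V] in
theorem pair_isInfix_append {a b : V} : ∀ {s t : List V}, [a, b] <:+: s ++ t →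
    [a, b] <:+: s ∨ [a, b] <:+: t ∨ ((∃ s', s = s' ++ [a]) ∧ ∃ t', t = b :: t') := by
  intro s
  induction s with
  | nil => intro t h; exact Or.inr (Or.inl h)
  | cons c s ih =>
    intro t h
    rw [List.cons_append, List.infix_cons_iff] at h
    rcases h with h | h
    · rw [List.cons_prefix_cons] at h
      obtain ⟨rfl, h⟩ := h
      rcases s with _ | ⟨d, s⟩
      · right; right
        obtain ⟨t', ht'⟩ := h
        exact ⟨⟨[], rfl⟩, t', by simpa using ht'.symm⟩
      · rw [List.cons_append, List.cons_prefix_cons] at h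
        obtain ⟨rfl, -⟩ := h
        exact Or.inl ⟨[], s, rfl⟩
    · rcases ih h with h | h | ⟨⟨s', rfl⟩, h'⟩
      · exact Or.inl (h.trans (List.suffix_cons c s).isInfix)
      · exact Or.inr (Or.inl h)
      · exact Or.inr (Or.inr ⟨⟨c :: s', rfl⟩, h'⟩)

/-- An enumeration of the vertices in which each arc of `M` joins consecutive vertices. -/
def IsOrdering (M : Finset (Fin 2 → V)) (ℓ : List V) : Prop :=
  ℓ.Nodup ∧ (∀ v, v ∈ ℓ) ∧ ∀ p ∈ M, [p 0, p 1] <:+: ℓ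

/-- Adding the arc from `x` to `y` would close a directed cycle. -/
def Blocked (M : Finset (Fin 2 → V)) (ℓ : List V) (x y : V) : Prop :=
  x = y ∨ ∃ A B C, ℓ = A ++ y :: (B ++ x :: C) ∧ ∀ w ∈ B ++ [x], ∃ p ∈ M, p 1 = w

theorem exists_isOrdering_insert {M : Finset (Fin 2 → V)} {ℓ : List V} (h : IsOrdering M ℓ)
    (q : Fin 2 → V) (hx : ∀ p ∈ M, p 0 ≠ q 0) (hy : ∀ p ∈ M, p 1 ≠ q 1)
    (hb : ¬ Blocked M ℓ (q 0) (q 1)) : ∃ ℓ', IsOrdering (insert q M) ℓ' := by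
  obtain ⟨h1, h2, h3⟩ := h
  obtain ⟨hne, hb⟩ := not_or.1 hb
  obtain ⟨A, R, hA⟩ := List.append_of_mem (h2 (q 0))
  have key : ∀ ℓ' : List V, ℓ'.Perm ℓ → [q 0, q 1] <:+: ℓ' →
      (∀ p ∈ M, [p 0, p 1] <:+: ℓ → [p 0, p 1] <:+: ℓ') → ∃ ℓ', IsOrdering (insert q M) ℓ' := by
    intro ℓ' hp hq hM
    refine ⟨ℓ', hp.nodup_iff.2 h1, fun v => hp.mem_iff.2 (h2 v), ?_⟩
    intro p hp
    rcases mem_insert.1 hp with rfl | hp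
    · exact hq
    · exact hM p hp (h3 p hp)
  have hy' : q 1 ∈ R ∨ q 1 ∈ A := by
    have := h2 (q 1)
    rw [hA, List.mem_append, List.mem_cons] at this
    rcases this with h | h | h
    · exact Or.inr h
    · exact absurd h.symm hne
    · exact Or.inl h
  rcases hy' with hyR | hyA
  · obtain ⟨B, C, rfl⟩ := List.append_of_mem hyR
    refine key ((A ++ [q 0]) ++ ((q 1 :: C) ++ B)) ?_ ⟨A, C ++ B, by simp⟩ ?_
    · rw [hA, List.append_assoc]
      refine List.Perm.append_left A ?_
      exact List.Perm.cons _ (List.perm_append_comm (l₁ := q 1 :: C) (l₂ := B))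
    · intro p hp hpl
      have e : ℓ = (A ++ [q 0]) ++ (B ++ (q 1 :: C)) := by rw [hA]; simp
      rw [e] at hpl
      rcases pair_isInfix_append hpl with h | h | ⟨⟨s, hs⟩, -⟩
      · exact h.trans (List.prefix_append _ _).isInfix
      · rcases pair_isInfix_append h with h | h | ⟨-, t, ht⟩
        · exact h.trans ((List.suffix_append _ _).trans (List.suffix_append _ _)).isInfix
        · exact h.trans ((List.prefix_append _ _).isInfix.trans (List.suffix_append _ _).isInfix)
        · exact absurd (List.cons.inj ht).1.symm (hy p hp)
      · have := List.append_inj_right' hs rfl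
        exact absurd (List.cons.inj this).1.symm (hx p hp)
  · obtain ⟨A, B, rfl⟩ := List.append_of_mem hyA
    have hb' : ∃ w ∈ B ++ [q 0], ∀ p ∈ M, p 1 ≠ w := by
      by_contra hcon
      push Not at hcon
      exact hb ⟨A, B, R, by rw [hA]; simp, hcon⟩
    obtain ⟨w, hw, hwM⟩ := hb'
    obtain ⟨B₁, D, hBD⟩ := List.append_of_mem hw
    have hlast : ∃ D', w :: D = D' ++ [q 0] := by
      rcases List.eq_nil_or_concat D with rfl | ⟨D', z, rfl⟩
      · have := List.append_inj_right' hBD rfl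
        exact ⟨[], by rw [this]; rfl⟩
      · have hBD' : B ++ [q 0] = (B₁ ++ w :: D') ++ [z] := by rw [hBD]; simp
        have := List.append_inj_right' hBD' rfl
        exact ⟨w :: D', by rw [(List.cons.inj this).1]; simp⟩
    obtain ⟨D', hD'⟩ := hlast
    have e : ℓ = A ++ ((q 1 :: B₁) ++ ((w :: D) ++ R)) := by
      rw [hA]
      have : B ++ q 0 :: R = (B ++ [q 0]) ++ R := by simp
      rw [List.append_assoc, List.cons_append, this, hBD]; simp
    refine key (A ++ ((w :: D) ++ ((q 1 :: B₁) ++ R))) ?_ ?_ ?_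
    · rw [e]
      refine List.Perm.append_left A ?_
      rw [← List.append_assoc, ← List.append_assoc]
      exact List.Perm.append_right R List.perm_append_comm
    · exact ⟨A ++ D', B₁ ++ R, by rw [hD']; simp⟩
    · intro p hp hpl
      rw [e] at hpl
      rcases pair_isInfix_append hpl with h | h | ⟨-, t, ht⟩
      · exact h.trans (List.prefix_append _ _).isInfix
      · rcases pair_isInfix_append h with h | h | ⟨-, t, ht⟩
        · refine h.trans (List.IsInfix.trans ?_ (List.suffix_append _ _).isInfix)
          exact (List.prefix_append _ _).isInfix.trans (List.suffix_append _ _).isInfix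
        · rcases pair_isInfix_append h with h | h | ⟨⟨s, hs⟩, -⟩
          · exact h.trans ((List.prefix_append _ _).isInfix.trans (List.suffix_append _ _).isInfix)
          · refine h.trans (List.IsSuffix.isInfix ?_)
            exact (List.suffix_append _ _).trans
              ((List.suffix_append _ _).trans (List.suffix_append _ _))
          · rw [hD'] at hs
            have := List.append_inj_right' hs rfl
            exact absurd (List.cons.inj this).1.symm (hx p hp)
        · exact absurd (List.cons.inj ht).1.symm (hwM p hp)
      · exact absurd (List.cons.inj ht).1.symm (hy p hp)

theorem blocked_unique {M : Finset (Fin 2 → V)} {ℓ : List V} (h : ℓ.Nodup) {x y y' : V}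
    (hy : ∀ p ∈ M, p 1 ≠ y) (hy' : ∀ p ∈ M, p 1 ≠ y')
    (hb : Blocked M ℓ x y) (hb' : Blocked M ℓ x y') (hx : x ≠ y) (hx' : x ≠ y') : y = y' := by
  obtain ⟨A, B, C, h1, h2⟩ := hb.resolve_left hx
  obtain ⟨A', B', C', h1', h2'⟩ := hb'.resolve_left hx'
  have e1 : ℓ = (A ++ y :: B) ++ x :: C := by rw [h1]; simp
  have e2 : ℓ = (A' ++ y' :: B') ++ x :: C' := by rw [h1']; simp
  have n1 : x ∉ A ++ y :: B ∧ x ∉ C := by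
    rw [e1, List.nodup_append] at h
    refine ⟨fun hm => h.2.2 x hm x (by simp) rfl, (List.nodup_cons.1 h.2.1).1⟩
  have n2 : x ∉ A' ++ y' :: B' := by
    rw [e2, List.nodup_append] at h
    exact fun hm => h.2.2 x hm x (by simp) rfl
  have e3 : A ++ y :: B = A' ++ y' :: B' := by
    have e := e1.symm.trans e2
    rcases List.append_eq_append_iff.1 e with ⟨s, hs, hs'⟩ | ⟨s, hs, hs'⟩
    · rcases s with _ | ⟨c, s⟩
      · simpa using hs.symm
      · have := (List.cons.inj hs').1
        exact absurd (by rw [hs, this]; simp) n2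
    · rcases s with _ | ⟨c, s⟩
      · simpa using hs
      · have := (List.cons.inj hs').1
        exact absurd (by rw [hs, this]; simp) n1.1
  by_contra hne
  rcases List.append_eq_append_iff.1 e3 with ⟨s, hs, hs'⟩ | ⟨s, hs, hs'⟩
  · rcases s with _ | ⟨c, s⟩
    · exact hne (List.cons.inj hs').1
    · have : y' ∈ B := by rw [(List.cons.inj hs').2]; simp
      obtain ⟨p, hp, hpy⟩ := h2 y' (by simp [this])
      exact hy' p hp hpy
  · rcases s with _ | ⟨c, s⟩
    · exact hne (List.cons.inj hs').1.symm
    · have : y ∈ B' := by rw [(List.cons.inj hs').2]; simp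
      obtain ⟨p, hp, hpy⟩ := h2' y (by simp [this])
      exact hy p hp hpy

theorem card_le_of_forall_blocked [Fintype V] {M : Finset (Fin 2 → V)} {ℓ : List V}
    (h : IsOrdering M ℓ) (S : Finset (Fin 2 → V))
    (hS : ∀ q ∈ S, (∀ p ∈ M, p 1 ≠ q 1) ∧ Blocked M ℓ (q 0) (q 1)) :
    #S ≤ 2 * Fintype.card V := by
  classical
  have h1 : #S ≤ #(univ : Finset (V × Bool)) := by
    refine Finset.card_le_card_of_injOn (fun q => (q 0, decide (q 0 = q 1)))
      (fun _ _ => mem_coe.2 (mem_univ _)) ?_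
    intro q hq q' hq' hqq
    simp only [Prod.mk.injEq, decide_eq_decide] at hqq
    obtain ⟨e0, e1⟩ := hqq
    have : q 1 = q' 1 := by
      by_cases hc : q 0 = q 1
      · rw [← hc, ← e1.1 hc, e0]
      · refine blocked_unique h.1 (hS q hq).1 (hS q' hq').1 (hS q hq).2 ?_ hc ?_
        · rw [e0]; exact (hS q' hq').2
        · intro hc'; exact hc (e1.2 (e0 ▸ hc'))
    funext i
    fin_cases i
    · exact e0
    · exact this
  refine h1.trans (le_of_eq ?_)
  rw [card_univ, Fintype.card_prod, Fintype.card_bool, mul_comm]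

end Ordering

section ArcMatching

variable {V C : Type} [DecidableEq V] [DecidableEq C]

/-- The start, the end and the colour of an arc. -/
def aval (f : V → V → C) (p : Fin 2 → V) : Finset ((V ⊕ V) ⊕ C) :=
  {Sum.inl (Sum.inl (p 0)), Sum.inl (Sum.inr (p 1)), Sum.inr (f (p 0) (p 1))}

theorem card_aval (f : V → V → C) (p : Fin 2 → V) : #(aval f p) = 3 := by
  rw [aval, card_insert_of_notMem (by simp), card_insert_of_notMem (by simp), card_singleton]

theorem card_arcs_le [Fintype V] (f : V → V → C) (i : Fin 2) (v : V) (c : C) :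
    #({p | p i = v ∧ f v (p (i + 1)) = c} : Finset (Fin 2 → V)) ≤ #{x | f v x = c} := by
  refine Finset.card_le_card_of_injOn (fun p => p (i + 1)) ?_ ?_
  · intro p hp
    simp only [coe_filter, Set.mem_ofPred_eq, mem_univ, true_and] at hp ⊢
    exact hp.2
  · intro p hp q hq h
    simp only [coe_filter, Set.mem_ofPred_eq, mem_univ, true_and] at hp hq h
    funext j
    have : ∀ i j : Fin 2, j = i ∨ j = i + 1 := by decide
    rcases this i j with rfl | rfl
    · rw [hp.1, hq.1]
    · exact h

theorem card_aval_pair_le [Fintype V] (f : V → V → C) (hf : ∀ x y, f x y = f y x) (r : ℝ)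
    (hr : 0 ≤ r) (hloc : ∀ v c, (#{x | f v x = c} : ℝ) ≤ r) (x y : (V ⊕ V) ⊕ C) (hxy : y ≠ x)
    (H : Finset (Fin 2 → V)) : (#{p ∈ H | x ∈ aval f p ∧ y ∈ aval f p} : ℝ) ≤ r := by
  have key : ∀ i v c, (∀ p : Fin 2 → V, x ∈ aval f p → y ∈ aval f p →
      p i = v ∧ f v (p (i + 1)) = c) → (#{p ∈ H | x ∈ aval f p ∧ y ∈ aval f p} : ℝ) ≤ r := by
    intro i v c h
    refine le_trans ?_ (hloc v c)
    have h1 : ({p ∈ H | x ∈ aval f p ∧ y ∈ aval f p} : Finset _) ⊆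
        ({p | p i = v ∧ f v (p (i + 1)) = c} : Finset (Fin 2 → V)) := by
      intro p hp
      simp only [mem_filter, mem_univ, true_and] at hp ⊢
      exact h p hp.2.1 hp.2.2
    exact_mod_cast (Finset.card_le_card h1).trans (card_arcs_le f i v c)
  have key0 : (∀ p : Fin 2 → V, x ∈ aval f p → y ∈ aval f p → False) →
      (#{p ∈ H | x ∈ aval f p ∧ y ∈ aval f p} : ℝ) ≤ r := by
    intro h
    rw [Finset.filter_false_of_mem fun p _ hp => h p hp.1 hp.2]
    simpa using hr
  rcases x with (v | v) | c <;> rcases y with (v' | v') | c' <;>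
    simp only [aval, mem_insert, mem_singleton, Sum.inl.injEq, Sum.inr.injEq, reduceCtorEq,
      or_false, false_or, ne_eq] at key key0 hxy ⊢
  · exact key0 fun p h h' => hxy (h'.trans h.symm)
  · exact key 0 v (f v v') fun p h h' => ⟨h.symm, by rw [h']; rfl⟩
  · exact key 0 v c' fun p h h' => ⟨h.symm, by rw [h, h']; rfl⟩
  · exact key 0 v' (f v' v) fun p h h' => ⟨h'.symm, by rw [h]; rfl⟩
  · exact key0 fun p h h' => hxy (h'.trans h.symm)
  · exact key 1 v c' fun p h h' => ⟨h.symm, by rw [h, h', hf]; rfl⟩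
  · exact key 0 v' c fun p h h' => ⟨h'.symm, by rw [h, h']; rfl⟩
  · exact key 1 v' c fun p h h' => ⟨h'.symm, by rw [h, h', hf]; rfl⟩
  · exact key0 fun p h h' => hxy (h'.trans h.symm)

theorem exists_arc_matching (γ β : ℝ) (hγ : 0 < γ) (hβ : 0 < β) (hβ1 : β ≤ 1) :
    ∃ K : ℝ, 1 ≤ K ∧ ∀ {V C J : Type} [Fintype V] [DecidableEq V] [Fintype C] [DecidableEq C]
      [Fintype J] (f : V → V → C) (_ : ∀ x y, f x y = f y x) (Λ : ℝ)
      (_ : 11 ≤ Fintype.card V) (_ : Fintype.card C ≤ 2 * Fintype.card V ^ 2)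
      (_ : Fintype.card J ≤ Fintype.card V ^ 3)
      (_ : K * Real.log (Fintype.card V) ≤ Λ) (_ : Λ ≤ Fintype.card V)
      (_ : ∀ v c, (#{x | f v x = c} : ℝ) ≤ Fintype.card V / Λ)
      (θ δ : ℝ) (_ : 1 / 2 ≤ θ) (_ : θ ≤ 1) (_ : 0 < δ) (_ : δ ≤ 1 / 4)
      (_ : ∀ c, (#({q | f q.1 q.2 = c} : Finset (V × V)) : ℝ) ≤ θ * Fintype.card V)
      (H : Finset (Fin 2 → V))
      (_ : ∀ i v, |(#{p ∈ H | p i = v} : ℝ) - θ * Fintype.card V| ≤ δ * Fintype.card V)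
      (q : J → (Fin 2 → V) → ℝ) (_ : ∀ j p, 0 ≤ q j p)
      (_ : ∀ j p, q j p ≤ 2 * (Fintype.card V / Λ))
      (_ : ∀ j, β * (Fintype.card V : ℝ) ^ 2 ≤ ∑ p ∈ H, q j p),
      ∃ M ⊆ H, (∀ p ∈ M, ∀ p' ∈ M, p ≠ p' →
          p 0 ≠ p' 0 ∧ p 1 ≠ p' 1 ∧ f (p 0) (p 1) ≠ f (p' 0) (p' 1)) ∧
        (∃ ℓ, IsOrdering M ℓ) ∧
        ∀ j, (1 - γ) * ((∑ p ∈ H, q j p) / ((θ + δ) * Fintype.card V)) ≤ ∑ p ∈ M, q j p := by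
  obtain ⟨K, hK, hmatch⟩ := exists_pseudorandom_matching 3 (by norm_num) γ hγ
  have hKβ : 0 < K / β := div_pos (by linarith) hβ
  refine ⟨80 * (K / β), ?_, ?_⟩
  · have : 1 ≤ K / β := by rw [le_div_iff₀ hβ]; linarith
    linarith
  intro V C J _ _ _ _ _ f hf Λ hn hC hJ hKΛ hΛn hloc θ δ hθ hθ1 hδ hδ1 hglob H hdeg q hq0 hq1 hQ
  classical
  set n := Fintype.card V with hndef
  have hn' : (11 : ℝ) ≤ n := by exact_mod_cast hn
  have hlog : 1 ≤ Real.log n := by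
    rw [Real.le_log_iff_exp_le (by linarith)]
    linarith [Real.exp_one_lt_d9]
  have hΛ : 0 < Λ := lt_of_lt_of_le (by positivity) hKΛ
  set D : ℝ := (θ + δ) * n with hD
  set L : ℝ := β * Λ / 16 with hL
  have hn2 : (0 : ℝ) < (n : ℝ) ^ 2 := by positivity
  have hD0 : 0 < D := by positivity
  have hL0 : 0 < L := by positivity
  have hDn : D ≤ 5 / 4 * n := by
    rw [hD]; exact mul_le_mul_of_nonneg_right (by linarith) (by linarith)
  have hDn' : 1 / 2 * (n : ℝ) ≤ D := by
    rw [hD]; exact mul_le_mul_of_nonneg_right (by linarith) (by linarith)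
  have hdeg1 : ∀ i v, (#{p ∈ H | p i = v} : ℝ) ≤ D := by
    intro i v
    have := (abs_le.1 (hdeg i v)).2
    rw [hD]; linarith
  have hvsdeg : ∀ x, (#(H.filter (x ∈ aval f ·)) : ℝ) ≤ D := by
    intro x
    rcases x with (v | v) | c
    · refine le_trans (le_of_eq ?_) (hdeg1 0 v)
      congr 2; ext p; simp [aval, eq_comm]
    · refine le_trans (le_of_eq ?_) (hdeg1 1 v)
      congr 2; ext p; simp [aval, eq_comm]
    · have h1 : #(H.filter (Sum.inr c ∈ aval f ·)) ≤
          #({q | f q.1 q.2 = c} : Finset (V × V)) := by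
        refine Finset.card_le_card_of_injOn (fun p => (p 0, p 1)) ?_ ?_
        · intro p hp
          simp only [coe_filter, Set.mem_ofPred_eq, aval, mem_insert, reduceCtorEq, false_or,
            mem_singleton, Sum.inr.injEq, mem_univ, true_and] at hp ⊢
          exact hp.2.symm
        · intro p _ p' _ h
          simp only [Prod.mk.injEq] at h
          funext i
          fin_cases i
          · exact h.1
          · exact h.2
      have h2 : (#(H.filter (Sum.inr c ∈ aval f ·)) : ℝ) ≤
          #({q | f q.1 q.2 = c} : Finset (V × V)) := by exact_mod_cast h1
      have h3 : θ * (n : ℝ) ≤ D := by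
        rw [hD]; exact mul_le_mul_of_nonneg_right (by linarith) (by linarith)
      exact h2.trans ((hglob c).trans h3)
  have hbig : ∀ j p, q j p * (D * L) ≤ ∑ p ∈ H, q j p := by
    intro j p
    refine le_trans ?_ (hQ j)
    calc q j p * (D * L) ≤ 2 * (n / Λ) * (5 / 4 * n * L) := by
          have := hq1 j p
          have h0 := hq0 j p
          gcongr
      _ = 5 / 32 * (β * (n : ℝ) ^ 2) := by rw [hL]; field_simp; ring
      _ ≤ _ := by
        have : 0 ≤ β * (n : ℝ) ^ 2 := by positivity
        linarith
  have hQpos : ∀ j, 0 < ∑ p ∈ H, q j p := fun j => lt_of_lt_of_le (by positivity) (hQ j)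
  have hDcast : ∀ {a b : ℝ}, a * L ≤ b → a ≤ b / L := fun h => (le_div_iff₀ hL0).2 h
  obtain ⟨M, hMH, hMd, hMP, hMq⟩ := hmatch H (aval f) (fun M => ∃ ℓ, IsOrdering M ℓ)
    (fun p _ => card_aval f p) (fun p => (card_aval f p).le) D L hD0 (by
      have h1 : Real.log (Fintype.card ((V ⊕ V) ⊕ C) + Fintype.card J + 2) ≤ 4 * Real.log n := by
        rw [show (4 : ℝ) * Real.log n = (4 : ℕ) * Real.log n by norm_num, ← Real.log_pow]
        refine Real.log_le_log (by positivity) ?_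
        rw [Fintype.card_sum, Fintype.card_sum]
        have : n + n + Fintype.card C + Fintype.card J + 2 ≤ n ^ 4 := by
          have e1 : 11 * n ≤ n ^ 2 := by rw [sq]; exact Nat.mul_le_mul_right _ hn
          have e2 : 11 * n ^ 2 ≤ n ^ 3 := by
            rw [pow_succ n 2, mul_comm]; exact Nat.mul_le_mul_left _ hn
          have e3 : 11 * n ^ 3 ≤ n ^ 4 := by
            rw [pow_succ n 3, mul_comm]; exact Nat.mul_le_mul_left _ hn
          omega
        exact_mod_cast this
      have h2 : K * (Real.log (Fintype.card ((V ⊕ V) ⊕ C) + Fintype.card J + 2) + 1) ≤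
          K * (5 * Real.log n) := mul_le_mul_of_nonneg_left (by linarith) (by linarith)
      refine h2.trans ?_
      rw [hL, le_div_iff₀ (by norm_num)]
      have h3 : K = β * (K / β) := by field_simp
      have h4 := mul_le_mul_of_nonneg_left hKΛ hβ.le
      calc K * (5 * Real.log n) * 16 = β * (K / β) * (5 * Real.log n) * 16 := by rw [← h3]
        _ = β * (80 * (K / β) * Real.log n) := by ring
        _ ≤ _ := h4)
    hvsdeg
    (fun x y hxy => by
      refine (card_aval_pair_le f hf (n / Λ) (by positivity) hloc x y hxy H).trans ?_
      refine hDcast ?_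
      have h1 : (n : ℝ) / Λ * L = β / 16 * n := by rw [hL]; field_simp
      rw [h1]
      refine le_trans (mul_le_mul_of_nonneg_right ?_ (by linarith)) hDn'
      linarith)
    q hq0 (fun j => ∑ p ∈ H, q j p) hQpos (fun _ => rfl)
    (fun j p => by rw [le_div_iff₀ (by positivity)]; exact hbig j p)
    (fun j x => hDcast (by
      have h1 : ∀ p ∈ H.filter (x ∈ aval f ·), q j p ≤ (∑ p ∈ H, q j p) / (D * L) := by
        intro p _; rw [le_div_iff₀ (by positivity)]; exact hbig j p
      have h2 := Finset.sum_le_sum h1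
      rw [sum_const, nsmul_eq_mul] at h2
      have h3 : (#(H.filter (x ∈ aval f ·)) : ℝ) * ((∑ p ∈ H, q j p) / (D * L)) ≤
          D * ((∑ p ∈ H, q j p) / (D * L)) :=
        mul_le_mul_of_nonneg_right (hvsdeg x) (div_nonneg (hQpos j).le (by positivity))
      have h4 : D * ((∑ p ∈ H, q j p) / (D * L)) * L = ∑ p ∈ H, q j p := by
        field_simp
      exact (mul_le_mul_of_nonneg_right (h2.trans h3) hL0.le).trans h4.le))
    ⟨univ.toList, Finset.nodup_toList _, fun v => Finset.mem_toList.2 (mem_univ v),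
      fun p hp => absurd hp (notMem_empty p)⟩
    (fun M _ _ hMP j S _ hS => by
      obtain ⟨ℓ, hℓ⟩ := hMP
      have hdis : ∀ p ∈ S, ∀ p' ∈ M, p' 0 ≠ p 0 ∧ p' 1 ≠ p 1 := by
        intro p hp p' hp'
        have := Finset.disjoint_left.1 ((hS p hp).1 p' hp')
        refine ⟨fun h => this (a := Sum.inl (Sum.inl (p 0))) ?_ ?_,
          fun h => this (a := Sum.inl (Sum.inr (p 1))) ?_ ?_⟩ <;> simp [aval, h]
      have h1 : #S ≤ 2 * n := card_le_of_forall_blocked hℓ S fun p hp => by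
        refine ⟨fun p' hp' => (hdis p hp p' hp').2, ?_⟩
        by_contra hb
        exact (hS p hp).2 (exists_isOrdering_insert hℓ p (fun p' hp' => (hdis p hp p' hp').1)
          (fun p' hp' => (hdis p hp p' hp').2) hb)
      have h2 : (#S : ℝ) ≤ 2 * n := by exact_mod_cast h1
      refine hDcast ?_
      refine le_trans ?_ (hQ j)
      have h3 : ∑ p ∈ S, q j p ≤ #S * (2 * (n / Λ)) := by
        rw [← nsmul_eq_mul, ← sum_const]
        exact Finset.sum_le_sum fun p _ => hq1 j p
      have h4 : (#S : ℝ) * (2 * (n / Λ)) ≤ 2 * n * (2 * (n / Λ)) :=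
        mul_le_mul_of_nonneg_right h2 (by positivity)
      refine (mul_le_mul_of_nonneg_right (h3.trans h4) hL0.le).trans ?_
      have h5 : 2 * (n : ℝ) * (2 * (n / Λ)) * L = 1 / 4 * (β * (n : ℝ) ^ 2) := by
        rw [hL]; field_simp; ring
      rw [h5]
      have : 0 ≤ β * (n : ℝ) ^ 2 := by positivity
      linarith)
  refine ⟨M, hMH, ?_, hMP, hMq⟩
  intro p hp p' hp' hpp
  have := Finset.disjoint_left.1 (hMd p hp p' hp' hpp)
  refine ⟨fun h => this (a := Sum.inl (Sum.inl (p 0))) ?_ ?_,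
    fun h => this (a := Sum.inl (Sum.inr (p 1))) ?_ ?_,
    fun h => this (a := Sum.inr (f (p 0) (p 1))) ?_ ?_⟩ <;> simp [aval, h]

end ArcMatching

section CyclicLists

variable {V : Type}

/-- The edges of the path through the vertices of a list. -/
def pathE : List V → Multiset (Sym2 V)
  | [] => 0
  | [_] => 0
  | a :: b :: t => s(a, b) ::ₘ pathE (b :: t)

/-- The edges of the closed path through the vertices of a list. -/
def cycE : List V → Multiset (Sym2 V)
  | [] => 0
  | a :: t => pathE (a :: t ++ [a])

theorem pathE_append_cons (a : V) (t : List V) :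
    ∀ s : List V, pathE (s ++ a :: t) = pathE (s ++ [a]) + pathE (a :: t)
  | [] => by simp [pathE]
  | [b] => by simp [pathE]
  | b :: c :: s => by
    have := pathE_append_cons a t (c :: s)
    simp only [List.cons_append, pathE, Multiset.cons_add] at this ⊢
    rw [this]

theorem pathE_reverse : ∀ s : List V, pathE s.reverse = pathE s
  | [] => rfl
  | [_] => rfl
  | a :: b :: t => by
    have := pathE_reverse (b :: t)
    rw [List.reverse_cons] at this
    rw [List.reverse_cons, List.reverse_cons, List.append_assoc, List.singleton_append,
      pathE_append_cons, this]
    simp only [pathE, ← Multiset.singleton_add]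
    rw [Sym2.eq_swap, add_comm, add_zero]

theorem cycE_append_comm (s t : List V) : cycE (s ++ t) = cycE (t ++ s) := by
  rcases s with _ | ⟨a, s⟩
  · simp
  rcases t with _ | ⟨b, t⟩
  · simp
  have h1 := pathE_append_cons b (t ++ [a]) (a :: s)
  have h2 := pathE_append_cons a (s ++ [b]) (b :: t)
  simp only [List.cons_append, cycE, List.append_assoc] at h1 h2 ⊢
  rw [h1, h2, add_comm]

theorem cycE_reverse (s : List V) : cycE s.reverse = cycE s := by
  rcases s with _ | ⟨a, s⟩
  · rfl
  rw [List.reverse_cons, cycE_append_comm, List.singleton_append]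
  have := pathE_reverse (a :: s ++ [a])
  simp only [List.reverse_append, List.reverse_cons, List.reverse_nil, List.nil_append,
    List.cons_append] at this
  simpa [cycE] using this

theorem exists_of_mem_pathE {u v : V} : ∀ {ℓ : List V}, s(u, v) ∈ pathE ℓ →
    ∃ s t x y, ℓ = s ++ x :: y :: t ∧ (x = u ∧ y = v ∨ x = v ∧ y = u)
  | [], h => by simp [pathE] at h
  | [_], h => by simp [pathE] at h
  | a :: b :: t, h => by
    rw [pathE, Multiset.mem_cons] at h
    rcases h with h | h
    · refine ⟨[], t, a, b, rfl, ?_⟩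
      rw [Sym2.eq_iff] at h
      rcases h with ⟨h1, h2⟩ | ⟨h1, h2⟩
      · exact Or.inl ⟨h1.symm, h2.symm⟩
      · exact Or.inr ⟨h2.symm, h1.symm⟩
    · obtain ⟨s, r, x, y, h1, h2⟩ := exists_of_mem_pathE h
      exact ⟨a :: s, r, x, y, by rw [h1]; rfl, h2⟩

theorem exists_cycE_of_mem {a b : V} (hab : a ≠ b) {ℓ : List V} (h : s(b, a) ∈ cycE ℓ) :
    ∃ t, (a :: (t ++ [b])).Perm ℓ ∧ cycE (a :: (t ++ [b])) = cycE ℓ := by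
  have key : ∀ x y t, (x = b ∧ y = a ∨ x = a ∧ y = b) → (y :: (t ++ [x])).Perm ℓ →
      cycE (y :: (t ++ [x])) = cycE ℓ →
      ∃ t, (a :: (t ++ [b])).Perm ℓ ∧ cycE (a :: (t ++ [b])) = cycE ℓ := by
    rintro x y t (⟨rfl, rfl⟩ | ⟨rfl, rfl⟩) h1 h2
    · exact ⟨t, h1, h2⟩
    · have e : (y :: (t ++ [x])).reverse = x :: (t.reverse ++ [y]) := by simp
      refine ⟨t.reverse, ?_, ?_⟩
      · rw [← e]; exact (List.reverse_perm _).trans h1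
      · rw [← e, cycE_reverse]; exact h2
  rcases ℓ with _ | ⟨c, r⟩
  · simp [cycE] at h
  obtain ⟨s, t, x, y, h1, h2⟩ := exists_of_mem_pathE h
  have hxy : x ≠ y := by
    rcases h2 with ⟨rfl, rfl⟩ | ⟨rfl, rfl⟩
    · exact hab.symm
    · exact hab
  rcases List.eq_nil_or_concat t with rfl | ⟨t, z, rfl⟩
  · have e : c :: r ++ [c] = (s ++ [x]) ++ [y] := by rw [h1]; simp
    have e1 := List.append_inj_left' e rfl
    have e2 := (List.cons.inj (List.append_inj_right' e rfl)).1
    rcases s with _ | ⟨d, s⟩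
    · exact absurd ((List.cons.inj e1).1.symm.trans e2) hxy
    · have e3 : d = y := (List.cons.inj e1).1.symm.trans e2
      have e4 : y :: (s ++ [x]) = c :: r := by rw [e1, e3]; rfl
      exact key x y s h2 (by rw [e4]) (by rw [e4])
  · have e : c :: r ++ [c] = (s ++ x :: y :: t) ++ [z] := by rw [h1]; simp
    have e1 := List.append_inj_left' e rfl
    have e2 : y :: ((t ++ s) ++ [x]) = (y :: t) ++ (s ++ [x]) := by simp
    have e3 : c :: r = (s ++ [x]) ++ (y :: t) := by rw [e1]; simp
    refine key x y (t ++ s) h2 ?_ ?_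
    · rw [e2, e3]; exact List.perm_append_comm
    · rw [e2, e3]; exact cycE_append_comm _ _

theorem exists_switch {a b u v : V} (hab : a ≠ b) (hu : u ≠ a ∧ u ≠ b) (hv : v ≠ a ∧ v ≠ b)
    {ℓ : List V} {R : Multiset (Sym2 V)} (h : cycE ℓ = s(u, v) ::ₘ s(b, a) ::ₘ R) :
    ∃ ℓ' x y, ℓ'.Perm ℓ ∧ (x = u ∧ y = v ∨ x = v ∧ y = u) ∧
      cycE ℓ' = s(a, y) ::ₘ s(b, x) ::ₘ R := by
  obtain ⟨t, h1, h2⟩ := exists_cycE_of_mem hab (ℓ := ℓ) (by rw [h]; simp)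
  have h3 : cycE (a :: (t ++ [b])) = pathE (a :: (t ++ [b])) + {s(b, a)} := by
    have := pathE_append_cons b [a] (a :: t)
    simpa [cycE, pathE] using this
  have h4 : pathE (a :: (t ++ [b])) = s(u, v) ::ₘ R := by
    have e : pathE (a :: (t ++ [b])) + {s(b, a)} = s(u, v) ::ₘ R + {s(b, a)} := by
      rw [← h3, h2, h, Multiset.cons_swap, add_comm, Multiset.singleton_add]
    exact add_right_cancel e
  obtain ⟨s, r, x, y, h5, h6⟩ := exists_of_mem_pathE (u := u) (v := v) (by
    rw [h4]; exact Multiset.mem_cons_self _ _)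
  have hx : x ≠ a ∧ x ≠ b ∧ y ≠ a ∧ y ≠ b := by
    rcases h6 with ⟨rfl, rfl⟩ | ⟨rfl, rfl⟩
    · exact ⟨hu.1, hu.2, hv.1, hv.2⟩
    · exact ⟨hv.1, hv.2, hu.1, hu.2⟩
  rcases s with _ | ⟨d, s⟩
  · exact absurd (List.cons.inj h5).1.symm hx.1
  have hd : a = d := (List.cons.inj h5).1
  subst hd
  rcases List.eq_nil_or_concat r with rfl | ⟨r, z, rfl⟩
  · have e : (a :: t) ++ [b] = (a :: s ++ [x]) ++ [y] := by simpa using h5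
    exact absurd (List.cons.inj (List.append_inj_right' e rfl)).1.symm hx.2.2.2
  have e : (a :: t) ++ [b] = (a :: s ++ x :: y :: r) ++ [z] := by simpa using h5
  have hz : b = z := (List.cons.inj (List.append_inj_right' e rfl)).1
  subst hz
  have h7 : pathE (a :: s ++ [x]) + pathE (y :: (r ++ [b])) = R := by
    have e1 : a :: (t ++ [b]) = (a :: s) ++ x :: (y :: (r ++ [b])) := by simpa using h5
    have e2 := pathE_append_cons x (y :: (r ++ [b])) (a :: s)
    rw [← e1, h4] at e2
    have e3 : s(u, v) = s(x, y) := by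
      rcases h6 with ⟨rfl, rfl⟩ | ⟨rfl, rfl⟩
      · rfl
      · exact Sym2.eq_swap
    rw [pathE, ← e3, Multiset.add_cons] at e2
    exact ((Multiset.cons_inj_right _).1 e2).symm
  refine ⟨(x :: (s.reverse ++ [a])) ++ (y :: (r ++ [b])), x, y, ?_, h6, ?_⟩
  · refine List.Perm.trans ?_ h1
    have e1 : a :: (t ++ [b]) = (a :: s ++ [x]) ++ (y :: (r ++ [b])) := by simpa using h5
    have e2 : x :: (s.reverse ++ [a]) = (a :: s ++ [x]).reverse := by simp
    rw [e1, e2]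
    exact List.Perm.append_right _ (List.reverse_perm _)
  · have e2 : x :: (s.reverse ++ [a]) = (a :: s ++ [x]).reverse := by simp
    have e3 := pathE_reverse (a :: s ++ [x])
    rw [← e2] at e3
    have e4 := pathE_append_cons a (y :: (r ++ [b] ++ [x])) (x :: s.reverse)
    have e5 := pathE_append_cons b [x] (y :: r)
    simp only [List.cons_append, List.append_assoc, List.nil_append, pathE] at e3 e4 e5 h7 ⊢
    rw [cycE]
    simp only [List.cons_append, List.append_assoc, List.nil_append]
    rw [e4, e5, e3, ← h7]
    simp only [← Multiset.singleton_add]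
    abel

theorem exists_switches {I : Type} [DecidableEq I] (a b u v : I → V) (hab : ∀ i, a i ≠ b i)
    (hu : ∀ i, u i ≠ a i ∧ u i ≠ b i) (hv : ∀ i, v i ≠ a i ∧ v i ≠ b i) (S : Finset I) :
    ∀ (ℓ : List V) (R : Multiset (Sym2 V)),
      cycE ℓ = ∑ i ∈ S, ({s(u i, v i)} + {s(b i, a i)}) + R →
      ∃ ℓ', ∃ x y : I → V, ℓ'.Perm ℓ ∧ (∀ i ∈ S, x i = u i ∧ y i = v i ∨ x i = v i ∧ y i = u i) ∧
        cycE ℓ' = ∑ i ∈ S, ({s(a i, y i)} + {s(b i, x i)}) + R := by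
  induction S using Finset.induction_on with
  | empty =>
    intro ℓ R h
    exact ⟨ℓ, u, v, List.Perm.refl _, by simp, h⟩
  | insert j S hj ih =>
    intro ℓ R h
    rw [Finset.sum_insert hj] at h
    obtain ⟨ℓ₁, x₁, y₁, hp₁, hxy₁, h₁⟩ := exists_switch (hab j) (hu j) (hv j) (ℓ := ℓ)
      (R := ∑ i ∈ S, ({s(u i, v i)} + {s(b i, a i)}) + R) (by
        rw [h]; simp only [← Multiset.singleton_add]; abel)
    obtain ⟨ℓ', x, y, hp, hxy, h'⟩ := ih ℓ₁ ({s(a j, y₁)} + {s(b j, x₁)} + R) (by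
      rw [h₁]; simp only [← Multiset.singleton_add]; abel)
    refine ⟨ℓ', Function.update x j x₁, Function.update y j y₁, hp.trans hp₁, ?_, ?_⟩
    · intro i hi
      by_cases hij : i = j
      · subst hij
        simpa using hxy₁
      · rw [Function.update_of_ne hij, Function.update_of_ne hij]
        exact hxy i ((mem_insert.1 hi).resolve_left hij)
    · rw [h', Finset.sum_insert hj, Function.update_self, Function.update_self]
      have : ∑ i ∈ S, (({s(a i, Function.update y j y₁ i)} : Multiset (Sym2 V)) +
          {s(b i, Function.update x j x₁ i)}) = ∑ i ∈ S, ({s(a i, y i)} + {s(b i, x i)}) := by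
        refine Finset.sum_congr rfl fun i hi => ?_
        have hij : i ≠ j := by rintro rfl; exact hj hi
        rw [Function.update_of_ne hij, Function.update_of_ne hij]
      rw [this]
      abel

theorem pathE_eq_map (σ : V → V) (c : V) : ∀ t : List V,
    (t ++ [c]).IsChain (fun x y => σ x = y) →
      pathE (t ++ [c]) = (t : Multiset V).map fun v => s(v, σ v)
  | [], _ => rfl
  | [a], h => by
    have : σ a = c := by simpa using h
    simp [pathE, this]
  | a :: b :: t, h => by
    simp only [List.cons_append, List.isChain_cons_cons] at h
    have := pathE_eq_map σ c (b :: t) h.2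
    simp only [List.cons_append] at this
    simp only [List.cons_append, pathE, this]
    rw [← h.1]
    simp

theorem cycE_eq_map [DecidableEq V] (ℓ : List V) (h : ℓ.Nodup) :
    cycE ℓ = (ℓ : Multiset V).map fun v => s(v, ℓ.formPerm v) := by
  rcases ℓ with _ | ⟨c, r⟩
  · rfl
  refine pathE_eq_map _ c (c :: r) ?_
  rw [List.isChain_iff_getElem]
  intro i hi
  simp only [List.length_append, List.length_singleton] at hi
  have hi' : i < (c :: r).length := by omega
  rw [List.getElem_append_left hi', List.formPerm_apply_getElem _ h i hi']
  by_cases hlt : i + 1 < (c :: r).length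
  · rw [List.getElem_append_left hlt]
    congr 1
    exact Nat.mod_eq_of_lt hlt
  · have he : i + 1 = (c :: r).length := by omega
    rw [List.getElem_append_right (by omega)]
    simp [he]

theorem formPerm_eq_of_isInfix [DecidableEq V] {ℓ : List V} (h : ℓ.Nodup) {x y : V}
    (hxy : [x, y] <:+: ℓ) : ℓ.formPerm x = y := by
  obtain ⟨s, t, rfl⟩ := hxy
  have h1 : s.length + 1 < (s ++ [x, y] ++ t).length := by simp
  have h2 := List.formPerm_apply_lt_getElem _ h s.length h1
  simpa using h2

end CyclicLists

section Absorption

variable {V C : Type} [DecidableEq V] [DecidableEq C]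

theorem sum_singleton_eq_map {α β : Type} (s : Finset α) (h : α → β) :
    ∑ i ∈ s, ({h i} : Multiset β) = s.val.map h := by
  have := Multiset.map_map (fun b : β => ({b} : Multiset β)) h s.val
  exact (congrArg Multiset.sum this.symm).trans (Multiset.sum_map_singleton _)

/-- The colours and the arc used when the arc `p` absorbs the missing edge between `a` and `b`. -/
def akey (f : V → V → C) (a b : V) (p : Fin 2 → V) : Fin 5 → C ⊕ (Fin 2 → V) :=
  ![Sum.inl (f (p 0) a), Sum.inl (f (p 1) a), Sum.inl (f (p 0) b), Sum.inl (f (p 1) b), Sum.inr p]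

theorem exists_rainbow_cycE [Fintype V] {m : ℕ} (f : V → V → C) (hf : ∀ x y, f x y = f y x)
    (k : C → Fin m) (M : Finset (Fin 2 → V)) (hMH : M ⊆ arcH f k)
    (hM : ∀ p ∈ M, ∀ p' ∈ M, p ≠ p' →
      p 0 ≠ p' 0 ∧ p 1 ≠ p' 1 ∧ f (p 0) (p 1) ≠ f (p' 0) (p' 1))
    (hV : 2 ≤ Fintype.card V) (ℓ : List V) (hℓ : IsOrdering M ℓ)
    (g : {v // ∀ p ∈ M, p 0 ≠ v} → Fin 2 → V)
    (hg : ∀ i : {v // ∀ p ∈ M, p 0 ≠ v}, g i ∈ M ∧ g i ∈ arcQ f k (ℓ.formPerm i) i)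
    (hgk : ∀ i j : {v // ∀ p ∈ M, p 0 ≠ v}, i ≠ j → ∀ s t,
      akey f (ℓ.formPerm i) i (g i) s ≠ akey f (ℓ.formPerm j) j (g j) t) :
    ∃ ℓ' : List V, ℓ'.Nodup ∧ (∀ v, v ∈ ℓ') ∧
      ((cycE ℓ').map (Sym2.lift ⟨f, hf⟩)).Nodup := by
  classical
  obtain ⟨h1, h2, h3⟩ := hℓ
  set σ := ℓ.formPerm with hσ
  have hσM : ∀ p ∈ M, σ (p 0) = p 1 := fun p hp => formPerm_eq_of_isInfix h1 (h3 p hp)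
  have hval : (ℓ : Multiset V) = (univ : Finset V).val := by
    refine (Multiset.Nodup.ext (Multiset.coe_nodup.2 h1) univ.nodup).2 fun v => ?_
    simp [h2 v]
  have hσne : ∀ v, σ v ≠ v := by
    intro v
    refine (List.formPerm_apply_mem_ne_self_iff ℓ h1 v (h2 v)).2 ?_
    rw [← Multiset.coe_card, hval]
    exact hV
  have hginj : Function.Injective g := by
    intro i j hij
    by_contra hne
    exact hgk i j hne 4 4 (congrArg Sum.inr hij)
  have hcls : ∀ p ∈ M, 1 ≤ (k (f (p 0) (p 1))).1 := fun p hp => (mem_filter.1 (hMH hp)).2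
  have hgQ : ∀ i : {v // ∀ p ∈ M, p 0 ≠ v}, ((k (f (g i 0) (σ i))).1 = 0 ∧ (k (f (g i 1) (σ i))).1 = 0 ∧
      (k (f (g i 0) i)).1 = 0 ∧ (k (f (g i 1) i)).1 = 0) ∧
      f (g i 0) (σ i) ≠ f (g i 1) i ∧ f (g i 1) (σ i) ≠ f (g i 0) i :=
    fun i => (mem_filter.1 (hg i).2).2
  have hgM : univ.image g ⊆ M := by
    intro p hp
    obtain ⟨i, -, rfl⟩ := mem_image.1 hp
    exact (hg i).1
  have hdec : cycE ℓ = ∑ i : {v // ∀ p ∈ M, p 0 ≠ v}, ({s(g i 0, g i 1)} + {s((i : V), σ i)}) +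
      ∑ p ∈ M \ univ.image g, {s(p 0, p 1)} := by
    have e1 : ∑ p ∈ M, ({s(p 0, p 1)} : Multiset (Sym2 V)) =
        ∑ v with ¬ ∀ p ∈ M, p 0 ≠ v, {s(v, σ v)} := by
      have : ({v | ¬ ∀ p ∈ M, p 0 ≠ v} : Finset V) = M.image fun p => p 0 := by
        ext v; simp
      rw [this, Finset.sum_image]
      · exact Finset.sum_congr rfl fun p hp => by rw [hσM p hp]
      · intro p hp q hq hpq
        by_contra hne
        exact (hM p hp q hq hne).1 hpq
    have e2 : ∑ i : {v // ∀ p ∈ M, p 0 ≠ v}, ({s((i : V), σ i)} : Multiset (Sym2 V)) =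
        ∑ v with ∀ p ∈ M, p 0 ≠ v, {s(v, σ v)} :=
      (Finset.sum_subtype _ (fun v => by simp) fun v : V =>
        ({s(v, σ v)} : Multiset (Sym2 V))).symm
    have e3 : ∑ i, ({s(g i 0, g i 1)} : Multiset (Sym2 V)) =
        ∑ p ∈ univ.image g, {s(p 0, p 1)} := by
      rw [Finset.sum_image fun i _ j _ hij => hginj hij]
    rw [cycE_eq_map ℓ h1, hval, ← sum_singleton_eq_map,
      ← Finset.sum_filter_add_sum_filter_not univ (fun v => ∀ p ∈ M, p 0 ≠ v), ← e1, ← e2,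
      ← Finset.sum_sdiff hgM, Finset.sum_add_distrib, e3]
    abel
  have hne : ∀ (i : {v // ∀ p ∈ M, p 0 ≠ v}) (z : V), (k (f (g i 0) z)).1 = 0 →
      (k (f (g i 1) z)).1 = 0 → g i 0 ≠ z ∧ g i 1 ≠ z := by
    intro i z hz0 hz1
    have := hcls _ (hg i).1
    constructor
    · rintro rfl
      rw [hf] at hz1
      omega
    · rintro rfl
      omega
  obtain ⟨ℓ', x, y, hp, hxy, h'⟩ := exists_switches (fun i : {v // ∀ p ∈ M, p 0 ≠ v} => σ i) (fun i => (i : V))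
    (fun i => g i 0) (fun i => g i 1) (fun i => hσne i)
    (fun i => ⟨(hne i _ (hgQ i).1.1 (hgQ i).1.2.1).1, (hne i _ (hgQ i).1.2.2.1 (hgQ i).1.2.2.2).1⟩)
    (fun i => ⟨(hne i _ (hgQ i).1.1 (hgQ i).1.2.1).2, (hne i _ (hgQ i).1.2.2.1 (hgQ i).1.2.2.2).2⟩)
    univ ℓ _ hdec
  refine ⟨ℓ', hp.nodup_iff.2 h1, fun v => hp.mem_iff.2 (h2 v), ?_⟩
  have hka : ∀ i : {v // ∀ p ∈ M, p 0 ≠ v}, ∃ t, akey f (σ i) i (g i) t = Sum.inl (f (σ i) (y i)) := by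
    intro i
    rcases hxy i (mem_univ i) with ⟨-, e⟩ | ⟨-, e⟩
    · exact ⟨1, by rw [e, hf]; rfl⟩
    · exact ⟨0, by rw [e, hf]; rfl⟩
  have hkb : ∀ i : {v // ∀ p ∈ M, p 0 ≠ v}, ∃ t, akey f (σ i) i (g i) t = Sum.inl (f i (x i)) := by
    intro i
    rcases hxy i (mem_univ i) with ⟨e, -⟩ | ⟨e, -⟩
    · exact ⟨2, by rw [e, hf]; rfl⟩
    · exact ⟨3, by rw [e, hf]; rfl⟩
  have hab : ∀ i : {v // ∀ p ∈ M, p 0 ≠ v}, f (σ i) (y i) ≠ f i (x i) := by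
    intro i
    rw [hf (σ i), hf i]
    rcases hxy i (mem_univ i) with ⟨e, e'⟩ | ⟨e, e'⟩
    · rw [e, e']; exact (hgQ i).2.2
    · rw [e, e']; exact (hgQ i).2.1
  have hk0 : ∀ i : {v // ∀ p ∈ M, p 0 ≠ v}, (k (f (σ i) (y i))).1 = 0 ∧ (k (f i (x i))).1 = 0 := by
    intro i
    rw [hf (σ i), hf i]
    obtain ⟨⟨q1, q2, q3, q4⟩, -⟩ := hgQ i
    rcases hxy i (mem_univ i) with ⟨e, e'⟩ | ⟨e, e'⟩
    · rw [e, e']; exact ⟨q2, q3⟩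
    · rw [e, e']; exact ⟨q1, q4⟩
  rw [h', Finset.sum_add_distrib, sum_singleton_eq_map, sum_singleton_eq_map,
    sum_singleton_eq_map, Multiset.map_add, Multiset.map_add, Multiset.map_map, Multiset.map_map,
    Multiset.map_map, Multiset.nodup_add, Multiset.nodup_add]
  have hdiff : ∀ i j : {v // ∀ p ∈ M, p 0 ≠ v}, i ≠ j → f (σ i) (y i) ≠ f (σ j) (y j) ∧ f i (x i) ≠ f j (x j) ∧
      f (σ i) (y i) ≠ f j (x j) := by
    intro i j hij
    obtain ⟨t₁, e₁⟩ := hka i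
    obtain ⟨t₂, e₂⟩ := hka j
    obtain ⟨t₃, e₃⟩ := hkb i
    obtain ⟨t₄, e₄⟩ := hkb j
    refine ⟨fun h => hgk i j hij t₁ t₂ ?_, fun h => hgk i j hij t₃ t₄ ?_,
      fun h => hgk i j hij t₁ t₄ ?_⟩
    · rw [e₁, e₂, h]
    · rw [e₃, e₄, h]
    · rw [e₁, e₄, h]
  refine ⟨⟨?_, ?_, ?_⟩, ?_, ?_⟩
  · refine Multiset.Nodup.map_on (fun i _ j _ h => ?_) univ.nodup
    by_contra hij
    exact (hdiff i j hij).1 h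
  · refine Multiset.Nodup.map_on (fun i _ j _ h => ?_) univ.nodup
    by_contra hij
    exact (hdiff i j hij).2.1 h
  · rw [Multiset.disjoint_left]
    intro c hc hc'
    obtain ⟨i, -, rfl⟩ := Multiset.mem_map.1 hc
    obtain ⟨j, -, hj⟩ := Multiset.mem_map.1 hc'
    by_cases hij : i = j
    · subst hij
      exact hab i hj.symm
    · exact (hdiff i j hij).2.2 hj.symm
  · refine Multiset.Nodup.map_on (fun p hp q hq h => ?_) (Finset.nodup _)
    by_contra hpq
    exact (hM p (mem_sdiff.1 hp).1 q (mem_sdiff.1 hq).1 hpq).2.2 h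
  · rw [Multiset.disjoint_left]
    intro c hc hc'
    obtain ⟨p, hp, rfl⟩ := Multiset.mem_map.1 hc'
    have := hcls p (mem_sdiff.1 hp).1
    rcases Multiset.mem_add.1 hc with hc | hc
    · obtain ⟨i, -, hi⟩ := Multiset.mem_map.1 hc
      have h0 := (hk0 i).1
      simp only [Function.comp, Sym2.lift_mk] at hi
      rw [hi] at h0
      omega
    · obtain ⟨i, -, hi⟩ := Multiset.mem_map.1 hc
      have h0 := (hk0 i).2
      simp only [Function.comp, Sym2.lift_mk] at hi
      rw [hi] at h0
      omega

end Absorption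

section ArcCompletion

variable {V C : Type} [Fintype V] [DecidableEq V] [Fintype C] [DecidableEq C]

omit [Fintype C] in
theorem sum_card_arc_key_le {I : Type} [Fintype I] (f : V → V → C) (hf : ∀ x y, f x y = f y x)
    (M : Finset (Fin 2 → V)) (e i : Fin 2) (hM : ∀ p ∈ M, ∀ p' ∈ M, p e = p' e → p = p')
    (G : I → Finset (Fin 2 → V)) (hG : ∀ j, G j ⊆ M) (s : I → V) (hs : Function.Injective s)
    (hsM : ∀ j, ∀ p ∈ M, p i ≠ s j) (c : C) :
    ∑ j, (#{p ∈ G j | f (p e) (s j) = c} : ℝ) ≤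
      ∑ v with ∀ p ∈ M, p i ≠ v, (#{u | f v u = c} + 1 : ℝ) := by
  classical
  calc ∑ j, (#{p ∈ G j | f (p e) (s j) = c} : ℝ)
      ≤ ∑ j, (#{u | f (s j) u = c} + 1 : ℝ) := by
        refine Finset.sum_le_sum fun j _ => ?_
        have : #{p ∈ G j | f (p e) (s j) = c} ≤ #{u | f (s j) u = c} := by
          refine Finset.card_le_card_of_injOn (fun p => p e) ?_ ?_
          · intro p hp
            simp only [coe_filter, Set.mem_ofPred_eq, mem_univ, true_and] at hp ⊢
            rw [hf]; exact hp.2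
          · intro p hp p' hp' h
            simp only [coe_filter, Set.mem_ofPred_eq] at hp hp'
            exact hM p (hG j hp.1) p' (hG j hp'.1) h
        have : (#{p ∈ G j | f (p e) (s j) = c} : ℝ) ≤ #{u | f (s j) u = c} := by
          exact_mod_cast this
        linarith
    _ = ∑ v ∈ univ.image s, (#{u | f v u = c} + 1 : ℝ) := by
        rw [Finset.sum_image fun x _ y _ h => hs h]
    _ ≤ _ := by
        refine Finset.sum_le_sum_of_subset_of_nonneg ?_ fun _ _ _ => by positivity
        intro v hv
        obtain ⟨j, -, rfl⟩ := mem_image.1 hv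
        exact mem_filter.2 ⟨mem_univ _, hsM j⟩

omit [Fintype C] in
theorem exists_rainbow_cycE_of_matching {m : ℕ} (f : V → V → C) (hf : ∀ x y, f x y = f y x)
    (k : C → Fin m) (M : Finset (Fin 2 → V)) (hMH : M ⊆ arcH f k)
    (hM : ∀ p ∈ M, ∀ p' ∈ M, p ≠ p' →
      p 0 ≠ p' 0 ∧ p 1 ≠ p' 1 ∧ f (p 0) (p 1) ≠ f (p' 0) (p' 1))
    (hV : 2 ≤ Fintype.card V) (ℓ : List V) (hℓ : IsOrdering M ℓ) (β γ : ℝ) (hβ : 0 < β)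
    (hγ : 0 ≤ γ) (hγβ : 100 * γ ≤ β ^ 2)
    (hQ : ∀ a b, β * Fintype.card V ≤ #(M ∩ arcQ f k a b))
    (hR : ∀ (i : Fin 2) (c : C), ∑ v with ∀ p ∈ M, p i ≠ v, (#{u | f v u = c} + 1 : ℝ) ≤
      γ * Fintype.card V) :
    ∃ ℓ' : List V, ℓ'.Nodup ∧ (∀ v, v ∈ ℓ') ∧
      ((cycE ℓ').map (Sym2.lift ⟨f, hf⟩)).Nodup := by
  classical
  set n := Fintype.card V with hn
  have hn0 : (0 : ℝ) < n := by exact_mod_cast (by omega : 0 < n)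
  have hσM : ∀ p ∈ M, ℓ.formPerm (p 0) = p 1 := fun p hp =>
    formPerm_eq_of_isInfix hℓ.1 (hℓ.2.2 p hp)
  have hMe : ∀ e : Fin 2, ∀ p ∈ M, ∀ p' ∈ M, p e = p' e → p = p' := by
    intro e p hp p' hp' h
    by_contra hne
    have := hM p hp p' hp' hne
    fin_cases e
    · exact this.1 h
    · exact this.2.1 h
  have hσI : ∀ j : {v // ∀ p ∈ M, p 0 ≠ v}, ∀ p ∈ M, p 1 ≠ ℓ.formPerm j := by
    intro j p hp h
    rw [← hσM p hp] at h
    exact j.2 p hp (ℓ.formPerm.injective h)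
  have hMn : #M ≤ n := Finset.card_le_card_of_injOn (fun p => p 0) (fun _ _ => mem_univ _)
    fun p hp p' hp' h => hMe 0 p hp p' hp' h
  have key1 := fun e : Fin 2 => sum_card_arc_key_le f hf M e 1 (hMe e)
    (fun j : {v // ∀ p ∈ M, p 0 ≠ v} => M ∩ arcQ f k (ℓ.formPerm j) j)
    (fun _ => inter_subset_left) (fun j => ℓ.formPerm j)
    (ℓ.formPerm.injective.comp Subtype.val_injective) hσI
  have key0 := fun e : Fin 2 => sum_card_arc_key_le f hf M e 0 (hMe e)
    (fun j : {v // ∀ p ∈ M, p 0 ≠ v} => M ∩ arcQ f k (ℓ.formPerm j) j)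
    (fun _ => inter_subset_left) (fun j => (j : V)) Subtype.val_injective (fun j => j.2)
  have hI : (Fintype.card {v // ∀ p ∈ M, p 0 ≠ v} : ℝ) ≤ γ * n := by
    obtain ⟨v⟩ : Nonempty V := Fintype.card_pos_iff.1 (by omega)
    refine le_trans ?_ (hR 0 (f v v))
    rw [Fintype.card_subtype, ← nsmul_one, ← sum_const]
    exact Finset.sum_le_sum fun v _ => le_add_of_nonneg_left (Nat.cast_nonneg _)
  have hτ0 : 0 ≤ γ * n := by positivity
  obtain ⟨g, hg, hgk⟩ := exists_key_free 5
    (fun b (j : {v // ∀ p ∈ M, p 0 ≠ v}) p => akey f (ℓ.formPerm j) j p b)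
    (fun j => M ∩ arcQ f k (ℓ.formPerm j) j) (β * n) n (γ * n) (by positivity)
    (fun j => hQ _ _)
    (fun j => by
      exact_mod_cast (Finset.card_le_card inter_subset_left).trans hMn)
    (by
      intro b x
      rcases x with c | q
      · fin_cases b
        · refine le_trans (le_of_eq ?_) ((key1 0 c).trans (hR 1 c))
          simp [akey]
        · refine le_trans (le_of_eq ?_) ((key1 1 c).trans (hR 1 c))
          simp [akey]
        · refine le_trans (le_of_eq ?_) ((key0 0 c).trans (hR 0 c))
          simp [akey]
        · refine le_trans (le_of_eq ?_) ((key0 1 c).trans (hR 0 c))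
          simp [akey]
        · refine le_trans (le_of_eq ?_) hτ0
          simp [akey]
      · fin_cases b
        · refine le_trans (le_of_eq ?_) hτ0
          simp [akey]
        · refine le_trans (le_of_eq ?_) hτ0
          simp [akey]
        · refine le_trans (le_of_eq ?_) hτ0
          simp [akey]
        · refine le_trans (le_of_eq ?_) hτ0
          simp [akey]
        · refine le_trans ?_ hI
          rw [← card_univ, ← nsmul_one, ← sum_const]
          refine Finset.sum_le_sum fun j _ => ?_
          have : #{p ∈ M ∩ arcQ f k (ℓ.formPerm j) j |
              akey f (ℓ.formPerm j) j p 4 = Sum.inr q} ≤ 1 := by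
            rw [Finset.card_le_one]
            intro p hp p' hp'
            have h1 := (mem_filter.1 hp).2
            have h2 := (mem_filter.1 hp').2
            exact (Sum.inr_injective h1).trans (Sum.inr_injective h2).symm
          exact_mod_cast this)
    hτ0
    (by
      have : 100 * γ * (n : ℝ) ^ 2 ≤ β ^ 2 * (n : ℝ) ^ 2 :=
        mul_le_mul_of_nonneg_right hγβ (by positivity)
      push_cast
      nlinarith)
  exact exists_rainbow_cycE f hf k M hMH hM hV ℓ hℓ g (fun i => mem_inter.1 (hg i))
    fun i j hij s t => hgk i j hij s t

end ArcCompletion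

theorem arc_leftover_sum_le {V : Type} [Fintype V] [DecidableEq V]
    (M : Finset (Fin 2 → V)) (i : Fin 2) (hM : ∀ p ∈ M, ∀ p' ∈ M, p i = p' i → p = p')
    (w : V → ℝ)
    (hw : ∀ v, 0 ≤ w v) (n θ δ γ : ℝ) (hθ : 1 / 2 ≤ θ) (hδ0 : 0 < δ) (hδ : δ ≤ γ / 16)
    (hγ0 : 0 < γ) (hγ1 : γ ≤ 1) (hW : ∑ v, w v ≤ 2 * n)
    (h1 : (1 - γ / 4) * ((θ - δ) / (θ + δ) * ∑ v, w v) ≤ ∑ p ∈ M, w (p i)) :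
    ∑ v with ∀ p ∈ M, p i ≠ v, w v ≤ γ * n := by
  have h2 : ∑ v with ∀ p ∈ M, p i ≠ v, w v + ∑ p ∈ M, w (p i) = ∑ v, w v := by
    have e1 : ({v | ∀ p ∈ M, p i ≠ v} : Finset V) = (M.image fun p => p i)ᶜ := by
      ext v; simp
    have e2 : ∑ p ∈ M, w (p i) = ∑ v ∈ M.image fun p => p i, w v := by
      rw [Finset.sum_image fun p hp p' hp' h => hM p hp p' hp' h]
    rw [e1, e2, Finset.sum_compl_add_sum]
  have hW0 : 0 ≤ ∑ v, w v := Finset.sum_nonneg fun v _ => hw v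
  generalize ∑ v, w v = W at *
  generalize ∑ p ∈ M, w (p i) = N at *
  generalize ∑ v with ∀ p ∈ M, p i ≠ v, w v = R at *
  have h3 : 1 - 4 * δ ≤ (θ - δ) / (θ + δ) := by
    rw [le_div_iff₀ (by linarith)]
    nlinarith
  have h4 : (1 - γ / 4) * ((1 - 4 * δ) * W) ≤ (1 - γ / 4) * ((θ - δ) / (θ + δ) * W) :=
    mul_le_mul_of_nonneg_left (mul_le_mul_of_nonneg_right h3 hW0) (by linarith)
  have h5 : (1 - γ / 2) ≤ (1 - γ / 4) * (1 - 4 * δ) := by nlinarith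
  have h6 := mul_le_mul_of_nonneg_right h5 hW0
  have h7 : γ / 2 * W ≤ γ / 2 * (2 * n) := mul_le_mul_of_nonneg_left hW (by positivity)
  have h8 : (1 - γ / 4) * (1 - 4 * δ) * W = (1 - γ / 4) * ((1 - 4 * δ) * W) := by ring
  linarith


set_option maxHeartbeats 1000000 in
theorem exists_rainbow_hamilton (ε : ℝ) (hε : 0 < ε) :
    ∃ (K : ℝ) (n₀ : ℕ), 1 ≤ K ∧ ∀ {V C : Type} [Fintype V] [DecidableEq V] [Fintype C]
      [DecidableEq C] (f : V → V → C) (hf : ∀ x y, f x y = f y x) (_ : n₀ ≤ Fintype.card V)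
      (_ : Fintype.card C ≤ 2 * Fintype.card V ^ 2)
      (_ : ∀ v c, (#{x | f v x = c} : ℝ) ≤
        Fintype.card V / (K * Real.log (Fintype.card V)))
      (_ : ∀ c, (#({q | f q.1 q.2 = c} : Finset (V × V)) : ℝ) ≤ (1 - ε) * Fintype.card V),
      ∃ ℓ : List V, ℓ.Nodup ∧ (∀ v, v ∈ ℓ) ∧
        ((cycE ℓ).map (Sym2.lift ⟨f, hf⟩)).Nodup := by
  obtain ⟨m, hm, hm1, hm2⟩ := exists_reserve_size ε hε
  set θ : ℝ := (m - 1 : ℕ) / (m : ℝ) with hθ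
  have hm0 : (0 : ℝ) < m := by
    have : 0 < m := by omega
    exact_mod_cast this
  have hm1' : (1 : ℝ) ≤ m := by
    have : 1 ≤ m := by omega
    exact_mod_cast this
  have hθm : ((m - 7 : ℕ) / (m : ℝ)) ^ 3 ≤ θ := by
    have h1 : ((m - 7 : ℕ) / (m : ℝ)) ≤ θ := by
      rw [hθ]
      refine div_le_div_of_nonneg_right ?_ hm0.le
      exact_mod_cast Nat.sub_le_sub_left (by norm_num) m
    refine le_trans (pow_le_of_le_one (by positivity) ?_ (by norm_num)) h1
    rw [div_le_one hm0]
    exact_mod_cast Nat.sub_le _ _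
  have hm3 : 1 - ε ≤ θ := hm1.trans hθm
  have hm4 : 1 / 2 ≤ θ := hm2.trans hθm
  have hθ1 : θ ≤ 1 := by
    rw [hθ, div_le_one hm0]
    exact_mod_cast Nat.sub_le _ _
  have hθ0 : 0 < θ := by linarith
  set β : ℝ := θ * (1 / m) ^ 4 / 8 with hβdef
  have hβ : 0 < β := by positivity
  have hm5 : (1 / (m : ℝ)) ^ 4 ≤ 1 :=
    pow_le_one₀ (by positivity) (by rw [div_le_one hm0]; exact hm1')
  have hβ1 : β ≤ 1 / 8 := by
    have := mul_le_mul hθ1 hm5 (by positivity) zero_le_one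
    rw [hβdef]; linarith
  set β' : ℝ := β / 4 with hβ'
  have hβ'0 : 0 < β' := by positivity
  set γ₁ : ℝ := β' ^ 2 / 100 with hγ₁
  have hγ₁0 : 0 < γ₁ := by positivity
  have hγ₁1 : γ₁ ≤ 1 := by
    have : β' ^ 2 ≤ 1 := pow_le_one₀ hβ'0.le (by rw [hβ']; linarith)
    rw [hγ₁]; linarith
  set δ : ℝ := min β (γ₁ / 16) with hδ
  have hδ0 : 0 < δ := by positivity
  have hδβ : δ ≤ β := min_le_left _ _
  have hδγ : δ ≤ γ₁ / 16 := min_le_right _ _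
  obtain ⟨K₁, hK₁, lottery⟩ := exists_arc_lottery m (by omega) δ hδ0 (by linarith)
  obtain ⟨K₂, hK₂, matching⟩ := exists_arc_matching (γ₁ / 4) β (by positivity) hβ (by linarith)
  set K : ℝ := K₁ + K₂ with hK
  obtain ⟨n₁, hn₁⟩ := exists_log_le K 1 zero_lt_one
  refine ⟨K, max 11 n₁, by linarith, ?_⟩
  intro V C _ _ _ _ f hf hn hC hloc hglob
  classical
  have hn11 : 11 ≤ Fintype.card V := (le_max_left _ _).trans hn
  have hKn := hn₁ _ ((le_max_right _ _).trans hn)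
  set n := Fintype.card V with hndef
  have hn' : (11 : ℝ) ≤ n := by exact_mod_cast hn11
  have hlog : 1 ≤ Real.log n := by
    rw [Real.le_log_iff_exp_le (by linarith)]
    linarith [Real.exp_one_lt_d9]
  set Λ : ℝ := K * Real.log n with hΛ
  have hKΛ : K ≤ Λ := le_mul_of_one_le_right (by linarith) hlog
  have hΛ0 : 0 < Λ := by linarith
  have hΛn : Λ ≤ n := by linarith
  have hnΛ : 1 ≤ (n : ℝ) / Λ := by rw [le_div_iff₀ hΛ0]; linarith
  obtain ⟨k, hk1, hk2⟩ := lottery f hf Λ hn11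
    (mul_le_mul_of_nonneg_right (by linarith) (by linarith)) hloc
  have hK₂Λ : K₂ * Real.log n ≤ Λ := by
    rw [hΛ]
    exact mul_le_mul_of_nonneg_right (by linarith) (by linarith)
  rw [← hθ] at hk1 hk2
  clear_value Λ K δ γ₁ β' β θ
  let w : C → V → ℝ := fun c v => #{u | f v u = c} + 1
  have hwsum : ∀ c, ∑ v, w c v = #({q | f q.1 q.2 = c} : Finset (V × V)) + n := by
    intro c
    simp only [w]
    rw [sum_add_distrib, sum_const, card_univ, nsmul_one]
    congr 1
    have : #({q | f q.1 q.2 = c} : Finset (V × V)) = ∑ v, #{u | f v u = c} := by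
      rw [Finset.card_eq_sum_card_fiberwise (f := Prod.fst) (t := univ) (fun _ _ => mem_univ _)]
      refine Finset.sum_congr rfl fun v _ => ?_
      refine Finset.card_nbij' (fun q => q.2) (fun u => (v, u)) ?_ ?_ ?_ ?_
      · rintro ⟨a, b⟩ h
        simp only [coe_filter, Set.mem_ofPred_eq, mem_filter, mem_univ, true_and] at h ⊢
        rw [← h.2]; exact h.1
      · intro u h
        simpa using h
      · rintro ⟨a, b⟩ h
        simp only [coe_filter, Set.mem_ofPred_eq, mem_filter, mem_univ, true_and] at h
        rw [← h.2]
      · intro u h; rfl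
    exact_mod_cast this.symm
  have hglob' : ∀ c, (#({q | f q.1 q.2 = c} : Finset (V × V)) : ℝ) ≤ θ * n := fun c =>
    (hglob c).trans (mul_le_mul_of_nonneg_right hm3 (by linarith))
  have hglob1 : ∀ c, (#({q | f q.1 q.2 = c} : Finset (V × V)) : ℝ) ≤ n := fun c =>
    (hglob' c).trans (by nlinarith)
  have hwH : ∀ i c, (θ - δ) * n * ∑ v, w c v ≤ ∑ p ∈ arcH f k, w c (p i) := by
    intro i c
    rw [← Finset.sum_fiberwise (arcH f k) (fun p => p i), mul_sum]
    refine Finset.sum_le_sum fun v _ => ?_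
    rw [Finset.sum_congr rfl (g := fun _ => w c v) fun p hp => by rw [(mem_filter.1 hp).2],
      sum_const, nsmul_eq_mul]
    refine mul_le_mul_of_nonneg_right ?_ (by positivity)
    have := (abs_le.1 (hk1 i v)).1
    linarith
  let q : (Fin 2 × C) ⊕ (V × V) → (Fin 2 → V) → ℝ :=
    Sum.elim (fun j p => w j.2 (p j.1)) fun j p => if p ∈ arcQ f k j.1 j.2 then 1 else 0
  have hqH : ∀ (M : Finset (Fin 2 → V)) a b, ∑ p ∈ M, q (Sum.inr (a, b)) p =
      #(M ∩ arcQ f k a b) := by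
    intro M a b
    simp only [q, Sum.elim_inr, Finset.sum_boole]
    rw [Finset.filter_mem_eq_inter]
  have hqQ : ∀ a b, β * (n : ℝ) ^ 2 ≤ ∑ p ∈ arcH f k, q (Sum.inr (a, b)) p := by
    intro a b
    have hsub : arcQ f k a b ⊆ arcH f k := Finset.filter_subset _ _
    rw [hqH, Finset.inter_eq_right.2 hsub]
    refine le_trans (mul_le_mul_of_nonneg_right ?_ (by positivity)) (hk2 a b)
    rw [hβdef] at hδβ ⊢
    linarith
  obtain ⟨M, hMH, hMd, ⟨ℓ, hℓ⟩, hMq⟩ := matching (J := (Fin 2 × C) ⊕ (V × V)) f hf Λ hn11 hC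
    (by
      rw [Fintype.card_sum, Fintype.card_prod, Fintype.card_prod, Fintype.card_fin, ← hndef]
      have : 11 * n ^ 2 ≤ n * n ^ 2 := Nat.mul_le_mul_right _ hn11
      calc 2 * Fintype.card C + n * n ≤ 11 * n ^ 2 := by nlinarith
        _ ≤ _ := by rw [pow_succ' n 2]; exact this)
    hK₂Λ hΛn hloc θ δ hm4 hθ1 hδ0 (by linarith) hglob' (arcH f k) hk1 q
    (by
      rintro (j | j) p
      · simp only [q, w, Sum.elim_inl]; positivity
      · simp only [q, Sum.elim_inr]; positivity)
    (by
      rintro (j | j) p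
      · have := hloc (p j.1) j.2
        simp only [q, w, Sum.elim_inl]
        linarith
      · simp only [q, Sum.elim_inr]
        split_ifs <;> linarith)
    (by
      rintro (j | j)
      · refine le_trans ?_ (hwH j.1 j.2)
        have h1 : (n : ℝ) ≤ ∑ v, w j.2 v := by
          rw [hwsum]
          exact le_add_of_nonneg_left (Nat.cast_nonneg _)
        have h2 : β ≤ θ - δ := by linarith
        have h3 : β * n ≤ (θ - δ) * n := mul_le_mul_of_nonneg_right h2 (by linarith)
        calc β * (n : ℝ) ^ 2 = β * n * n := by ring
          _ ≤ _ := mul_le_mul h3 h1 (by linarith) (by nlinarith)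
      · exact hqQ j.1 j.2)
  have hθδ : 0 < (θ + δ) * n := by positivity
  refine exists_rainbow_cycE_of_matching f hf k M hMH hMd (by omega) ℓ hℓ β' γ₁ hβ'0 hγ₁0.le
    (by rw [hγ₁]; linarith) (fun a b => ?_) (fun i c => ?_)
  · rw [← hqH]
    refine le_trans ?_ (hMq _)
    have h1 : β / 2 * n ≤ (∑ p ∈ arcH f k, q (Sum.inr (a, b)) p) / ((θ + δ) * n) := by
      rw [le_div_iff₀ hθδ]
      refine le_trans ?_ (hqQ a b)
      have h2 : θ + δ ≤ 2 := by linarith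
      have h3 : β / 2 * (n : ℝ) ^ 2 * (θ + δ) ≤ β / 2 * (n : ℝ) ^ 2 * 2 :=
        mul_le_mul_of_nonneg_left h2 (by positivity)
      linarith
    have h2 : 0 ≤ β / 2 * n := by positivity
    rw [hβ', ← hndef]
    nlinarith
  · refine arc_leftover_sum_le M i ?_ (w c) (fun v => by positivity) n θ δ γ₁ hm4 hδ0 hδγ hγ₁0
      hγ₁1 (by rw [hwsum]; linarith [hglob1 c]) ?_
    · intro p hp p' hp' h
      by_contra hne
      have := hMd p hp p' hp' hne
      fin_cases i
      · exact this.1 h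
      · exact this.2.1 h
    · refine le_trans (mul_le_mul_of_nonneg_left ?_ (by linarith)) (hMq (Sum.inl (i, c)))
      rw [le_div_iff₀ hθδ]
      refine le_trans (le_of_eq ?_) (hwH i c)
      have : θ + δ ≠ 0 := by linarith
      field_simp


theorem exists_walk_of_isChain {V : Type} : ∀ (t : List V) (a b : V),
    (a :: (t ++ [b])).IsChain (· ≠ ·) → ∃ w : (⊤ : SimpleGraph V).Walk a b,
      w.support = a :: (t ++ [b]) ∧ (w.edges : Multiset (Sym2 V)) = pathE (a :: (t ++ [b]))
  | [], a, b, h => by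
    have hab : a ≠ b := (List.isChain_cons_cons.1 h).1
    exact ⟨.cons ((SimpleGraph.top_adj a b).2 hab) .nil, rfl, by simp [pathE]⟩
  | c :: t, a, b, h => by
    obtain ⟨hac, h'⟩ := List.isChain_cons_cons.1 h
    obtain ⟨w, hw, he⟩ := exists_walk_of_isChain t c b h'
    refine ⟨.cons ((SimpleGraph.top_adj a c).2 hac) w, ?_, ?_⟩
    · rw [SimpleGraph.Walk.support_cons, hw]; rfl
    · rw [SimpleGraph.Walk.edges_cons, ← Multiset.cons_coe, he]
      rfl

theorem exists_isHamiltonianCycle_of_nodup {V : Type} [DecidableEq V] (ℓ : List V)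
    (h : ℓ.Nodup) (hall : ∀ v, v ∈ ℓ) (hlen : 2 ≤ ℓ.length) (hcyc : (cycE ℓ).Nodup) :
    ∃ (v : V) (w : (⊤ : SimpleGraph V).Walk v v), w.IsHamiltonianCycle ∧
      (w.edges : Multiset (Sym2 V)) = cycE ℓ := by
  rcases ℓ with _ | ⟨a, t⟩
  · simp at hlen
  have ht : t ≠ [] := by
    rintro rfl
    simp at hlen
  have hch : (a :: (t ++ [a])).IsChain (· ≠ ·) := by
    rw [← List.cons_append, List.isChain_append]
    refine ⟨h.isChain, .singleton a, ?_⟩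
    intro x hx y hy
    have hya : a = y := by simpa using hy
    subst hya
    rcases t with _ | ⟨b, t⟩
    · exact absurd rfl ht
    rw [List.getLast?_cons_cons] at hx
    rintro rfl
    exact (List.nodup_cons.1 h).1 (List.mem_of_getLast? hx)
  obtain ⟨w, hw, he⟩ := exists_walk_of_isChain t a a hch
  have he' : (w.edges : Multiset (Sym2 V)) = cycE (a :: t) := he
  have hsup : w.support.tail = t ++ [a] := by rw [hw]; rfl
  have hnd : (t ++ [a]).Nodup := by
    rw [List.nodup_append_comm]; exact h
  refine ⟨a, w, ?_, he'⟩
  rw [SimpleGraph.Walk.isHamiltonianCycle_iff_isCycle_and_support_count_tail_eq_one]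
  refine ⟨⟨⟨⟨?_⟩, ?_⟩, ?_⟩, ?_⟩
  · rw [← Multiset.coe_nodup, he']
    exact hcyc
  · rintro rfl
    simp at hsup
  · rw [hsup]; exact hnd
  · intro v
    rw [hsup]
    refine List.count_eq_one_of_mem hnd ?_
    rw [List.mem_append, List.mem_singleton, or_comm, ← List.mem_cons]
    exact hall v


theorem exists_isFFactorSub_of_bijective {V : Type} (Y : Type) (g : Y → Fin 3 → V)
    (hg : Function.Bijective (fun q : Y × Fin 3 => g q.1 q.2)) :
    ∃ L : (⊤ : SimpleGraph V).Subgraph,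
      IsFFactorSub (⊤ : SimpleGraph (Fin 3)) L ∧ L.IsSpanning ∧
      ∀ e ∈ L.edgeSet, ∃ q : Y × Fin 3, e = s(g q.1 q.2, g q.1 (q.2 + 1)) := by
  have hinj : ∀ y y' i i', g y i = g y' i' → y = y' ∧ i = i' := fun y y' i i' h =>
    Prod.mk.inj (hg.1 (a₁ := (y, i)) (a₂ := (y', i')) h)
  let T : Y → (⊤ : SimpleGraph V).Subgraph := fun y =>
    (⊤ : (⊤ : SimpleGraph V).Subgraph).induce (Set.range (g y))
  have hT : ∀ y u v, (T y).Adj u v ↔ u ∈ Set.range (g y) ∧ v ∈ Set.range (g y) ∧ u ≠ v := by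
    intro y u v
    simp [T]
  have h3 : ∀ i j : Fin 3, i ≠ j → j = i + 1 ∨ i = j + 1 := by decide
  refine ⟨sSup (Set.range T), ⟨Set.range T, ?_, ?_, rfl⟩, ?_, ?_⟩
  · rintro _ ⟨y, rfl⟩
    refine ⟨⟨Equiv.ofBijective (fun i => ⟨g y i, Set.mem_range_self i⟩) ⟨?_, ?_⟩, ?_⟩⟩
    · intro i j hij
      exact (hinj _ _ _ _ (Subtype.ext_iff.1 hij)).2
    · rintro ⟨_, i, rfl⟩
      exact ⟨i, rfl⟩
    · intro i j
      rw [SimpleGraph.Subgraph.coe_adj, hT]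
      exact ⟨fun h hij => h.2.2 (congrArg (g y) hij), fun h => ⟨Set.mem_range_self i,
        Set.mem_range_self j, fun hij => h (hinj _ _ _ _ hij).2⟩⟩
  · rintro _ ⟨y, rfl⟩ _ ⟨y', rfl⟩ hne
    rw [Set.disjoint_left]
    rintro _ ⟨i, rfl⟩ ⟨j, hj⟩
    exact hne (congrArg T (hinj _ _ _ _ hj).1.symm)
  · intro v
    obtain ⟨⟨y, i⟩, rfl⟩ := hg.2 v
    rw [SimpleGraph.Subgraph.verts_sSup]
    exact Set.mem_biUnion (Set.mem_range_self y) (Set.mem_range_self i)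
  · intro e
    induction e using Sym2.ind with
    | _ u v =>
      intro he
      rw [SimpleGraph.Subgraph.mem_edgeSet, SimpleGraph.Subgraph.sSup_adj] at he
      obtain ⟨_, ⟨y, rfl⟩, h⟩ := he
      obtain ⟨⟨i, rfl⟩, ⟨j, rfl⟩, hij⟩ := (hT _ _ _).1 h
      have hij' : i ≠ j := fun h => hij (congrArg _ h)
      have : j = i + 1 ∨ i = j + 1 := h3 i j hij'
      rcases this with rfl | rfl
      · exact ⟨(y, i), rfl⟩
      · exact ⟨(y, j), Sym2.eq_swap⟩


section DiagonalColours

variable {V : Type} [Fintype V] [DecidableEq V]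

/-- An edge-colouring of the complete graph, extended by a new colour for each loop. -/
def loopCol (φ : Sym2 V → ℕ) (x y : V) : univ.image φ ⊕ V :=
  if x = y then Sum.inr x else Sum.inl ⟨φ s(x, y), mem_image_of_mem φ (mem_univ _)⟩

theorem loopCol_comm (φ : Sym2 V → ℕ) (x y : V) : loopCol φ x y = loopCol φ y x := by
  unfold loopCol
  by_cases h : x = y
  · subst h; rfl
  · rw [if_neg h, if_neg (Ne.symm h)]
    simp only [Sym2.eq_swap (a := x)]

theorem loopCol_eq_inl (φ : Sym2 V → ℕ) {x y : V} {c : univ.image φ} :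
    loopCol φ x y = Sum.inl c ↔ x ≠ y ∧ φ s(x, y) = c := by
  unfold loopCol
  split_ifs with h
  · simp [h]
  · simp [h, Subtype.ext_iff]

theorem loopCol_eq_inr (φ : Sym2 V → ℕ) {x y z : V} :
    loopCol φ x y = Sum.inr z ↔ x = z ∧ y = z := by
  unfold loopCol
  split_ifs with h
  · subst h; simp
  · simp only [false_iff]
    rintro ⟨rfl, rfl⟩
    exact h rfl

theorem loopCol_congr (φ : Sym2 V → ℕ) {x y x' y' : V} (h : x ≠ y) (h' : x' ≠ y')
    (he : φ s(x, y) = φ s(x', y')) : loopCol φ x y = loopCol φ x' y' := by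
  unfold loopCol
  rw [if_neg h, if_neg h']
  simp only [he]

omit [DecidableEq V] in
theorem card_loopCol_colours_le (φ : Sym2 V → ℕ) :
    Fintype.card (univ.image φ ⊕ V) ≤ 2 * Fintype.card V ^ 2 := by
  rw [Fintype.card_sum, Fintype.card_coe]
  have h1 : #(univ.image φ) ≤ Fintype.card (V × V) := by
    refine Finset.card_image_le.trans ?_
    exact Fintype.card_le_of_surjective (fun q : V × V => s(q.1, q.2)) fun e => by
      induction e using Sym2.ind with
      | _ x y => exact ⟨(x, y), rfl⟩
  rw [Fintype.card_prod] at h1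
  have : Fintype.card V ≤ Fintype.card V ^ 2 := Nat.le_self_pow (by norm_num) _
  nlinarith

theorem card_loopCol_local_le (φ : Sym2 V → ℕ) (l : ℝ) (hl : 1 ≤ l)
    (h : LBounded (⊤ : SimpleGraph V) φ l) (v : V) (c : univ.image φ ⊕ V) :
    (#{u | loopCol φ v u = c} : ℝ) ≤ l := by
  rcases c with c | z
  · refine le_trans (le_of_eq ?_) (h v c)
    rw [← Set.ncard_coe_finset]
    congr 2
    ext u
    simp [loopCol_eq_inl]
  · have : #{u | loopCol φ v u = Sum.inr z} ≤ 1 := by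
      rw [Finset.card_le_one]
      intro a ha b hb
      simp only [mem_filter, mem_univ, true_and, loopCol_eq_inr] at ha hb
      rw [ha.2, hb.2]
    have : (#{u | loopCol φ v u = Sum.inr z} : ℝ) ≤ 1 := by exact_mod_cast this
    linarith

theorem card_loopCol_global_le (φ : Sym2 V → ℕ) (b : ℝ) (hb : 1 ≤ b)
    (h : GBounded (⊤ : SimpleGraph V) φ (b / 2)) (c : univ.image φ ⊕ V) :
    (#({q | loopCol φ q.1 q.2 = c} : Finset (V × V)) : ℝ) ≤ b := by
  rcases c with c | z
  · have h1 := Finset.card_le_mul_card_image (f := fun q : V × V => s(q.1, q.2))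
      ({q | loopCol φ q.1 q.2 = Sum.inl c} : Finset (V × V)) 2 (by
        intro e _
        induction e using Sym2.ind with
        | _ x y =>
          refine le_trans (Finset.card_le_card (t := {(x, y), (y, x)}) ?_) Finset.card_le_two
          rintro ⟨a, b⟩ hq
          have := (mem_filter.1 hq).2
          simpa using this)
    have h2 : #(({q | loopCol φ q.1 q.2 = Sum.inl c} : Finset (V × V)).image
        fun q => s(q.1, q.2)) ≤ (colourCls (⊤ : SimpleGraph V) φ c).ncard := by
      rw [← Set.ncard_coe_finset]
      refine Set.ncard_le_ncard ?_ (Set.toFinite _)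
      intro e he
      obtain ⟨⟨x, y⟩, hq, rfl⟩ := mem_image.1 (mem_coe.1 he)
      simp only [mem_filter, mem_univ, true_and, loopCol_eq_inl] at hq
      exact ⟨(SimpleGraph.top_adj x y).2 hq.1, hq.2⟩
    have h3 : (#({q | loopCol φ q.1 q.2 = Sum.inl c} : Finset (V × V)) : ℝ) ≤
        2 * (colourCls (⊤ : SimpleGraph V) φ c).ncard := by
      exact_mod_cast h1.trans (Nat.mul_le_mul_left 2 h2)
    linarith [h c]
  · have : #({q | loopCol φ q.1 q.2 = Sum.inr z} : Finset (V × V)) ≤ 1 := by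
      rw [Finset.card_le_one]
      rintro ⟨a, a'⟩ ha ⟨b, b'⟩ hb
      simp only [mem_filter, mem_univ, true_and, loopCol_eq_inr] at ha hb
      rw [ha.1, ha.2, hb.1, hb.2]
    have : (#({q | loopCol φ q.1 q.2 = Sum.inr z} : Finset (V × V)) : ℝ) ≤ 1 := by
      exact_mod_cast this
    linarith

theorem exists_isHamiltonianCycle_rainbow (φ : Sym2 V → ℕ) (ℓ : List V) (h : ℓ.Nodup)
    (hall : ∀ v, v ∈ ℓ) (hV : 2 ≤ Fintype.card V)
    (hr : ((cycE ℓ).map (Sym2.lift ⟨loopCol φ, loopCol_comm φ⟩)).Nodup) :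
    ∃ (v : V) (w : (⊤ : SimpleGraph V).Walk v v), w.IsHamiltonianCycle ∧
      (w.edges.map φ).Nodup := by
  have hcyc : (cycE ℓ).Nodup := hr.of_map
  have hlen : 2 ≤ ℓ.length := by
    have : ℓ.toFinset = univ := by ext v; simp [hall v]
    have h1 := List.toFinset_card_of_nodup h
    rw [this, card_univ] at h1
    omega
  obtain ⟨v, w, hw, he⟩ := exists_isHamiltonianCycle_of_nodup ℓ h hall hlen hcyc
  refine ⟨v, w, hw, ?_⟩
  rw [← he, Multiset.map_coe, Multiset.coe_nodup] at hr
  refine List.Nodup.map_on ?_ (List.Nodup.of_map _ hr)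
  intro e h1 e' h2 hφ
  refine List.inj_on_of_nodup_map hr h1 h2 ?_
  have h1' := w.edges_subset_edgeSet h1
  have h2' := w.edges_subset_edgeSet h2
  induction e using Sym2.ind with
  | _ x y =>
    induction e' using Sym2.ind with
    | _ x' y' =>
      rw [SimpleGraph.mem_edgeSet, SimpleGraph.top_adj] at h1' h2'
      exact loopCol_congr φ h1' h2' hφ

theorem exists_rainbow_isFFactorSub (φ : Sym2 V → ℕ) (Y : Type) (g : Y → Fin 3 → V)
    (hg : Function.Bijective (fun q : Y × Fin 3 => g q.1 q.2))
    (hr : Function.Injective (fun q : Y × Fin 3 => tcol (loopCol φ) (g q.1) q.2)) :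
    ∃ L : (⊤ : SimpleGraph V).Subgraph,
      IsFFactorSub (⊤ : SimpleGraph (Fin 3)) L ∧ L.IsSpanning ∧ Rainbow φ L.edgeSet := by
  obtain ⟨L, h1, h2, h3⟩ := exists_isFFactorSub_of_bijective Y g hg
  refine ⟨L, h1, h2, ?_⟩
  intro e he e' he' hφ
  have hne : ∀ q : Y × Fin 3, g q.1 q.2 ≠ g q.1 (q.2 + 1) := by
    intro q h
    have := (Prod.mk.inj (hg.1 (a₁ := (q.1, q.2)) (a₂ := (q.1, q.2 + 1)) h)).2
    have h4 : ∀ i : Fin 3, i ≠ i + 1 := by decide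
    exact h4 _ this
  obtain ⟨q, rfl⟩ := h3 e he
  obtain ⟨q', rfl⟩ := h3 e' he'
  have : q = q' := hr (loopCol_congr φ (hne q) (hne q') hφ)
  rw [this]

end DiagonalColours

theorem exists_div_log_pow_le (K : ℝ) (hK : 1 ≤ K) : ∃ n₀ : ℕ, ∀ n : ℕ, n₀ ≤ n →
    1 ≤ (n : ℝ) / (K * Real.log n) ∧
    (n : ℝ) / Real.log n ^ 4 ≤ n / (K * Real.log n) := by
  obtain ⟨n₁, hn₁⟩ := exists_log_le K 1 zero_lt_one
  obtain ⟨n₂, hn₂⟩ := exists_nat_ge (Real.exp K)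
  refine ⟨max n₁ n₂, fun n hn => ?_⟩
  have h1 := hn₁ n ((le_max_left _ _).trans hn)
  have h2 : Real.exp K ≤ n := hn₂.trans (by exact_mod_cast (le_max_right _ _).trans hn)
  have hn0 : (0 : ℝ) < n := (Real.exp_pos K).trans_le h2
  have h3 : K ≤ Real.log n := (Real.le_log_iff_exp_le hn0).2 h2
  have h4 : 0 < K * Real.log n := mul_pos (by linarith) (by linarith)
  refine ⟨?_, ?_⟩
  · rw [le_div_iff₀ h4]; linarith
  · refine div_le_div_of_nonneg_left hn0.le h4 ?_
    have h5 : 1 ≤ Real.log n := hK.trans h3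
    calc K * Real.log n ≤ Real.log n * Real.log n :=
          mul_le_mul_of_nonneg_right h3 (by linarith)
      _ = Real.log n ^ 2 := by ring
      _ ≤ Real.log n ^ 4 := pow_le_pow_right₀ h5 (by norm_num)

end RainbowProof

/-- Corollary 1.2: any `(1-ε)n/2`-bounded, locally `ηn/log⁴n`-bounded edge-colouring of
`K_n` contains a rainbow Hamilton cycle, and (if `3 ∣ n`) a rainbow triangle-factor. -/
theorem stmt_1 :
    ∀ ε : ℝ, 0 < ε →
    ∃ η : ℝ, 0 < η ∧ ∃ n₀ : ℕ, ∀ n : ℕ, n₀ ≤ n →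
    ∀ φ : Sym2 (Fin n) → ℕ,
      GBounded (⊤ : SimpleGraph (Fin n)) φ ((1 - ε) * n / 2) →
      LBounded (⊤ : SimpleGraph (Fin n)) φ (η * n / (Real.log n) ^ 4) →
      (∃ (v : Fin n) (w : (⊤ : SimpleGraph (Fin n)).Walk v v),
          w.IsHamiltonianCycle ∧ (w.edges.map φ).Nodup) ∧
      (3 ∣ n →
        ∃ L : (⊤ : SimpleGraph (Fin n)).Subgraph,
          IsFFactorSub (⊤ : SimpleGraph (Fin 3)) L ∧ L.IsSpanning ∧
          Rainbow φ L.edgeSet) := by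
  intro ε hε
  have hε' : 0 < min ε (1 / 2) := by positivity
  obtain ⟨K₁, n₁, hK₁, ham⟩ := RainbowProof.exists_rainbow_hamilton (min ε (1 / 2)) hε'
  obtain ⟨K₂, n₂, hK₂, tri⟩ := RainbowProof.exists_rainbow_triangle_factor (min ε (1 / 2)) hε'
  obtain ⟨n₃, hn₃⟩ := RainbowProof.exists_div_log_pow_le K₁ hK₁
  obtain ⟨n₄, hn₄⟩ := RainbowProof.exists_div_log_pow_le K₂ hK₂
  refine ⟨1, zero_lt_one, n₁ + n₂ + n₃ + n₄ + 2, fun n hn φ hglob hloc => ?_⟩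
  obtain ⟨h31, h32⟩ := hn₃ n (by omega)
  obtain ⟨h41, h42⟩ := hn₄ n (by omega)
  have hn2 : (2 : ℝ) ≤ n := by exact_mod_cast (by omega : 2 ≤ n)
  have hb : 1 ≤ (1 - min ε (1 / 2)) * (n : ℝ) := by
    nlinarith [min_le_right ε (1 / 2)]
  have hb' : (1 - ε) * (n : ℝ) ≤ (1 - min ε (1 / 2)) * n := by
    nlinarith [min_le_left ε (1 / 2)]
  rw [one_mul] at hloc
  have hg := RainbowProof.card_loopCol_global_le φ _ hb fun c => (hglob c).trans (by linarith)
  have hC := RainbowProof.card_loopCol_colours_le φ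
  constructor
  · have hl := RainbowProof.card_loopCol_local_le φ _ h31 fun v c => (hloc v c).trans h32
    obtain ⟨ℓ, hℓ, hall, hr⟩ := ham (RainbowProof.loopCol φ) (RainbowProof.loopCol_comm φ)
      (by rw [Fintype.card_fin]; omega) hC (by simpa only [Fintype.card_fin] using hl)
      (by simpa only [Fintype.card_fin] using hg)
    exact RainbowProof.exists_isHamiltonianCycle_rainbow φ ℓ hℓ hall
      (by rw [Fintype.card_fin]; omega) hr
  · intro h3
    have hl := RainbowProof.card_loopCol_local_le φ _ h41 fun v c => (hloc v c).trans h42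
    obtain ⟨Y, _, g, hgb, hr⟩ := tri (RainbowProof.loopCol φ) (RainbowProof.loopCol_comm φ)
      (by rw [Fintype.card_fin]; omega) hC (by rwa [Fintype.card_fin])
      (by simpa only [Fintype.card_fin] using hl) (by simpa only [Fintype.card_fin] using hg)
    exact RainbowProof.exists_rainbow_isFFactorSub φ Y g hgb hr
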